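/- Let d ≥ 4, 1 < p < 2(d−1)/(d+1) and p ≤ q ≤ ∞. Then for all measurable f : ℝ × ℝ^d → ℂ, ‖ ∫_ℝ (K_r ∗ f(r,·)) dr ‖_{L^{p,q}(ℝ^d)}^p ≤ C ∫_{ℝ^d} ‖ f(·,y) / (1+|·|)^{(d−1)/2} ‖_{L^{p,q}(ν_d)}^p dy, with C independent of f. -/

import Mathlib

open MeasureTheory Real Set
open scoped Classical FourierTransform RealInnerProductSpace NNReal ENNReal

noncomputable section

/-- Euclidean space `ℝ^d`. -/
abbrev Rd (d : ℕ) := EuclideanSpace ℝ (Fin d)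

/-- `a` is a "distance function": smooth away from the origin, positive away from the
origin, and homogeneous of degree one. -/
structure IsDistFn {d : ℕ} (a : Rd d → ℝ) : Prop where
  smooth : ContDiffOn ℝ (⊤ : ℕ∞) a {ξ : Rd d | ξ ≠ 0}
  pos : ∀ ξ : Rd d, ξ ≠ 0 → 0 < a ξ
  homog : ∀ t : ℝ, 0 < t → ∀ ξ : Rd d, a (t • ξ) = t * a ξ

/-- Nonvanishing Gaussian curvature of the cosphere `Σ = {a = 1}`: at every point `ξ` of `Σ`
the second fundamental form, i.e. the Hessian of `a` restricted to the tangent space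
`ker (da(ξ))`, is nondegenerate. -/
def CurvNondeg {d : ℕ} (a : Rd d → ℝ) : Prop :=
  ∀ ξ : Rd d, a ξ = 1 → ∀ v : Rd d, fderiv ℝ a ξ v = 0 → v ≠ 0 →
    ∃ w : Rd d, fderiv ℝ a ξ w = 0 ∧ iteratedFDeriv ℝ 2 a ξ ![v, w] ≠ 0

/-- The bump function `η`: smooth, supported in `[1/8,8]`, equal to `1` on `[1/4,4]`. -/
structure IsBump (η : ℝ → ℝ) : Prop where
  smooth : ContDiff ℝ (⊤ : ℕ∞) η
  supp : ∀ x : ℝ, x ∉ Icc (1/8 : ℝ) 8 → η x = 0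
  one : ∀ x ∈ Icc (1/4 : ℝ) 4, η x = 1

/-- The kernel `K_r`, given by the inverse Fourier transform of `ξ ↦ η(a(ξ)) e^{i r a(ξ)}`. -/
def Kker {d : ℕ} (a : Rd d → ℝ) (η : ℝ → ℝ) (r : ℝ) (x : Rd d) : ℂ :=
  ∫ ξ : Rd d, (η (a ξ) : ℂ) * Complex.exp (Complex.I * r * a ξ) *
    Complex.exp (2 * π * Complex.I * (inner ℝ x ξ : ℝ))

/-- Convolution `K ∗ b`. -/
def conv {d : ℕ} (K b : Rd d → ℂ) (x : Rd d) : ℂ := ∫ y, K (x - y) * b y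

/-- The measure `ν_d` on `ℝ`, `dν_d(r) = (1+|r|)^{d-1} dr`. -/
def nuMeas (d : ℕ) : Measure ℝ :=
  volume.withDensity fun r => ENNReal.ofReal ((1 + |r|) ^ (d - 1))

/-- The Lorentz quasinorm `‖f‖_{L^{p,q}(μ)}`. -/
def lorentzNorm {α : Type*} {E : Type*} [MeasurableSpace α] [NormedAddCommGroup E]
    (μ : Measure α) (p : ℝ) (q : ℝ≥0∞) (f : α → E) : ℝ≥0∞ :=
  if q = ∞ then ⨆ t : ℝ, ENNReal.ofReal t * μ {x | t < ‖f x‖} ^ (1 / p)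
  else (∫⁻ t in Ioi (0 : ℝ),
      (ENNReal.ofReal t * μ {x | t < ‖f x‖} ^ (1 / p)) ^ q.toReal / ENNReal.ofReal t) ^
      (1 / q.toReal)

/-- The unit cube `q_z = ∏ [z_i, z_i + 1)`. -/
def qcube (d : ℕ) (z : Fin d → ℤ) : Set (Rd d) :=
  {y : Rd d | ∀ i, (z i : ℝ) ≤ y i ∧ y i < z i + 1}

/-- A normalized function `b_{n,z}`: measurable, bounded by the characteristic
function of `q_z`. -/
def IsNormalized {d : ℕ} (z : Fin d → ℤ) (b : Rd d → ℂ) : Prop :=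
  Measurable b ∧ (∀ y, ‖b y‖ ≤ 1) ∧ ∀ y ∉ qcube d z, b y = 0

/-- A dyadic cube of side length `2^k`, `1 ≤ k ≤ j`, in the tiling of
`[2^j, 2^{j+1}) × ℝ^d`. -/
structure DyCube (d j : ℕ) where
  k : ℕ
  m : ℤ
  zv : Fin d → ℤ
  hk : 1 ≤ k ∧ k ≤ j
  hm : (2:ℤ) ^ (j - k) ≤ m ∧ m < 2 ^ (j + 1 - k)

/-- side length of a dyadic cube -/
def DyCube.len {d j : ℕ} (Q : DyCube d j) : ℝ := 2 ^ Q.k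

/-- a dyadic cube as a subset of `ℝ^{1+d}` -/
def DyCube.toSet {d j : ℕ} (Q : DyCube d j) : Set (ℝ × (Fin d → ℝ)) :=
  {p | ((Q.m : ℝ) * 2 ^ Q.k ≤ p.1 ∧ p.1 < (Q.m + 1) * 2 ^ Q.k) ∧
    ∀ i, (Q.zv i : ℝ) * 2 ^ Q.k ≤ p.2 i ∧ p.2 i < (Q.zv i + 1) * 2 ^ Q.k}

/-- center of a dyadic cube: the `r`-coordinate -/
def DyCube.centerT {d j : ℕ} (Q : DyCube d j) : ℝ := ((Q.m : ℝ) + 1/2) * 2 ^ Q.k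

/-- center of a dyadic cube: the `y`-coordinate -/
def DyCube.centerX {d j : ℕ} (Q : DyCube d j) : Rd d :=
  WithLp.toLp 2 fun i => ((Q.zv i : ℝ) + 1/2) * 2 ^ Q.k

/-- a point `(n,z) ∈ ℕ × ℤ^d` viewed as a point of `ℝ^{1+d}` -/
def embedPt (d : ℕ) (e : ℕ × (Fin d → ℤ)) : ℝ × (Fin d → ℝ) :=
  ((e.1 : ℝ), fun i => (e.2 i : ℝ))

/-- the number of points of `E` lying in the cube `Q` -/
def cubeCount {d j : ℕ} (E : Finset (ℝ × (Fin d → ℝ))) (Q : DyCube d j) : ℕ :=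
  (E.filter (· ∈ Q.toSet)).card

/-- `Q` is `λ`-dense: `#(E ∩ Q) > λ^p l(Q)` -/
def IsDense {d j : ℕ} (E : Finset (ℝ × (Fin d → ℝ))) (lam p : ℝ) (Q : DyCube d j) : Prop :=
  lam ^ p * Q.len < (cubeCount E Q : ℝ)

/-- `Q` is a maximal `λ`-dense dyadic cube -/
def IsMaxDense {d j : ℕ} (E : Finset (ℝ × (Fin d → ℝ))) (lam p : ℝ) (Q : DyCube d j) : Prop :=
  IsDense E lam p Q ∧
    ∀ Q' : DyCube d j, IsDense E lam p Q' → Q.toSet ⊆ Q'.toSet → Q'.toSet = Q.toSet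

/-- a lattice vector viewed as an element of `ℝ^d` -/
def latticeVec (d : ℕ) (z : Fin d → ℤ) : Rd d := WithLp.toLp 2 fun i => (z i : ℝ)

/-- The structural properties of the phase function `ψ = -ψ₋`: Lipschitz with constant `L`,
comparable to the norm, and homogeneous of degree one. -/
structure IsPsi {d : ℕ} (ψ : Rd d → ℝ) (L c₁ c₂ : ℝ) : Prop where
  lip : LipschitzWith (Real.toNNReal L) ψ
  lower : ∀ x : Rd d, c₁ * ‖x‖ ≤ ψ x
  upper : ∀ x : Rd d, ψ x ≤ c₂ * ‖x‖
  homog : ∀ t : ℝ, 0 < t → ∀ x : Rd d, ψ (t • x) = t * ψ x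

/-- The stationary phase kernel estimate for `K_r`, `r ≥ 2`:
`|K_r(x)| ≤ C_N (1+|x|+|r|)^{-(d-1)/2} (1+|ψ(x)-r|)^{-N}`. -/
def KernelEst {d : ℕ} (a : Rd d → ℝ) (η : ℝ → ℝ) (ψ : Rd d → ℝ) : Prop :=
  ∀ N : ℕ, ∃ C : ℝ, 0 < C ∧ ∀ r : ℝ, 2 ≤ r → ∀ x : Rd d,
    ‖Kker a η r x‖ ≤ C * (1 + ‖x‖ + |r|) ^ (-(((d:ℝ) - 1) / 2)) * (1 + |ψ x - r|) ^ (-(N : ℝ))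

/-- The two-sided stationary phase kernel estimate for `K_r`, `|r| ≥ 2`, with the
two phase functions `ψ₊`, `ψ₋`:
`|K_r(x)| ≤ C_N (1+|x|+|r|)^{-(d-1)/2} ∑_± (1+|ψ_±(x)+r|)^{-N}`. -/
def KernelEstPM {d : ℕ} (a : Rd d → ℝ) (η : ℝ → ℝ) (ψp ψm : Rd d → ℝ) : Prop :=
  ∀ N : ℕ, ∃ C : ℝ, 0 < C ∧ ∀ r : ℝ, 2 ≤ |r| → ∀ x : Rd d,
    ‖Kker a η r x‖ ≤ C * (1 + ‖x‖ + |r|) ^ (-(((d:ℝ) - 1) / 2)) *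
      ((1 + |ψp x + r|) ^ (-(N : ℝ)) + (1 + |ψm x + r|) ^ (-(N : ℝ)))

/-- The derivatives in the first variable of a jointly smooth function are jointly smooth. -/
lemma contDiff_iteratedFDeriv_left {V Q F : Type*} [NormedAddCommGroup V] [NormedSpace ℝ V]
    [NormedAddCommGroup Q] [NormedSpace ℝ Q] [NormedAddCommGroup F] [NormedSpace ℝ F]
    {A : V → Q → F} (hA : ContDiff ℝ (⊤ : ℕ∞) (fun z : V × Q => A z.1 z.2)) (i : ℕ) :
    ContDiff ℝ (⊤ : ℕ∞)
      (fun z : V × Q => iteratedFDeriv ℝ i (fun v => A v z.2) z.1) := by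
  induction i with
  | zero =>
    have : (fun z : V × Q => iteratedFDeriv ℝ 0 (fun v => A v z.2) z.1) =
        fun z : V × Q => (continuousMultilinearCurryFin0 ℝ V F).symm (A z.1 z.2) := by
      ext z; simp [iteratedFDeriv_zero_eq_comp]
    rw [this]
    exact (continuousMultilinearCurryFin0 ℝ V F).symm.contDiff.comp hA
  | succ i ih =>
    have : (fun z : V × Q => iteratedFDeriv ℝ (i + 1) (fun v => A v z.2) z.1) =
        fun z : V × Q => (continuousMultilinearCurryLeftEquiv ℝ (fun _ : Fin (i + 1) => V) F).symm
          (fderiv ℝ (iteratedFDeriv ℝ i (fun v => A v z.2)) z.1) := by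
      ext z; simp [iteratedFDeriv_succ_eq_comp_left]
    rw [this]
    let e : (V →L[ℝ] (V [×i]→L[ℝ] F)) →L[ℝ] (V [×(i + 1)]→L[ℝ] F) :=
      ((continuousMultilinearCurryLeftEquiv ℝ
        (fun _ : Fin (i + 1) => V) F).symm.toContinuousLinearEquiv : _ →L[ℝ] _)
    have he : ContDiff ℝ (⊤ : ℕ∞) (fun x => e x) := ContinuousLinearMap.contDiff (𝕜 := ℝ)
      (E := V →L[ℝ] (V [×i]→L[ℝ] F)) (F := V [×(i + 1)]→L[ℝ] F) (n := (⊤ : ℕ∞)) e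
    refine he.comp ?_
    refine ContDiff.fderiv (m := (⊤ : ℕ∞)) (n := (⊤ : ℕ∞)) (f := fun (z : V × Q) (v : V) =>
      iteratedFDeriv ℝ i (fun v => A v z.2) v) (g := fun z => z.1) ?_ contDiff_fst ?_
    · exact ih.comp (contDiff_snd.prodMk (contDiff_snd.comp contDiff_fst))
    · exact le_rfl

/-- Uniform rapid decay of the Fourier transforms of a smooth family of functions supported in a
fixed compact set. -/
lemma uniform_fourier_decay {V Q : Type*} [NormedAddCommGroup V] [NormedSpace ℝ V]
    [FiniteDimensional ℝ V] [MeasurableSpace V] [BorelSpace V]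
    (μ : Measure V) [μ.IsAddHaarMeasure]
    [NormedAddCommGroup Q] [NormedSpace ℝ Q]
    {A : V → Q → ℂ} (hA : ContDiff ℝ (⊤ : ℕ∞) (fun z : V × Q => A z.1 z.2))
    {K : Set V} (hK : IsCompact K) (hsupp : ∀ v q, v ∉ K → A v q = 0)
    {S : Set Q} (hS : IsCompact S) (N : ℕ) :
    ∃ C : ℝ, 0 ≤ C ∧ ∀ q ∈ S, ∀ w : V →L[ℝ] ℝ,
      (1 + ‖w‖) ^ N * ‖∫ v, Complex.exp (Complex.I * (w v : ℝ)) * A v q ∂μ‖ ≤ C := by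
  have hcs : ∀ q i, Function.support (iteratedFDeriv ℝ i (fun v => A v q)) ⊆ K := by
    intro q i
    refine (support_iteratedFDeriv_subset (𝕜 := ℝ) i).trans ?_
    refine closure_minimal ?_ hK.isClosed
    intro v hv
    by_contra h
    exact hv (hsupp v q h)
  have hsm : ∀ q, ContDiff ℝ (⊤ : ℕ∞) (fun v => A v q) := fun q =>
    hA.comp (contDiff_id.prodMk contDiff_const)
  have hint : ∀ q (i : ℕ), Integrable (fun v => ‖iteratedFDeriv ℝ i (fun v => A v q) v‖) μ := by
    intro q i
    refine (Continuous.integrable_of_hasCompactSupport ?_ ?_).norm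
    · exact (hsm q).continuous_iteratedFDeriv (by exact_mod_cast le_top)
    · exact HasCompactSupport.intro hK fun v hv => by
        by_contra h; exact hv (hcs q i h)
  have hb : ∀ i : ℕ, ∃ B : ℝ, 0 ≤ B ∧ ∀ q ∈ S,
      ∫ v, ‖iteratedFDeriv ℝ i (fun v => A v q) v‖ ∂μ ≤ B := by
    intro i
    have hc : Continuous (fun z : V × Q => iteratedFDeriv ℝ i (fun v => A v z.2) z.1) :=
      (contDiff_iteratedFDeriv_left hA i).continuous
    obtain ⟨B, hB⟩ := (hK.prod hS).exists_bound_of_continuousOn hc.continuousOn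
    refine ⟨max B 0 * μ.real K, by positivity, fun q hq => ?_⟩
    rw [← setIntegral_eq_integral_of_forall_compl_eq_zero (s := K)]
    · have := norm_setIntegral_le_of_norm_le_const (μ := μ) (s := K) (C := max B 0)
        (f := fun v => ‖iteratedFDeriv ℝ i (fun v => A v q) v‖) hK.measure_lt_top
        (fun v hv => by
          rw [norm_norm]; exact (hB (v, q) ⟨hv, hq⟩).trans (le_max_left _ _))
      exact (le_abs_self _).trans this
    · intro v hv
      have : iteratedFDeriv ℝ i (fun v => A v q) v = 0 := by
        by_contra h; exact hv (hcs q i h)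
      simp [this]
  choose B hB0 hB using hb
  -- the pairing
  let L : V →L[ℝ] (V →L[ℝ] ℝ) →L[ℝ] ℝ := (ContinuousLinearMap.id ℝ (V →L[ℝ] ℝ)).flip
  have key : ∀ n : ℕ, ∃ C : ℝ, 0 ≤ C ∧ ∀ q ∈ S, ∀ w : V →L[ℝ] ℝ, ∀ e : V, ‖e‖ ≤ 1 →
      |w e| ^ n * ‖∫ v, Complex.exp (Complex.I * (w v : ℝ)) * A v q ∂μ‖ ≤ C := by
    intro n
    refine ⟨(2 * π) ^ n * (2 ^ n * ∑ i ∈ Finset.range (n + 1), B i), by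
      have := fun i => hB0 i
      have : 0 ≤ ∑ i ∈ Finset.range (n + 1), B i := Finset.sum_nonneg fun i _ => hB0 i
      positivity, fun q hq w e he => ?_⟩
    have h1 := VectorFourier.pow_mul_norm_iteratedFDeriv_fourierIntegral_le (μ := μ) L
      (K := 0) (N := (⊤ : ℕ∞)) (f := fun v => A v q) (hsm q) (by
        intro k m hk _
        have : k = 0 := by simpa using hk
        subst this
        simpa using hint q m) (k := 0) (n := n) le_rfl le_top e (-(2 * π)⁻¹ • w)
    have h2 : VectorFourier.fourierIntegral 𝐞 μ L.toLinearMap₁₂ (fun v => A v q)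
        (-(2 * π)⁻¹ • w) = ∫ v, Complex.exp (Complex.I * (w v : ℝ)) * A v q ∂μ := by
      rw [VectorFourier.fourierIntegral]
      congr 1
      ext v
      simp only [L, Circle.smul_def, Real.fourierChar_apply, smul_eq_mul]
      congr 2
      simp
      field_simp
    rw [norm_iteratedFDeriv_zero, h2] at h1
    have h3 : |L e (-(2 * π)⁻¹ • w)| = (2 * π)⁻¹ * |w e| := by
      simp [L, abs_mul, abs_of_pos Real.pi_pos]
    rw [h3] at h1
    have h4 : ∑ p ∈ Finset.range (0 + 1) ×ˢ Finset.range (n + 1),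
          ∫ v, ‖v‖ ^ p.1 * ‖iteratedFDeriv ℝ p.2 (fun v => A v q) v‖ ∂μ
          ≤ ∑ i ∈ Finset.range (n + 1), B i := by
      rw [Finset.sum_product]
      simp only [zero_add, Finset.range_one, Finset.sum_singleton, pow_zero, one_mul]
      exact Finset.sum_le_sum fun i _ => hB i q hq
    have h5 : ((2 * π)⁻¹ * |w e|) ^ n * ‖∫ v, Complex.exp (Complex.I * (w v : ℝ)) * A v q ∂μ‖
        ≤ 2 ^ n * ∑ i ∈ Finset.range (n + 1), B i := by
      refine h1.trans ?_
      have : ‖e‖ ^ n ≤ 1 := pow_le_one₀ (norm_nonneg _) he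
      have h0 : 0 ≤ ∑ i ∈ Finset.range (n + 1), B i := Finset.sum_nonneg fun i _ => hB0 i
      simp only [pow_zero, mul_one, Nat.cast_zero, mul_zero, zero_add]
      calc _ ≤ ‖e‖ ^ n * 2 ^ n * ∑ i ∈ Finset.range (n + 1), B i := by
            gcongr
        _ ≤ 1 * 2 ^ n * ∑ i ∈ Finset.range (n + 1), B i := by gcongr
        _ = _ := by ring
    calc _ = (2 * π) ^ n * (((2 * π)⁻¹ * |w e|) ^ n *
          ‖∫ v, Complex.exp (Complex.I * (w v : ℝ)) * A v q ∂μ‖) := by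
            rw [← mul_assoc, ← mul_pow]
            congr 2
            rw [mul_inv_cancel_left₀ (by positivity)]
      _ ≤ _ := by gcongr
  obtain ⟨C0, hC0, h0⟩ := key 0
  rcases Nat.eq_zero_or_pos N with hN | hN
  · subst hN
    exact ⟨C0, hC0, fun q hq w => by simpa using h0 q hq w 0 (by simp)⟩
  obtain ⟨C1, hC1, h1⟩ := key N
  refine ⟨2 ^ N * (C0 + C1), by positivity, fun q hq w => ?_⟩
  set J := ‖∫ v, Complex.exp (Complex.I * (w v : ℝ)) * A v q ∂μ‖ with hJ
  have hJ0 : 0 ≤ J := norm_nonneg _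
  have hw : ‖w‖ ^ N * J ≤ C1 := by
    rcases hJ0.eq_or_lt with h | h
    · rw [← h]; simpa using hC1
    have : ‖w‖ ≤ (C1 / J) ^ ((1:ℝ) / N) := by
      refine ContinuousLinearMap.opNorm_le_of_unit_norm (by positivity) ?_
      intro e he
      have h2 := h1 q hq w e he.le
      have h3 : |w e| ^ N ≤ C1 / J := by rw [le_div_iff₀ h]; exact h2
      calc ‖w e‖ = (|w e| ^ N) ^ ((1:ℝ) / N) := by
            rw [← Real.rpow_natCast, ← Real.rpow_mul (abs_nonneg _)]
            field_simp
            simp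
        _ ≤ _ := by gcongr
    have h3 : ‖w‖ ^ N ≤ C1 / J := by
      calc ‖w‖ ^ N ≤ ((C1 / J) ^ ((1:ℝ) / N)) ^ N := by gcongr
        _ = C1 / J := by
          rw [← Real.rpow_natCast, ← Real.rpow_mul (by positivity), one_div,
            inv_mul_cancel₀ (by positivity), Real.rpow_one]
    rwa [le_div_iff₀ h] at h3
  have h0' : J ≤ C0 := by simpa using h0 q hq w 0 (by simp)
  have h5 : (1 + ‖w‖) ^ N ≤ 2 ^ N * (1 + ‖w‖ ^ N) := by
    rcases le_total ‖w‖ 1 with h | h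
    · calc (1 + ‖w‖) ^ N ≤ 2 ^ N := by gcongr; linarith
        _ ≤ _ := le_mul_of_one_le_right (by positivity) (by linarith [pow_nonneg (norm_nonneg w) N])
    · calc (1 + ‖w‖) ^ N ≤ (2 * ‖w‖) ^ N := by gcongr; linarith
        _ = 2 ^ N * ‖w‖ ^ N := by rw [mul_pow]
        _ ≤ _ := by gcongr; linarith
  calc (1 + ‖w‖) ^ N * J ≤ 2 ^ N * (1 + ‖w‖ ^ N) * J := by gcongr
    _ = 2 ^ N * (J + ‖w‖ ^ N * J) := by ring
    _ ≤ _ := by gcongr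

section gradient
variable {d : ℕ} {a : Rd d → ℝ}

lemma IsDistFn.contDiffAt (ha : IsDistFn a) {ζ : Rd d} (hζ : ζ ≠ 0) :
    ContDiffAt ℝ (⊤ : ℕ∞) a ζ :=
  ha.smooth.contDiffAt (isOpen_ne.mem_nhds hζ)

lemma IsDistFn.differentiableAt (ha : IsDistFn a) {ζ : Rd d} (hζ : ζ ≠ 0) :
    DifferentiableAt ℝ a ζ :=
  (ha.contDiffAt hζ).differentiableAt (by simp)

lemma IsDistFn.fderiv_smul (ha : IsDistFn a) {t : ℝ} (ht : 0 < t) (ζ : Rd d) :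
    fderiv ℝ a (t • ζ) = fderiv ℝ a ζ := by
  have h1 : (fun x => a (t • x)) = fun x => t • a x := by
    ext x; exact ha.homog t ht x
  have h2 := congrArg (fun f => fderiv ℝ f ζ) h1
  have h4 : fderiv ℝ (fun x => t • a x) ζ = t • fderiv ℝ a ζ :=
    congrFun (fderiv_const_smul_field (f := a) t) ζ
  simp only [fderiv_comp_smul, h4] at h2
  have h3 := congrArg (fun l => t⁻¹ • l) h2
  simpa [smul_smul, inv_mul_cancel₀ ht.ne'] using h3

lemma IsDistFn.fderiv_self (ha : IsDistFn a) {ζ : Rd d} (hζ : ζ ≠ 0) :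
    fderiv ℝ a ζ ζ = a ζ := by
  have h1 : HasDerivAt (fun t : ℝ => a (t • ζ)) (fderiv ℝ a ((1:ℝ) • ζ) ((1:ℝ) • ζ)) 1 := by
    have : HasDerivAt (fun t : ℝ => t • ζ) ((1:ℝ) • ζ) 1 := (hasDerivAt_id (1:ℝ)).smul_const ζ
    refine HasFDerivAt.comp_hasDerivAt (1:ℝ) ?_ this
    rw [one_smul]
    exact (ha.differentiableAt hζ).hasFDerivAt
  have h2 : HasDerivAt (fun t : ℝ => a (t • ζ)) (a ζ) 1 := by
    have : HasDerivAt (fun t : ℝ => t * a ζ) (1 * a ζ) 1 := (hasDerivAt_id (1:ℝ)).mul_const _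
    rw [one_mul] at this
    refine this.congr_of_eventuallyEq ?_
    filter_upwards [lt_mem_nhds (zero_lt_one (α := ℝ))] with t ht
    exact ha.homog t ht ζ
  simpa using h1.unique h2

/-- The gradient of a distance function. -/
def gr (a : Rd d → ℝ) (ζ : Rd d) : Rd d := gradient a ζ

lemma inner_gr (ζ v : Rd d) : ⟪gr a ζ, v⟫ = fderiv ℝ a ζ v := by
  rw [gr, gradient, InnerProductSpace.toDual_symm_apply]

lemma gr_smul (ha : IsDistFn a) {t : ℝ} (ht : 0 < t) (ζ : Rd d) : gr a (t • ζ) = gr a ζ := by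
  rw [gr, gr, gradient, gradient, ha.fderiv_smul ht]

lemma inner_gr_self (ha : IsDistFn a) {ζ : Rd d} (hζ : ζ ≠ 0) : ⟪gr a ζ, ζ⟫ = a ζ := by
  rw [inner_gr, ha.fderiv_self hζ]

lemma contDiffAt_gr (ha : IsDistFn a) {ζ : Rd d} (hζ : ζ ≠ 0) :
    ContDiffAt ℝ (⊤ : ℕ∞) (gr a) ζ := by
  have h1 : ContDiffAt ℝ (⊤ : ℕ∞) (fderiv ℝ a) ζ :=
    (ha.contDiffAt hζ).fderiv_right (by exact le_rfl)
  have h2 : ContDiff ℝ (⊤ : ℕ∞) (fun l => (InnerProductSpace.toDual ℝ (Rd d)).symm l) :=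
    (InnerProductSpace.toDual ℝ (Rd d)).symm.contDiff
  exact h2.contDiffAt.comp ζ h1

lemma inner_fderiv_gr (ha : IsDistFn a) {ζ : Rd d} (hζ : ζ ≠ 0) (v w : Rd d) :
    ⟪fderiv ℝ (gr a) ζ v, w⟫ = fderiv ℝ (fderiv ℝ a) ζ v w := by
  have h1 : HasFDerivAt (fun ζ => ⟪gr a ζ, w⟫) 
      ((innerSL ℝ w).comp (fderiv ℝ (gr a) ζ)) ζ := by
    have := (innerSL ℝ w).hasFDerivAt.comp ζ
      ((contDiffAt_gr ha hζ).differentiableAt (by simp)).hasFDerivAt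
    refine this.congr_of_eventuallyEq (Filter.Eventually.of_forall fun x => ?_)
    simp [real_inner_comm]
  have h2 : HasFDerivAt (fun ζ => fderiv ℝ a ζ w) 
      ((ContinuousLinearMap.apply ℝ ℝ w).comp (fderiv ℝ (fderiv ℝ a) ζ)) ζ := by
    have h3 : DifferentiableAt ℝ (fderiv ℝ a) ζ :=
      ((ha.contDiffAt hζ).fderiv_right (m := (⊤ : ℕ∞)) le_rfl).differentiableAt
        (by simp)
    exact (ContinuousLinearMap.apply ℝ ℝ w).hasFDerivAt.comp ζ h3.hasFDerivAt
  have h3 : (fun ζ => ⟪gr a ζ, w⟫) = fun ζ => fderiv ℝ a ζ w := by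
    ext; exact inner_gr _ _
  rw [h3] at h1
  have := congrArg (fun l => l v) (h1.unique h2)
  simpa [real_inner_comm] using this

lemma fderiv_gr_symm (ha : IsDistFn a) {ζ : Rd d} (hζ : ζ ≠ 0) (v w : Rd d) :
    ⟪fderiv ℝ (gr a) ζ v, w⟫ = ⟪fderiv ℝ (gr a) ζ w, v⟫ := by
  rw [inner_fderiv_gr ha hζ, inner_fderiv_gr ha hζ]
  exact ((ha.contDiffAt hζ).isSymmSndFDerivAt (by
    rw [minSmoothness_of_isRCLikeNormedField]; exact WithTop.coe_le_coe.2 (le_top : (2 : ℕ∞) ≤ ⊤))) v w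

lemma fderiv_gr_self (ha : IsDistFn a) {ζ : Rd d} (hζ : ζ ≠ 0) :
    fderiv ℝ (gr a) ζ ζ = 0 := by
  have h1 : HasDerivAt (fun t : ℝ => gr a (t • ζ)) (fderiv ℝ (gr a) ((1:ℝ) • ζ) ((1:ℝ) • ζ)) 1 := by
    have : HasDerivAt (fun t : ℝ => t • ζ) ((1:ℝ) • ζ) 1 := (hasDerivAt_id (1:ℝ)).smul_const ζ
    refine HasFDerivAt.comp_hasDerivAt (1:ℝ) ?_ this
    rw [one_smul]
    exact ((contDiffAt_gr ha hζ).differentiableAt (by simp)).hasFDerivAt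
  have h2 : HasDerivAt (fun t : ℝ => gr a (t • ζ)) 0 1 := by
    refine (hasDerivAt_const (1:ℝ) (gr a ζ)).congr_of_eventuallyEq ?_
    filter_upwards [lt_mem_nhds (zero_lt_one (α := ℝ))] with t ht
    exact gr_smul ha ht ζ
  simpa using h1.unique h2

/-- The kernel of the Hessian of `a` at `ζ` meets no hyperplane transversal to `ζ`. -/
lemma eq_zero_of_fderiv_gr (ha : IsDistFn a) (hc : CurvNondeg a) {ζ : Rd d} (hζ : ζ ≠ 0)
    {v : Rd d} (h1 : fderiv ℝ (gr a) ζ v = 0) (h2 : ⟪ζ, v⟫ = 0) : v = 0 := by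
  have haζ := ha.pos ζ hζ
  set s := fderiv ℝ a ζ v / a ζ with hs
  set v' := v - s • ζ with hv'
  have hH : fderiv ℝ (gr a) ζ v' = 0 := by
    rw [hv', map_sub, map_smul, fderiv_gr_self ha hζ, h1]; simp
  have hda : fderiv ℝ a ζ v' = 0 := by
    rw [hv', map_sub, map_smul, ha.fderiv_self hζ, hs]
    simp [div_mul_cancel₀ _ haζ.ne']
  have ht : 0 < (a ζ)⁻¹ := inv_pos.2 haζ
  have hζ1 : (a ζ)⁻¹ • ζ ≠ 0 := smul_ne_zero ht.ne' hζ
  have hv0 : v' = 0 := by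
    by_contra hne
    obtain ⟨w, -, hw⟩ := hc ((a ζ)⁻¹ • ζ)
      (by rw [ha.homog _ ht, inv_mul_cancel₀ haζ.ne']) v'
      (by rw [ha.fderiv_smul ht, hda]) hne
    apply hw
    rw [iteratedFDeriv_two_apply]
    simp only [Matrix.cons_val_zero, Matrix.cons_val_one]
    rw [← inner_fderiv_gr ha hζ1]
    have h5 : fderiv ℝ (gr a) ζ = (a ζ)⁻¹ • fderiv ℝ (gr a) ((a ζ)⁻¹ • ζ) := by
      rw [← fderiv_comp_smul]
      congr 1
      ext1 x
      exact (gr_smul ha ht x).symm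
    rw [h5] at hH
    have h6 : fderiv ℝ (gr a) ((a ζ)⁻¹ • ζ) v' = 0 := by
      have := hH
      simp only [smul_apply, smul_eq_zero] at this
      exact this.resolve_left ht.ne'
    rw [h6, inner_zero_left]
  have hv : v = s • ζ := by rw [hv'] at hv0; exact sub_eq_zero.1 hv0
  rw [hv, inner_smul_right, real_inner_self_eq_norm_sq] at h2
  have : s = 0 := by
    rcases mul_eq_zero.1 h2 with h | h
    · exact h
    · exact absurd (by simpa using h) hζ
  rw [hv, this, zero_smul]

end gradient

lemma exists_local_inverse {E : Type*} [NormedAddCommGroup E] [NormedSpace ℝ E]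
    [FiniteDimensional ℝ E] {f : E → E} {f' : E →L[ℝ] E} {b : E} (hf : HasStrictFDerivAt f f' b)
    (hinj : ∀ v, f' v = 0 → v = 0) {U : Set E} (hU : U ∈ nhds b) :
    ∃ ρ > 0, ∃ C > 0, Metric.ball b (2 * ρ) ⊆ U ∧
      (∀ ζ ∈ Metric.ball b ρ, ∀ ζ' ∈ Metric.ball b ρ, ‖ζ - ζ'‖ ≤ C * ‖f ζ - f ζ'‖) ∧
      ∀ ζ ∈ Metric.ball b ρ, ∀ u, C * ‖u‖ < ρ →
        ∃ ζ', ‖ζ' - ζ‖ ≤ C * ‖u‖ ∧ f ζ' = f ζ + u := by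
  let e : E ≃L[ℝ] E := (LinearEquiv.ofInjectiveEndo (f' : E →ₗ[ℝ] E)
    ((injective_iff_map_eq_zero _).2 hinj)).toContinuousLinearEquiv
  have he : (e : E →L[ℝ] E) = f' := by ext x; rfl
  rw [← he] at hf
  obtain ⟨s, hbs, hs, happ⟩ := hf.approximates_deriv_on_open_nhds
  obtain ⟨ρ0, hρ0, hρs⟩ := Metric.mem_nhds_iff.1 (Filter.inter_mem (hs.mem_nhds hbs) hU)
  rcases subsingleton_or_nontrivial E with hE | hE
  · exact ⟨ρ0 / 2, by positivity, 1, one_pos, by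
      rw [mul_div_cancel₀ _ two_ne_zero]; exact hρs.trans inter_subset_right,
      fun ζ _ ζ' _ => by simp [Subsingleton.elim ζ ζ'],
      fun ζ _ u _ => ⟨ζ, by simp, Subsingleton.elim _ _⟩⟩
  set N : ℝ≥0 := ‖(e.symm : E →L[ℝ] E)‖₊ with hN
  have hNpos : 0 < N := e.nnnorm_symm_pos
  have hN' : (0:ℝ) < N := hNpos
  refine ⟨ρ0 / 2, by positivity, 2 * N, by positivity, ?_, ?_, ?_⟩
  · rw [mul_div_cancel₀ _ two_ne_zero]; exact hρs.trans inter_subset_right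
  · intro ζ hζ ζ' hζ'
    have hsub : Metric.ball b (ρ0 / 2) ⊆ s :=
      (Metric.ball_subset_ball (by linarith)).trans (hρs.trans inter_subset_left)
    have h1 := happ.antilipschitz (Or.inr (NNReal.half_lt_self (inv_ne_zero hNpos.ne')))
    have h2 := h1.le_mul_dist ⟨ζ, hsub hζ⟩ ⟨ζ', hsub hζ'⟩
    rw [Subtype.dist_eq, dist_eq_norm, dist_eq_norm] at h2
    have h3 : ((N⁻¹ - N⁻¹ / 2 : ℝ≥0)⁻¹ : ℝ≥0) = 2 * N := by
      have : (N⁻¹ - N⁻¹ / 2 : ℝ≥0) = N⁻¹ / 2 := by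
        rw [tsub_eq_iff_eq_add_of_le (NNReal.half_le_self _)]; exact (add_halves _).symm
      rw [this, inv_div, div_inv_eq_mul]
    rw [h3] at h2
    exact_mod_cast h2
  · intro ζ hζ u hu
    have hsub : Metric.closedBall ζ (2 * N * ‖u‖) ⊆ s := by
      refine Subset.trans ?_ (hρs.trans inter_subset_left)
      intro z hz
      rw [Metric.mem_closedBall] at hz
      rw [Metric.mem_ball] at hζ ⊢
      linarith [dist_triangle z ζ b]
    have h1 := happ.surjOn_closedBall_of_nonlinearRightInverse e.toNonlinearRightInverse
      (b := ζ) (ε := 2 * N * ‖u‖) (by positivity) hsub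
    have h2 : f ζ + u ∈ Metric.closedBall (f ζ)
        (((e.toNonlinearRightInverse.nnnorm : ℝ)⁻¹ - (N⁻¹ / 2 : ℝ≥0)) * (2 * N * ‖u‖)) := by
      rw [mem_closedBall_iff_norm, add_sub_cancel_left]
      have : (e.toNonlinearRightInverse.nnnorm : ℝ) = N := rfl
      rw [this]
      push_cast
      apply le_of_eq
      field_simp
      ring
    obtain ⟨ζ', hz, hz'⟩ := h1 h2
    exact ⟨ζ', by simpa [dist_eq_norm] using hz, hz'⟩

section geometry
variable {d : ℕ} {a : Rd d → ℝ}

/-- The projection along `ζ₀`. -/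
def spanProj (ζ₀ : Rd d) : Rd d →L[ℝ] Rd d := (innerSL ℝ ζ₀).smulRight ζ₀

lemma spanProj_apply (ζ₀ v : Rd d) : spanProj ζ₀ v = ⟪ζ₀, v⟫ • ζ₀ := by simp [spanProj]

/-- The map `ζ ↦ (‖ζ₀‖² ∇a(ζ) - ⟨ζ₀, ∇a(ζ)⟩ ζ₀) + ⟨ζ₀, ζ⟩ ζ₀`. -/
def psiMap (a : Rd d → ℝ) (ζ₀ ζ : Rd d) : Rd d :=
  ‖ζ₀‖ ^ 2 • gr a ζ - spanProj ζ₀ (gr a ζ) + spanProj ζ₀ ζ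

lemma psiMap_local (ha : IsDistFn a) (hc : CurvNondeg a) {ζ₀ : Rd d} (hζ : ζ₀ ≠ 0)
    {U : Set (Rd d)} (hU : U ∈ nhds ζ₀) :
    ∃ ρ > 0, ∃ C > 0, Metric.ball ζ₀ (2 * ρ) ⊆ U ∧
      (∀ ζ ∈ Metric.ball ζ₀ ρ, ∀ ζ' ∈ Metric.ball ζ₀ ρ,
        ‖ζ - ζ'‖ ≤ C * ‖psiMap a ζ₀ ζ - psiMap a ζ₀ ζ'‖) ∧
      ∀ ζ ∈ Metric.ball ζ₀ ρ, ∀ u, C * ‖u‖ < ρ →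
        ∃ ζ', ‖ζ' - ζ‖ ≤ C * ‖u‖ ∧ psiMap a ζ₀ ζ' = psiMap a ζ₀ ζ + u := by
  have hn : 0 < ‖ζ₀‖ := norm_pos_iff.2 hζ
  have hg : HasStrictFDerivAt (gr a) (fderiv ℝ (gr a) ζ₀) ζ₀ :=
    (contDiffAt_gr ha hζ).hasStrictFDerivAt (by simp)
  have hψ : HasStrictFDerivAt (psiMap a ζ₀) (‖ζ₀‖ ^ 2 • fderiv ℝ (gr a) ζ₀ -
      (spanProj ζ₀).comp (fderiv ℝ (gr a) ζ₀) + spanProj ζ₀) ζ₀ :=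
    ((hg.const_smul (‖ζ₀‖ ^ 2)).sub ((spanProj ζ₀).hasStrictFDerivAt.comp ζ₀ hg)).add
      (spanProj ζ₀).hasStrictFDerivAt
  have hinj : ∀ v, (‖ζ₀‖ ^ 2 • fderiv ℝ (gr a) ζ₀ -
      (spanProj ζ₀).comp (fderiv ℝ (gr a) ζ₀) + spanProj ζ₀) v = 0 → v = 0 := by
    intro v hv
    simp only [add_apply, sub_apply, smul_apply, ContinuousLinearMap.comp_apply,
      spanProj_apply] at hv
    set w := fderiv ℝ (gr a) ζ₀ v with hw
    have h0 : ⟪ζ₀, v⟫ = 0 := by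
      have := congrArg (fun z => ⟪ζ₀, z⟫) hv
      simp only [inner_add_right, inner_sub_right, inner_smul_right, real_inner_self_eq_norm_sq,
        inner_zero_right] at this
      have h4 : ⟪ζ₀, v⟫ * ‖ζ₀‖ ^ 2 = 0 := by linarith
      exact (mul_eq_zero.1 h4).resolve_right (by positivity)
    have h5 : ⟪ζ₀, w⟫ = 0 := by
      rw [hw, real_inner_comm, fderiv_gr_symm ha hζ, fderiv_gr_self ha hζ, inner_zero_left]
    rw [h0, h5] at hv
    simp only [zero_smul, sub_zero, add_zero, smul_eq_zero] at hv
    exact eq_zero_of_fderiv_gr ha hc hζ (hv.resolve_left (by positivity)) h0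
  exact exists_local_inverse hψ hinj hU

end geometry

section geometry
variable {d : ℕ} {a : Rd d → ℝ}

lemma exists_critical_local (ha : IsDistFn a) (hc : CurvNondeg a) {ζ₀ : Rd d} (hζ : ζ₀ ≠ 0) :
    ∃ U ∈ nhds ζ₀, ∃ C > 0, ∀ ζ ∈ U, ∀ v : Rd d, ∃ z, z ≠ 0 ∧
      ‖gr a z - v‖ ≤ C * (|⟪ζ, gr a ζ - v⟫| + ‖gr a ζ - v‖ ^ 2) := by
  have hn : 0 < ‖ζ₀‖ := norm_pos_iff.2 hζ
  obtain ⟨L, t, ht, hL⟩ := ((contDiffAt_gr ha hζ).of_le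
    (show (1 : WithTop ℕ∞) ≤ (⊤ : ℕ∞) by exact_mod_cast le_top)).exists_lipschitzOnWith
  obtain ⟨ρ, hρ, C, hC, hU, -, hinv⟩ := psiMap_local ha hc hζ
    (Filter.inter_mem ht (Metric.ball_mem_nhds ζ₀ (show 0 < ‖ζ₀‖ / 2 by positivity)))
  set B := C * (2 * ‖ζ₀‖ ^ 2) with hB
  have hB0 : 0 < B := by positivity
  set c := ρ / (2 * B) with hcdef
  have hc0 : 0 < c := by positivity
  set M := (1 + L * B) * B with hM
  have hM0 : 0 < M := by positivity
  refine ⟨Metric.ball ζ₀ ρ, Metric.ball_mem_nhds _ hρ,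
    c⁻¹ + 2 / ‖ζ₀‖ * (1 + M), by positivity, fun ζ hζm v => ?_⟩
  have hball0 : ∀ z ∈ Metric.ball ζ₀ (2 * ρ), z ≠ 0 := by
    intro z hz h0
    have := (hU hz).2
    rw [h0, Metric.mem_ball, dist_zero_left] at this
    linarith
  have hζ0 : ζ ≠ 0 := hball0 ζ (Metric.ball_subset_ball (by linarith) hζm)
  set e := gr a ζ - v with he
  rcases le_or_gt c ‖e‖ with hce | hce
  · refine ⟨ζ, hζ0, ?_⟩
    have h1 : ‖e‖ ≤ c⁻¹ * ‖e‖ ^ 2 := by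
      rw [inv_mul_eq_div, le_div_iff₀ hc0, pow_two]; gcongr
    refine h1.trans ?_
    have h2 : 0 ≤ 2 / ‖ζ₀‖ * (1 + M) := by positivity
    gcongr
    · linarith
    · linarith [abs_nonneg (⟪ζ, e⟫)]
  set u := -(‖ζ₀‖ ^ 2 • e - spanProj ζ₀ e) with hu
  have hun : ‖u‖ ≤ 2 * ‖ζ₀‖ ^ 2 * ‖e‖ := by
    rw [hu, norm_neg]
    refine (norm_sub_le _ _).trans ?_
    rw [norm_smul, spanProj_apply, norm_smul, norm_pow, norm_norm]
    have := norm_inner_le_norm (𝕜 := ℝ) ζ₀ e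
    nlinarith [norm_nonneg ζ₀]
  have hCu : C * ‖u‖ ≤ B * ‖e‖ := by
    calc C * ‖u‖ ≤ C * (2 * ‖ζ₀‖ ^ 2 * ‖e‖) := by gcongr
      _ = _ := by rw [hB]; ring
  have hBe : B * ‖e‖ < ρ := by
    calc B * ‖e‖ < B * c := by gcongr
      _ = ρ / 2 := by rw [hcdef]; field_simp
      _ < ρ := by linarith
  obtain ⟨z, hz1, hz2⟩ := hinv ζ hζm u (hCu.trans_lt hBe)
  replace hz1 := hz1.trans hCu
  have hcb : Metric.closedBall ζ (B * ‖e‖) ⊆ Metric.ball ζ₀ (2 * ρ) := by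
    intro y hy
    rw [Metric.mem_closedBall] at hy
    rw [Metric.mem_ball] at hζm ⊢
    linarith [dist_triangle y ζ ζ₀]
  have hzb : z ∈ Metric.ball ζ₀ (2 * ρ) := hcb (by simpa [dist_eq_norm] using hz1)
  refine ⟨z, hball0 z hzb, ?_⟩
  set e' := gr a z - v with he'
  -- `e'` is a multiple of `ζ₀`
  have h3 : ⟪ζ₀, z⟫ = ⟪ζ₀, ζ⟫ := by
    have := congrArg (fun y => ⟪ζ₀, y⟫) hz2
    simp only [psiMap, hu, spanProj_apply, inner_add_right, inner_sub_right, inner_smul_right,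
      real_inner_self_eq_norm_sq, inner_neg_right] at this
    have h4 : ‖ζ₀‖ ^ 2 * (⟪ζ₀, z⟫ - ⟪ζ₀, ζ⟫) = 0 := by linarith
    have := (mul_eq_zero.1 h4).resolve_left (by positivity)
    linarith
  have h4 : ‖ζ₀‖ ^ 2 • e' = ⟪ζ₀, e'⟫ • ζ₀ := by
    have h5 := hz2
    simp only [psiMap, hu, spanProj_apply, h3, he] at h5
    rw [he']
    simp only [inner_sub_right, sub_smul, smul_sub] at h5 ⊢
    rw [← sub_eq_zero] at h5 ⊢
    rw [← h5]
    abel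
  set s := ⟪ζ₀, e'⟫ / ‖ζ₀‖ ^ 2 with hs
  have h5 : e' = s • ζ₀ := by
    rw [hs, div_eq_inv_mul, mul_smul, ← h4, smul_smul, inv_mul_cancel₀ (by positivity), one_smul]
  have h6 : ‖ζ₀‖ ^ 2 / 2 ≤ ⟪z, ζ₀⟫ := by
    have h7 := (hU hzb).2
    rw [Metric.mem_ball, dist_eq_norm] at h7
    have h8 := norm_inner_le_norm (𝕜 := ℝ) (z - ζ₀) ζ₀
    rw [inner_sub_left, real_inner_self_eq_norm_sq, Real.norm_eq_abs] at h8
    have h9 := neg_abs_le (⟪z, ζ₀⟫ - ‖ζ₀‖ ^ 2)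
    nlinarith
  have h7 : ‖e'‖ ≤ 2 / ‖ζ₀‖ * |⟪z, e'⟫| := by
    rw [h5, inner_smul_right, norm_smul, abs_mul, abs_of_nonneg ((by positivity : (0:ℝ) ≤ _).trans h6),
      Real.norm_eq_abs]
    calc |s| * ‖ζ₀‖ = 2 / ‖ζ₀‖ * (|s| * (‖ζ₀‖ ^ 2 / 2)) := by field_simp
      _ ≤ _ := by gcongr
  -- mean value inequality
  have h8 : ‖(a z - ⟪v, z⟫) - (a ζ - ⟪v, ζ⟫)‖ ≤ (1 + L * B) * ‖e‖ * ‖z - ζ‖ := by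
    refine (convex_closedBall ζ (B * ‖e‖)).norm_image_sub_le_of_norm_hasFDerivWithin_le
      (𝕜 := ℝ) (f := fun y => a y - ⟪v, y⟫) (f' := fun y => fderiv ℝ a y - innerSL ℝ v) ?_ ?_ ?_ ?_
    · intro y hy
      exact ((ha.differentiableAt (hball0 y (hcb hy))).hasFDerivAt.sub
        (innerSL ℝ v).hasFDerivAt).hasFDerivWithinAt
    · intro y hy
      have h9 : fderiv ℝ a y - innerSL ℝ v = innerSL ℝ (gr a y - v) := by
        ext w; simp [inner_gr]
      rw [h9, innerSL_apply_norm]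
      have h10 := hL.dist_le_mul y (hU (hcb hy)).1 ζ
        (hU (Metric.ball_subset_ball (by linarith) hζm)).1
      rw [dist_eq_norm, dist_eq_norm] at h10
      have h11 : gr a y - v = (gr a y - gr a ζ) + e := by rw [he]; abel
      rw [h11]
      rw [Metric.mem_closedBall, dist_eq_norm] at hy
      calc _ ≤ ‖gr a y - gr a ζ‖ + ‖e‖ := norm_add_le _ _
        _ ≤ L * (B * ‖e‖) + ‖e‖ := by gcongr; exact h10.trans (by gcongr)
        _ = _ := by ring
    · exact Metric.mem_closedBall_self (by positivity)
    · simpa [dist_eq_norm] using hz1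
  have h9 : ∀ y : Rd d, y ≠ 0 → ⟪y, gr a y - v⟫ = a y - ⟪v, y⟫ := by
    intro y hy
    rw [inner_sub_right, real_inner_comm, inner_gr_self ha hy, real_inner_comm]
  have h10 : |⟪z, e'⟫| ≤ |⟪ζ, e⟫| + M * ‖e‖ ^ 2 := by
    rw [he', he, h9 z (hball0 z hzb), h9 ζ hζ0]
    have : (1 + L * B) * ‖e‖ * ‖z - ζ‖ ≤ M * ‖e‖ ^ 2 := by
      calc _ ≤ (1 + L * B) * ‖e‖ * (B * ‖e‖) := by gcongr
        _ = _ := by rw [hM]; ring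
    rw [Real.norm_eq_abs] at h8
    have h11 := abs_sub_abs_le_abs_sub (a z - ⟪v, z⟫) (a ζ - ⟪v, ζ⟫)
    linarith
  calc ‖e'‖ ≤ 2 / ‖ζ₀‖ * |⟪z, e'⟫| := h7
    _ ≤ 2 / ‖ζ₀‖ * (|⟪ζ, e⟫| + M * ‖e‖ ^ 2) := by gcongr
    _ ≤ 2 / ‖ζ₀‖ * ((1 + M) * (|⟪ζ, e⟫| + ‖e‖ ^ 2)) := by
        gcongr
        nlinarith [abs_nonneg (⟪ζ, e⟫), sq_nonneg ‖e‖]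
    _ ≤ _ := by
        rw [← mul_assoc]
        gcongr
        linarith [inv_pos.2 hc0]

lemma exists_critical (ha : IsDistFn a) (hc : CurvNondeg a) {K : Set (Rd d)} (hK : IsCompact K)
    (h0 : (0 : Rd d) ∉ K) :
    ∃ C > 0, ∀ ζ ∈ K, ∀ v : Rd d, ∃ z, z ≠ 0 ∧
      ‖gr a z - v‖ ≤ C * (|⟪ζ, gr a ζ - v⟫| + ‖gr a ζ - v‖ ^ 2) := by
  refine hK.induction_on (p := fun K => ∃ C > 0, ∀ ζ ∈ K, ∀ v : Rd d, ∃ z, z ≠ 0 ∧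
      ‖gr a z - v‖ ≤ C * (|⟪ζ, gr a ζ - v⟫| + ‖gr a ζ - v‖ ^ 2)) ?_ ?_ ?_ ?_
  · exact ⟨1, one_pos, fun ζ h => h.elim⟩
  · rintro s t hst ⟨C, hC, h⟩
    exact ⟨C, hC, fun ζ hζ => h ζ (hst hζ)⟩
  · rintro s t ⟨C, hC, h⟩ ⟨C', hC', h'⟩
    refine ⟨C + C', by positivity, ?_⟩
    rintro ζ (hζ | hζ) v
    · obtain ⟨z, hz, hz'⟩ := h ζ hζ v
      exact ⟨z, hz, hz'.trans (by gcongr; linarith)⟩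
    · obtain ⟨z, hz, hz'⟩ := h' ζ hζ v
      exact ⟨z, hz, hz'.trans (by gcongr; linarith)⟩
  · intro ζ hζ
    obtain ⟨U, hU, C, hC, h⟩ := exists_critical_local ha hc (fun h => h0 (h ▸ hζ))
    exact ⟨U, mem_nhdsWithin_of_mem_nhds hU, C, hC, h⟩

end geometry

section geometry
variable {d : ℕ} {a : Rd d → ℝ}

lemma volume_gr_near_local (hd : 1 ≤ d) (ha : IsDistFn a) (hc : CurvNondeg a) {ζ₀ : Rd d}
    (hζ : ζ₀ ≠ 0) :
    ∃ U ∈ nhds ζ₀, ∃ C > 0, ∀ t > 0, ∀ v : Rd d,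
      volume {ζ ∈ U | ‖gr a ζ - v‖ ≤ t} ≤ ENNReal.ofReal (C * t ^ (d - 1)) := by
  have hn : 0 < ‖ζ₀‖ := norm_pos_iff.2 hζ
  obtain ⟨ρ, hρ, C, hC, hU, hanti, -⟩ := psiMap_local ha hc hζ
    (Metric.ball_mem_nhds ζ₀ (show 0 < ‖ζ₀‖ / 2 by positivity))
  set ω := (volume (Metric.ball (0 : Rd d) 1)).toReal with hω
  have hω' : volume (Metric.ball (0 : Rd d) 1) = ENNReal.ofReal ω :=
    (ENNReal.ofReal_toReal measure_ball_lt_top.ne).symm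
  have hω0 : 0 ≤ ω := ENNReal.toReal_nonneg
  have hvol : ∀ (x : Rd d) (r : ℝ), 0 ≤ r →
      volume (Metric.closedBall x r) = ENNReal.ofReal (r ^ d * ω) := by
    intro x r hr
    rw [Measure.addHaar_closedBall _ _ hr, hω', ← ENNReal.ofReal_mul (by positivity)]
    simp
  set C1 := C * (4 * ‖ζ₀‖ ^ 2 + ‖ζ₀‖) with hC1
  have hC10 : 0 < C1 := by positivity
  set M := ‖ζ₀‖ * (‖ζ₀‖ + ρ) with hM
  have hM0 : 0 < M := by positivity
  refine ⟨Metric.ball ζ₀ ρ, Metric.ball_mem_nhds _ hρ,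
    ρ ^ d * ω + (2 * M + 2) * (C1 ^ d * ω) + 1, by positivity, fun t ht v => ?_⟩
  rcases le_or_gt 1 t with h1t | h1t
  · calc volume {ζ ∈ Metric.ball ζ₀ ρ | ‖gr a ζ - v‖ ≤ t}
        ≤ volume (Metric.closedBall ζ₀ ρ) :=
          measure_mono fun ζ h => Metric.ball_subset_closedBall h.1
      _ = ENNReal.ofReal (ρ ^ d * ω) := hvol _ _ hρ.le
      _ ≤ _ := by
        apply ENNReal.ofReal_le_ofReal
        have : 1 ≤ t ^ (d - 1) := one_le_pow₀ h1t
        have h2 : 0 ≤ (2 * M + 2) * (C1 ^ d * ω) := by positivity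
        have h3 : 0 ≤ ρ ^ d * ω := by positivity
        nlinarith
  set S := {ζ ∈ Metric.ball ζ₀ ρ | ‖gr a ζ - v‖ ≤ t} with hS
  have hdiam : ∀ ζ ∈ S, ∀ ζ' ∈ S, |⟪ζ₀, ζ⟫ - ⟪ζ₀, ζ'⟫| ≤ t → ‖ζ' - ζ‖ ≤ C1 * t := by
    intro ζ hz ζ' hz' h
    rw [norm_sub_rev]
    refine (hanti ζ hz.1 ζ' hz'.1).trans ?_
    rw [hC1, mul_assoc]
    gcongr
    have h1 : psiMap a ζ₀ ζ - psiMap a ζ₀ ζ' = ‖ζ₀‖ ^ 2 • (gr a ζ - gr a ζ') -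
        ⟪ζ₀, gr a ζ - gr a ζ'⟫ • ζ₀ + (⟪ζ₀, ζ⟫ - ⟪ζ₀, ζ'⟫) • ζ₀ := by
      simp only [psiMap, spanProj_apply, inner_sub_right, smul_sub, sub_smul]
      abel
    have h2 : ‖gr a ζ - gr a ζ'‖ ≤ 2 * t := by
      have : gr a ζ - gr a ζ' = (gr a ζ - v) - (gr a ζ' - v) := by abel
      rw [this]
      exact (norm_sub_le _ _).trans (by linarith [hz.2, hz'.2])
    rw [h1]
    refine (norm_add_le _ _).trans ?_
    refine (add_le_add_left (norm_sub_le _ _) _).trans ?_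
    rw [norm_smul, norm_smul, norm_smul, norm_pow, norm_norm, Real.norm_eq_abs (_ - _)]
    have h3 := norm_inner_le_norm (𝕜 := ℝ) ζ₀ (gr a ζ - gr a ζ')
    calc _ ≤ ‖ζ₀‖ ^ 2 * (2 * t) + (‖ζ₀‖ * (2 * t)) * ‖ζ₀‖ + t * ‖ζ₀‖ := by
          gcongr
          exact h3.trans (by gcongr)
      _ = _ := by ring
  have hcov : S ⊆ ⋃ k ∈ Finset.Icc ⌊-M / t⌋ ⌊M / t⌋, {ζ ∈ S | ⌊⟪ζ₀, ζ⟫ / t⌋ = k} := by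
    intro ζ hz
    have h1 : |⟪ζ₀, ζ⟫| ≤ M := by
      refine (abs_real_inner_le_norm _ _).trans ?_
      rw [hM]
      gcongr
      have := hz.1
      rw [Metric.mem_ball, dist_eq_norm] at this
      have h2 : ζ = ζ₀ + (ζ - ζ₀) := by abel
      rw [h2]
      exact (norm_add_le _ _).trans (by gcongr)
    obtain ⟨h2, h3⟩ := abs_le.1 h1
    simp only [mem_iUnion]
    refine ⟨⌊⟪ζ₀, ζ⟫ / t⌋, Finset.mem_Icc.2 ⟨?_, ?_⟩, hz, rfl⟩
    · exact Int.floor_le_floor (by gcongr)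
    · exact Int.floor_le_floor (by gcongr)
  have hslab : ∀ k : ℤ, volume {ζ ∈ S | ⌊⟪ζ₀, ζ⟫ / t⌋ = k} ≤ ENNReal.ofReal ((C1 * t) ^ d * ω) := by
    intro k
    rcases Set.eq_empty_or_nonempty {ζ ∈ S | ⌊⟪ζ₀, ζ⟫ / t⌋ = k} with h | ⟨ζ, hz⟩
    · rw [h]; simp
    · rw [← hvol ζ _ (by positivity)]
      refine measure_mono fun ζ' hz' => ?_
      rw [mem_closedBall_iff_norm]
      refine hdiam ζ hz.1 ζ' hz'.1 ?_
      have h1 := Int.abs_sub_lt_one_of_floor_eq_floor (hz.2.trans hz'.2.symm)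
      rw [← sub_div, abs_div, abs_of_pos ht, div_lt_one ht] at h1
      exact h1.le
  calc volume S ≤ ∑ k ∈ Finset.Icc ⌊-M / t⌋ ⌊M / t⌋, volume {ζ ∈ S | ⌊⟪ζ₀, ζ⟫ / t⌋ = k} :=
        (measure_mono hcov).trans (measure_biUnion_finset_le _ _)
    _ ≤ ∑ k ∈ Finset.Icc ⌊-M / t⌋ ⌊M / t⌋, ENNReal.ofReal ((C1 * t) ^ d * ω) :=
        Finset.sum_le_sum fun k _ => hslab k
    _ = ENNReal.ofReal ((Finset.Icc ⌊-M / t⌋ ⌊M / t⌋).card * ((C1 * t) ^ d * ω)) := by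
        rw [Finset.sum_const, nsmul_eq_mul, ENNReal.ofReal_mul (p := (Finset.card _ : ℝ)) (Nat.cast_nonneg _),
          ENNReal.ofReal_natCast]
    _ ≤ _ := by
        apply ENNReal.ofReal_le_ofReal
        have hcard : ((Finset.Icc ⌊-M / t⌋ ⌊M / t⌋).card : ℝ) ≤ (2 * M + 2) / t := by
          rw [Int.card_Icc]
          have h1 : ((⌊M / t⌋ + 1 - ⌊-M / t⌋).toNat : ℝ) = ((⌊M / t⌋ + 1 - ⌊-M / t⌋ : ℤ) : ℝ) := by
            have : ⌊-M / t⌋ ≤ ⌊M / t⌋ := Int.floor_le_floor (by gcongr; linarith)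
            exact_mod_cast Int.toNat_of_nonneg (by omega)
          rw [h1]
          push_cast
          have h2 := Int.floor_le (M / t)
          have h3 := Int.lt_floor_add_one (-M / t)
          have h4 : (2 * M + 2) / t = M / t - (-M / t) + 2 / t := by ring
          have h5 : 2 ≤ 2 / t := by rw [le_div_iff₀ ht]; linarith
          linarith
        have h6 : t ^ d = t * t ^ (d - 1) := by rw [← pow_succ', Nat.sub_add_cancel hd]
        calc _ ≤ (2 * M + 2) / t * ((C1 * t) ^ d * ω) := by gcongr
          _ = (2 * M + 2) * (C1 ^ d * ω) * t ^ (d - 1) := by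
              rw [mul_pow, h6]; field_simp
          _ ≤ _ := by
              gcongr
              have : 0 ≤ ρ ^ d * ω := by positivity
              linarith

lemma volume_gr_near (hd : 1 ≤ d) (ha : IsDistFn a) (hc : CurvNondeg a) {K : Set (Rd d)}
    (hK : IsCompact K) (h0 : (0 : Rd d) ∉ K) :
    ∃ C > 0, ∀ t > 0, ∀ v : Rd d,
      volume {ζ ∈ K | ‖gr a ζ - v‖ ≤ t} ≤ ENNReal.ofReal (C * t ^ (d - 1)) := by
  refine hK.induction_on (p := fun K => ∃ C > 0, ∀ t > 0, ∀ v : Rd d,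
      volume {ζ ∈ K | ‖gr a ζ - v‖ ≤ t} ≤ ENNReal.ofReal (C * t ^ (d - 1))) ?_ ?_ ?_ ?_
  · exact ⟨1, one_pos, fun ζ h => by simp⟩
  · rintro s t hst ⟨C, hC, h⟩
    refine ⟨C, hC, fun τ hτ v => le_trans (measure_mono ?_) (h τ hτ v)⟩
    exact fun ζ hζ => ⟨hst hζ.1, hζ.2⟩
  · rintro s t ⟨C, hC, h⟩ ⟨C', hC', h'⟩
    refine ⟨C + C', by positivity, fun τ hτ v => ?_⟩
    calc volume {ζ ∈ s ∪ t | ‖gr a ζ - v‖ ≤ τ}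
        ≤ volume ({ζ ∈ s | ‖gr a ζ - v‖ ≤ τ} ∪ {ζ ∈ t | ‖gr a ζ - v‖ ≤ τ}) := by
          refine measure_mono ?_
          rintro ζ ⟨hζ | hζ, h⟩
          · exact Or.inl ⟨hζ, h⟩
          · exact Or.inr ⟨hζ, h⟩
      _ ≤ _ := (measure_union_le _ _).trans (add_le_add (h τ hτ v) (h' τ hτ v))
      _ = _ := by rw [← ENNReal.ofReal_add (by positivity) (by positivity), add_mul]
  · intro ζ hζ
    obtain ⟨U, hU, C, hC, h⟩ := volume_gr_near_local hd ha hc (fun h => h0 (h ▸ hζ))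
    exact ⟨U, mem_nhdsWithin_of_mem_nhds hU, C, hC, h⟩

end geometry

lemma contDiff_intervalIntegral {Q : Type*} [NormedAddCommGroup Q] [NormedSpace ℝ Q]
    {F : Q → ℝ → ℝ} (hF : ContDiff ℝ (⊤ : ℕ∞) (fun z : Q × ℝ => F z.1 z.2)) :
    ContDiff ℝ (⊤ : ℕ∞) (fun q => ∫ t in (0:ℝ)..1, F q t) := by
  let χ : ContDiffBump (0 : ℝ) := ⟨1, 2, one_pos, one_lt_two⟩
  let g : Q → ℝ → ℝ := fun q s => χ s * F q (-s)
  have hg : ContDiff ℝ (⊤ : ℕ∞) (fun z : Q × ℝ => g z.1 z.2) :=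
    (χ.contDiff.comp contDiff_snd).mul (hF.comp (contDiff_fst.prodMk contDiff_snd.neg))
  have h1 := contDiffOn_convolution_right_with_param_comp (n := (⊤ : ℕ∞)) (μ := volume)
    (f := (Ioc (0:ℝ) 1).indicator (fun _ => (1:ℝ))) (ContinuousLinearMap.mul ℝ ℝ)
    (g := g) (s := univ) (v := fun _ : Q => (0:ℝ)) (k := Metric.closedBall 0 2)
    contDiffOn_const isOpen_univ
    (isCompact_closedBall _ _) (fun q s _ hs => by
      have : χ s = 0 := χ.zero_of_le_dist (by
        rw [Metric.mem_closedBall, not_le] at hs; exact hs.le)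
      simp [g, this])
    ((integrable_indicator_iff measurableSet_Ioc).2
      (integrableOn_const (by simp))).locallyIntegrable hg.contDiffOn
  rw [contDiffOn_univ] at h1
  convert h1 using 2 with q
  rw [convolution_def, intervalIntegral.integral_of_le zero_le_one,
    ← integral_indicator measurableSet_Ioc]
  congr 1
  ext t
  by_cases ht : t ∈ Ioc (0:ℝ) 1
  · have : χ (-t) = 1 := χ.one_of_mem_closedBall (by
      rw [mem_closedBall_zero_iff, norm_neg, Real.norm_eq_abs, abs_of_pos ht.1]; exact ht.2)
    simp [g, ht, this]
  · simp [ht]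

section taylor
variable {E : Type*} [NormedAddCommGroup E] [NormedSpace ℝ E]

/-- The second order Taylor remainder `(b(y + εz) - b(y) - ε db(y)z) / ε²`. -/
def taylorRem (b : E → ℝ) (y z : E) (ε : ℝ) : ℝ :=
  ∫ t in (0:ℝ)..1, (1 - t) * fderiv ℝ (fderiv ℝ b) (y + (t * ε) • z) z z

lemma contDiff_taylorRem {b : E → ℝ} (hb : ContDiff ℝ (⊤ : ℕ∞) b) :
    ContDiff ℝ (⊤ : ℕ∞) (fun q : E × E × ℝ => taylorRem b q.1 q.2.1 q.2.2) := by
  have h2 : ContDiff ℝ (⊤ : ℕ∞) (fderiv ℝ (fderiv ℝ b)) :=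
    (hb.fderiv_right le_rfl).fderiv_right le_rfl
  refine contDiff_intervalIntegral (F := fun (q : E × E × ℝ) t =>
    (1 - t) * fderiv ℝ (fderiv ℝ b) (q.1 + (t * q.2.2) • q.2.1) q.2.1 q.2.1) ?_
  fun_prop

lemma taylorRem_eq {b : E → ℝ} (hb : ContDiff ℝ (⊤ : ℕ∞) b) (y z : E) (ε : ℝ) :
    b (y + ε • z) = b y + ε * fderiv ℝ b y z + ε ^ 2 * taylorRem b y z ε := by
  have h1 : ∀ x, HasFDerivAt b (fderiv ℝ b x) x := fun x =>
    (hb.differentiable (by simp) x).hasFDerivAt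
  have hb' : ContDiff ℝ (⊤ : ℕ∞) (fderiv ℝ b) := hb.fderiv_right le_rfl
  have h2 : ∀ x, HasFDerivAt (fderiv ℝ b) (fderiv ℝ (fderiv ℝ b) x) x := fun x =>
    (hb'.differentiable (by simp) x).hasFDerivAt
  have hl : ∀ t : ℝ, HasDerivAt (fun t : ℝ => y + (t * ε) • z) (ε • z) t := by
    intro t
    have := (((hasDerivAt_id t).mul_const ε).smul_const z).const_add y
    simpa using this
  have hφ : ∀ t : ℝ, HasDerivAt (fun t : ℝ => b (y + (t * ε) • z))
      (fderiv ℝ b (y + (t * ε) • z) (ε • z)) t := fun t => (h1 _).comp_hasDerivAt t (hl t)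
  have hφ' : ∀ t : ℝ, HasDerivAt (fun t : ℝ => fderiv ℝ b (y + (t * ε) • z) (ε • z))
      (fderiv ℝ (fderiv ℝ b) (y + (t * ε) • z) (ε • z) (ε • z)) t := by
    intro t
    have := (h2 _).comp_hasDerivAt t (hl t)
    exact this.clm_apply (hasDerivAt_const t (ε • z)) |>.congr_deriv (by simp)
  have hΦ : ∀ t ∈ uIcc (0:ℝ) 1, HasDerivAt (fun t : ℝ => b (y + (t * ε) • z) +
      (1 - t) * fderiv ℝ b (y + (t * ε) • z) (ε • z))
      (ε ^ 2 * ((1 - t) * fderiv ℝ (fderiv ℝ b) (y + (t * ε) • z) z z)) t := by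
    intro t _
    have := (hφ t).add (((hasDerivAt_id t).const_sub 1).mul (hφ' t))
    refine this.congr_deriv ?_
    simp
    ring
  have hc : ContDiff ℝ (⊤ : ℕ∞) (fun t : ℝ =>
      ε ^ 2 * ((1 - t) * fderiv ℝ (fderiv ℝ b) (y + (t * ε) • z) z z)) := by
    have h2 : ContDiff ℝ (⊤ : ℕ∞) (fderiv ℝ (fderiv ℝ b)) := hb'.fderiv_right le_rfl
    fun_prop
  have := intervalIntegral.integral_eq_sub_of_hasDerivAt hΦ
    (hc.continuous.intervalIntegrable _ _)
  rw [intervalIntegral.integral_const_mul] at this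
  rw [taylorRem, this]
  simp

end taylor

/-- A function that is smooth off the origin coincides away from a neighbourhood of the origin with
a smooth function. -/
lemma IsDistFn.exists_contDiff {d : ℕ} {a : Rd d → ℝ} (ha : IsDistFn a) {δ : ℝ} (hδ : 0 < δ) :
    ∃ b : Rd d → ℝ, ContDiff ℝ (⊤ : ℕ∞) b ∧ ∀ ξ, δ ≤ ‖ξ‖ → b ξ = a ξ := by
  let χ : ContDiffBump (0 : Rd d) := ⟨δ / 2, δ, by positivity, by linarith⟩
  refine ⟨fun ξ => (1 - χ ξ) * a ξ, ?_, fun ξ hξ => ?_⟩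
  · rw [contDiff_iff_contDiffAt]
    intro ξ
    rcases eq_or_ne ξ 0 with h | h
    · subst h
      refine (contDiffAt_const (c := (0:ℝ))).congr_of_eventuallyEq ?_
      filter_upwards [χ.eventuallyEq_one] with ξ hξ
      simp [hξ]
    · exact (contDiffAt_const.sub χ.contDiff.contDiffAt).mul (ha.contDiffAt h)
  · have : χ ξ = 0 := χ.zero_of_le_dist (by simpa using hξ)
    simp [this]

section kernel
variable {d : ℕ} {a : Rd d → ℝ}

/-- The oscillatory kernel with phase `r a(ξ) + 2π⟨x, ξ⟩` and amplitude `u`. -/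
def oscKer (u : Rd d → ℝ) (a : Rd d → ℝ) (r : ℝ) (x : Rd d) : ℂ :=
  ∫ ξ : Rd d, (u ξ : ℂ) * Complex.exp (Complex.I * r * a ξ) *
    Complex.exp (2 * π * Complex.I * (inner ℝ x ξ : ℝ))

/-- A smooth amplitude supported in the annulus `m ≤ |ξ| ≤ M`. -/
structure IsAmp (u : Rd d → ℝ) (m M : ℝ) : Prop where
  smooth : ContDiff ℝ (⊤ : ℕ∞) u
  pos : 0 < m
  supp : ∀ ξ, u ξ ≠ 0 → m ≤ ‖ξ‖ ∧ ‖ξ‖ ≤ M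

/-- The gradient of the phase. -/
def phGrad (a : Rd d → ℝ) (r : ℝ) (x ζ : Rd d) : Rd d := (2 * π) • x + r • gr a ζ

/-- The frequency size of the wave packet at `ζ`. -/
def packetSize (a : Rd d → ℝ) (r : ℝ) (x ζ : Rd d) : ℝ :=
  |⟪ζ, phGrad a r x ζ⟫| + (√r)⁻¹ * ‖phGrad a r x ζ‖

lemma packetSize_nonneg (r : ℝ) (x ζ : Rd d) : 0 ≤ packetSize a r x ζ := by
  unfold packetSize; positivity

/-- Averaging an integral over dilates and translates. -/
lemma integral_packet {h : Rd d → ℂ} (hc : Continuous h) (hs : HasCompactSupport h)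
    {κ : ℝ → ℝ} {φ : Rd d → ℝ} (hκ : Continuous κ) (hφ : Continuous φ)
    (hκs : ∀ ρ, κ ρ ≠ 0 → 1 ≤ ρ ∧ ρ ≤ 2) (hφs : ∀ z, φ z ≠ 0 → ‖z‖ ≤ 1)
    (hκ1 : ∫ ρ, κ ρ = 1) (hφ1 : ∫ z, φ z = 1) (ε : ℝ) :
    ∫ ζ : Rd d, ∫ v : ℝ × Rd d, ((κ v.1 * v.1 ^ d * φ v.2 : ℝ) : ℂ) * h (v.1 • ζ + ε • v.2)
      = ∫ ξ, h ξ := by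
  obtain ⟨R, hR⟩ := hs.isCompact.isBounded.subset_closedBall 0
  have hhR : ∀ ξ, h ξ ≠ 0 → ‖ξ‖ ≤ R := fun ξ hξ => by
    simpa using hR (subset_tsupport _ hξ)
  rw [integral_integral_swap]
  · have h1 : ∀ v : ℝ × Rd d, ∫ ζ : Rd d,
        ((κ v.1 * v.1 ^ d * φ v.2 : ℝ) : ℂ) * h (v.1 • ζ + ε • v.2)
        = ((κ v.1 : ℝ) : ℂ) * ((φ v.2 : ℝ) : ℂ) * ∫ ξ, h ξ := by
      rintro ⟨ρ, z⟩
      simp only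
      by_cases h0 : κ ρ = 0
      · simp [h0]
      have hρ : 0 < ρ := by linarith [(hκs ρ h0).1]
      rw [integral_const_mul,
        Measure.integral_comp_smul volume (fun ξ => h (ξ + ε • z)) ρ, integral_add_right_eq_self]
      simp only [finrank_euclideanSpace, Fintype.card_fin]
      rw [abs_of_pos (by positivity), Complex.real_smul]
      push_cast
      have : (ρ : ℂ) ≠ 0 := by exact_mod_cast hρ.ne'
      field_simp
    simp_rw [h1]
    rw [integral_mul_const, Measure.volume_eq_prod,
      integral_prod_mul (fun ρ : ℝ => ((κ ρ : ℝ) : ℂ)) (fun z : Rd d => ((φ z : ℝ) : ℂ)),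
      integral_complex_ofReal, integral_complex_ofReal, hκ1, hφ1]
    simp
  · refine Continuous.integrable_of_hasCompactSupport ?_ ?_
    · simp only [Function.uncurry_def]
      fun_prop
    · refine HasCompactSupport.intro (K := Metric.closedBall 0 (R + |ε|) ×ˢ
        (Icc 1 2 ×ˢ Metric.closedBall 0 1)) ((isCompact_closedBall _ _).prod
          (isCompact_Icc.prod (isCompact_closedBall _ _))) ?_
      rintro ⟨ζ, ρ, z⟩ hn
      by_contra h0
      simp only [Function.uncurry_apply_pair, mul_eq_zero, not_or, Complex.ofReal_mul,
        Complex.ofReal_eq_zero] at h0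
      obtain ⟨⟨⟨h1, -⟩, h2⟩, h3⟩ := h0
      have h4 := hκs ρ h1
      have h5 := hφs z h2
      have h6 := hhR _ h3
      apply hn
      refine ⟨?_, h4, by simpa using h5⟩
      rw [mem_closedBall_zero_iff]
      have h7 : ‖ρ • ζ‖ ≤ R + |ε| := by
        have : ρ • ζ = (ρ • ζ + ε • z) - ε • z := by abel
        rw [this]
        refine (norm_sub_le _ _).trans ?_
        rw [norm_smul ε, Real.norm_eq_abs]
        gcongr
        exact mul_le_of_le_one_right (abs_nonneg _) h5
      rw [norm_smul, Real.norm_eq_abs, abs_of_pos (by linarith)] at h7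
      nlinarith [norm_nonneg ζ]

lemma oscKer_le_packets (ha : IsDistFn a) {u : Rd d → ℝ} {m M : ℝ} (hu : IsAmp u m M) (N : ℕ) :
    ∃ C : ℝ, 0 ≤ C ∧ ∃ r₀ : ℝ, 1 ≤ r₀ ∧ ∀ r, r₀ ≤ r → ∀ x,
      ‖oscKer u a r x‖ₑ ≤ ∫⁻ ζ in {ζ : Rd d | m / 4 ≤ ‖ζ‖ ∧ ‖ζ‖ ≤ M + m},
        ENNReal.ofReal (C / (1 + packetSize a r x ζ) ^ N) := by
  have hm := hu.pos
  obtain ⟨b, hb, hba⟩ := ha.exists_contDiff (show 0 < m / 8 by positivity)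
  let κ₀ : ContDiffBump (3 / 2 : ℝ) := ⟨1 / 4, 1 / 2, by norm_num, by norm_num⟩
  let φ₀ : ContDiffBump (0 : Rd d) := ⟨1 / 2, 1, by norm_num, by norm_num⟩
  set κ := κ₀.normed volume with hκ
  set φ := φ₀.normed volume with hφ
  have hκc : ContDiff ℝ (⊤ : ℕ∞) κ := κ₀.contDiff_normed
  have hφc : ContDiff ℝ (⊤ : ℕ∞) φ := φ₀.contDiff_normed
  have hκs : ∀ ρ, κ ρ ≠ 0 → 1 ≤ ρ ∧ ρ ≤ 2 := by
    intro ρ hρ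
    have h1 : ρ ∈ Function.support κ := hρ
    rw [hκ, κ₀.support_normed_eq, Real.ball_eq_Ioo] at h1
    exact ⟨by have := h1.1; norm_num [κ₀] at this; linarith,
      by have := h1.2; norm_num [κ₀] at this; linarith⟩
  have hφs : ∀ z, φ z ≠ 0 → ‖z‖ ≤ 1 := by
    intro z hz
    have h1 : z ∈ Function.support φ := hz
    rw [hφ, φ₀.support_normed_eq] at h1
    have := mem_ball_zero_iff.1 h1
    exact this.le
  -- the amplitude
  let A : ℝ × Rd d → Rd d × ℝ → ℂ := fun v q =>
    ((κ v.1 * v.1 ^ d * φ v.2 * u (v.1 • q.1 + q.2 • v.2) : ℝ) : ℂ) *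
      Complex.exp (Complex.I * (taylorRem b (v.1 • q.1) v.2 q.2 : ℝ))
  have hA : ContDiff ℝ (⊤ : ℕ∞) (fun z : (ℝ × Rd d) × (Rd d × ℝ) => A z.1 z.2) := by
    have hu' := hu.smooth
    have h1 : ContDiff ℝ (⊤ : ℕ∞) (fun z : (ℝ × Rd d) × (Rd d × ℝ) =>
        (κ z.1.1 * z.1.1 ^ d * φ z.1.2 * u (z.1.1 • z.2.1 + z.2.2 • z.1.2) : ℝ)) := by
      fun_prop
    have h2 : ContDiff ℝ (⊤ : ℕ∞) (fun z : (ℝ × Rd d) × (Rd d × ℝ) =>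
        taylorRem b (z.1.1 • z.2.1) z.1.2 z.2.2) := by
      refine (contDiff_taylorRem hb).comp
        (g := fun q : Rd d × Rd d × ℝ => taylorRem b q.1 q.2.1 q.2.2)
        (f := fun z : (ℝ × Rd d) × (Rd d × ℝ) => (z.1.1 • z.2.1, z.1.2, z.2.2)) ?_
      fun_prop
    exact (Complex.ofRealCLM.contDiff.comp h1).mul
      ((contDiff_const.mul (Complex.ofRealCLM.contDiff.comp h2)).cexp)
  have : (volume : Measure (ℝ × Rd d)).IsAddHaarMeasure := by
    rw [Measure.volume_eq_prod]; infer_instance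
  obtain ⟨C, hC, hdec⟩ := uniform_fourier_decay (volume : Measure (ℝ × Rd d)) hA
    (K := Icc 1 2 ×ˢ Metric.closedBall 0 1) (isCompact_Icc.prod (isCompact_closedBall _ _))
    (fun v q hv => by
      have : κ v.1 = 0 ∨ φ v.2 = 0 := by
        by_contra! h
        exact hv ⟨hκs _ h.1, by simpa using hφs _ h.2⟩
      rcases this with h | h <;> simp [A, h])
    (S := Metric.closedBall 0 (M + m) ×ˢ Icc 0 (m / 8))
    ((isCompact_closedBall _ _).prod isCompact_Icc) N
  refine ⟨2 ^ N * C, by positivity, max 1 ((8 / m) ^ 2), le_max_left _ _, fun r hr x => ?_⟩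
  have hr1 : 1 ≤ r := (le_max_left _ _).trans hr
  have hsr : 0 < √r := Real.sqrt_pos.2 (by linarith)
  set ε := (√r)⁻¹ with hε
  have hε0 : 0 < ε := inv_pos.2 hsr
  have hεm : ε ≤ m / 8 := by
    rw [hε, inv_le_comm₀ hsr (by positivity), inv_div]
    exact Real.le_sqrt_of_sq_le ((le_max_right _ _).trans hr)
  have hε2 : r * ε ^ 2 = 1 := by
    rw [hε, inv_pow, Real.sq_sqrt (by linarith)]
    exact mul_inv_cancel₀ (by linarith)
  let h : Rd d → ℂ := fun ξ => (u ξ : ℂ) * Complex.exp (Complex.I * (r * b ξ + 2 * π * ⟪x, ξ⟫ : ℝ))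
  have hcont : Continuous h := by
    have := hu.smooth.continuous
    have := hb.continuous
    fun_prop
  have hcs : HasCompactSupport h := by
    refine HasCompactSupport.intro (isCompact_closedBall 0 M) fun ξ hξ => ?_
    by_contra h0
    have : u ξ ≠ 0 := fun h' => h0 (by simp [h, h'])
    exact hξ (by simpa using (hu.supp ξ this).2)
  have hosc : oscKer u a r x = ∫ ξ, h ξ := by
    unfold oscKer
    congr 1
    ext ξ
    by_cases h0 : u ξ = 0
    · simp [h, h0]
    · have := hba ξ (by linarith [(hu.supp ξ h0).1])
      simp only [h]
      rw [mul_assoc, ← Complex.exp_add, this]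
      congr 2
      push_cast
      ring
  have hκ1 : ∫ ρ, κ ρ = 1 := κ₀.integral_normed
  have hφ1 : ∫ z, φ z = 1 := φ₀.integral_normed
  rw [hosc, ← integral_packet hcont hcs hκc.continuous hφc.continuous hκs hφs hκ1 hφ1 ε]
  refine (enorm_integral_le_lintegral_enorm _).trans ?_
  set K' := {ζ : Rd d | m / 4 ≤ ‖ζ‖ ∧ ‖ζ‖ ≤ M + m} with hK'
  have hK'm : MeasurableSet K' := by
    have h1 : IsClosed K' := (isClosed_le continuous_const continuous_norm).inter
      (isClosed_le continuous_norm continuous_const)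
    exact h1.measurableSet
  rw [← lintegral_indicator hK'm]
  refine lintegral_mono fun ζ => ?_
  -- the support of the packets
  have hζs : ∀ v : ℝ × Rd d, κ v.1 ≠ 0 → φ v.2 ≠ 0 → u (v.1 • ζ + ε • v.2) ≠ 0 →
      m / 2 ≤ ‖v.1 • ζ‖ ∧ ‖ζ‖ ≤ M + m ∧ m / 4 ≤ ‖ζ‖ := by
    intro v h1 h2 h3
    have h4 := hκs _ h1
    have h5 := hφs _ h2
    have h6 := hu.supp _ h3
    have h7 : ‖ε • v.2‖ ≤ m / 8 := by
      rw [norm_smul, Real.norm_eq_abs, abs_of_pos hε0]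
      calc ε * ‖v.2‖ ≤ ε * 1 := by gcongr
        _ ≤ m / 8 := by linarith
    have h8 : ‖v.1 • ζ‖ = v.1 * ‖ζ‖ := by
      rw [norm_smul, Real.norm_eq_abs, abs_of_pos (by linarith)]
    have h9 := norm_add_le (v.1 • ζ) (ε • v.2)
    have h10 := norm_sub_le (v.1 • ζ + ε • v.2) (ε • v.2)
    rw [add_sub_cancel_right] at h10
    refine ⟨by linarith, ?_, ?_⟩ <;> nlinarith [norm_nonneg ζ]
  by_cases hζ : ζ ∈ K'
  swap
  · have : ∀ v : ℝ × Rd d, ((κ v.1 * v.1 ^ d * φ v.2 : ℝ) : ℂ) * h (v.1 • ζ + ε • v.2) = 0 := by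
      intro v
      by_contra h0
      simp only [mul_eq_zero, not_or, Complex.ofReal_mul, Complex.ofReal_eq_zero, h] at h0
      obtain ⟨⟨⟨h1, -⟩, h2⟩, h3, -⟩ := h0
      have := hζs v h1 h2 h3
      exact hζ ⟨this.2.2, this.2.1⟩
    simp_rw [this]
    simp
  rw [indicator_of_mem hζ]
  have hζ0 : ζ ≠ 0 := by
    intro h0
    have := hζ.1
    rw [h0, norm_zero] at this
    linarith
  set G := phGrad a r x ζ with hG
  let w : ℝ × Rd d →L[ℝ] ℝ := (⟪ζ, G⟫ • ContinuousLinearMap.fst ℝ ℝ (Rd d)) +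
    ε • ((innerSL ℝ G).comp (ContinuousLinearMap.snd ℝ ℝ (Rd d)))
  have hw : ∀ v, w v = v.1 * ⟪ζ, G⟫ + ε * ⟪G, v.2⟫ := by
    intro v; simp [w, mul_comm]
  have key : ∀ v : ℝ × Rd d, ((κ v.1 * v.1 ^ d * φ v.2 : ℝ) : ℂ) * h (v.1 • ζ + ε • v.2) =
      Complex.exp (Complex.I * (w v : ℝ)) * A v (ζ, ε) := by
    intro v
    simp only [A, h]
    by_cases h0 : κ v.1 = 0 ∨ φ v.2 = 0 ∨ u (v.1 • ζ + ε • v.2) = 0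
    · rcases h0 with h0 | h0 | h0 <;> simp [h0]
    push Not at h0
    obtain ⟨h1, h2, h3⟩ := h0
    have h4 := hκs _ h1
    have h5 := (hζs v h1 h2 h3).1
    have hph : r * b (v.1 • ζ + ε • v.2) + 2 * π * ⟪x, v.1 • ζ + ε • v.2⟫ =
        w v + taylorRem b (v.1 • ζ) v.2 ε := by
      rw [taylorRem_eq hb, hw, hba _ (by linarith), ha.homog _ (by linarith)]
      have h6 : fderiv ℝ b (v.1 • ζ) = fderiv ℝ a (v.1 • ζ) := by
        refine Filter.EventuallyEq.fderiv_eq ?_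
        have : {y : Rd d | m / 8 < ‖y‖} ∈ nhds (v.1 • ζ) :=
          (isOpen_lt continuous_const continuous_norm).mem_nhds (by
            simp only [mem_ofPred_eq]; linarith)
        filter_upwards [this] with y hy
        exact hba y (le_of_lt hy)
      rw [h6, ha.fderiv_smul (by linarith), ← inner_gr, ← inner_gr_self ha hζ0]
      simp only [hG, phGrad, inner_add_right, inner_add_left, inner_smul_left, inner_smul_right,
        real_inner_comm ζ, RCLike.conj_to_real]
      linear_combination (taylorRem b (v.1 • ζ) v.2 ε) * hε2
    rw [hph]
    push_cast
    rw [mul_add, Complex.exp_add]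
    ring
  simp_rw [key]
  have h1 := hdec (ζ, ε) ⟨by simpa using hζ.2, hε0.le, hεm⟩ w
  have hw1 : |⟪ζ, G⟫| ≤ ‖w‖ := by
    have := w.le_opNorm ((1 : ℝ), (0 : Rd d))
    rw [hw] at this
    simpa [Prod.norm_def] using this
  have hw2 : ε * ‖G‖ ≤ ‖w‖ := by
    rcases eq_or_ne G 0 with h0 | h0
    · rw [h0]; simp
    have hGn : 0 < ‖G‖ := norm_pos_iff.2 h0
    have := w.le_opNorm ((0 : ℝ), G)
    rw [hw, real_inner_self_eq_norm_sq] at this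
    simp only [zero_mul, zero_add, Prod.norm_def, norm_zero, norm_mul, Real.norm_eq_abs,
      abs_of_pos hε0, norm_nonneg, sup_of_le_right, norm_pow, abs_norm] at this
    rw [pow_two, ← mul_assoc] at this
    exact le_of_mul_le_mul_right this hGn
  have hps : 1 + packetSize a r x ζ ≤ 2 * (1 + ‖w‖) := by
    rw [packetSize, ← hG, ← hε]; linarith
  have hps0 := packetSize_nonneg (a := a) r x ζ
  rw [← ofReal_norm]
  apply ENNReal.ofReal_le_ofReal
  rw [le_div_iff₀ (by positivity)]
  calc _ ≤ ‖∫ v, Complex.exp (Complex.I * (w v : ℝ)) * A v (ζ, ε)‖ * (2 * (1 + ‖w‖)) ^ N := by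
        gcongr
    _ = 2 ^ N * ((1 + ‖w‖) ^ N * ‖∫ v, Complex.exp (Complex.I * (w v : ℝ)) * A v (ζ, ε)‖) := by
        rw [mul_pow]; ring
    _ ≤ _ := by gcongr

end kernel

section phdist
variable {d : ℕ} {a : Rd d → ℝ}

/-- The distance from the origin to the range of the phase gradient. -/
def phDist (a : Rd d → ℝ) (r : ℝ) (x : Rd d) : ℝ :=
  Metric.infDist 0 (phGrad a r x '' Metric.sphere 0 1)

lemma phDist_nonneg (r : ℝ) (x : Rd d) : 0 ≤ phDist a r x := Metric.infDist_nonneg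

lemma gr_normalize (ha : IsDistFn a) {ζ : Rd d} (hζ : ζ ≠ 0) : gr a (‖ζ‖⁻¹ • ζ) = gr a ζ :=
  gr_smul ha (inv_pos.2 (norm_pos_iff.2 hζ)) ζ

lemma phDist_le (ha : IsDistFn a) (r : ℝ) (x : Rd d) {ζ : Rd d} (hζ : ζ ≠ 0) :
    phDist a r x ≤ ‖phGrad a r x ζ‖ := by
  have h : phGrad a r x ζ ∈ phGrad a r x '' Metric.sphere 0 1 := by
    refine ⟨‖ζ‖⁻¹ • ζ, ?_, by rw [phGrad, gr_normalize ha hζ, phGrad]⟩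
    rw [mem_sphere_zero_iff_norm, norm_smul, norm_inv, norm_norm,
      inv_mul_cancel₀ (norm_ne_zero_iff.2 hζ)]
  have := Metric.infDist_le_dist_of_mem (x := (0 : Rd d)) h
  rwa [dist_zero_left] at this

lemma continuousOn_gr (ha : IsDistFn a) : ContinuousOn (gr a) {0}ᶜ := fun _ hζ =>
  (contDiffAt_gr ha hζ).continuousAt.continuousWithinAt

lemma exists_phDist_eq (hd : 1 ≤ d) (ha : IsDistFn a) (r : ℝ) (x : Rd d) :
    ∃ ζ : Rd d, ‖ζ‖ = 1 ∧ phDist a r x = ‖phGrad a r x ζ‖ := by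
  have : NeZero d := ⟨by omega⟩
  have hcomp : IsCompact (phGrad a r x '' Metric.sphere 0 1) := by
    refine (isCompact_sphere _ _).image_of_continuousOn ?_
    refine continuousOn_const.add (((continuousOn_gr ha).mono ?_).const_smul r)
    intro z hz h0
    rw [mem_sphere_zero_iff_norm, mem_singleton_iff.1 h0] at hz
    simp at hz
  obtain ⟨y, ⟨ζ, hζ, rfl⟩, h⟩ := hcomp.exists_infDist_eq_dist
    ((NormedSpace.sphere_nonempty.2 zero_le_one).image _) (0 : Rd d)
  exact ⟨ζ, by simpa using hζ, by rw [phDist, h, dist_zero_left]⟩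

lemma phGrad_neg (r : ℝ) (x ζ : Rd d) : phGrad a (-r) (-x) ζ = - phGrad a r x ζ := by
  simp only [phGrad, smul_neg, neg_smul]; abel

lemma phDist_neg (hd : 1 ≤ d) (ha : IsDistFn a) (r : ℝ) (x : Rd d) :
    phDist a (-r) (-x) = phDist a r x := by
  have key : ∀ r x, phDist a (-r) (-x) ≤ phDist a r x := by
    intro r x
    obtain ⟨ζ, hζ, h⟩ := exists_phDist_eq hd ha r x
    rw [h, ← norm_neg, ← phGrad_neg]
    exact phDist_le ha _ _ (by rintro rfl; simp at hζ)
  refine le_antisymm (key r x) ?_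
  simpa using key (-r) (-x)

lemma exists_gr_bound (ha : IsDistFn a) : ∃ L : ℝ, 0 < L ∧ ∀ ζ ≠ 0, ‖gr a ζ‖ ≤ L := by
  have h : BddAbove ((fun ζ => ‖gr a ζ‖) '' Metric.sphere 0 1) := by
    refine (isCompact_sphere _ _).bddAbove_image ((continuousOn_gr ha).norm.mono ?_)
    intro z hz h0
    rw [mem_sphere_zero_iff_norm, mem_singleton_iff.1 h0] at hz
    simp at hz
  obtain ⟨L, hL⟩ := h
  refine ⟨max L 1, by positivity, fun ζ hζ => (le_trans ?_ (le_max_left L 1))⟩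
  rw [← gr_normalize ha hζ]
  refine hL ⟨_, ?_, rfl⟩
  rw [mem_sphere_zero_iff_norm, norm_smul, norm_inv, norm_norm,
    inv_mul_cancel₀ (norm_ne_zero_iff.2 hζ)]

/-- The distance function is Lipschitz and grows linearly away from the light cone. -/
lemma exists_phDist_lipschitz (hd : 1 ≤ d) (ha : IsDistFn a) : ∃ L : ℝ, 1 ≤ L ∧
    (∀ r r' x x', phDist a r x ≤ phDist a r' x' + L * (|r - r'| + ‖x - x'‖)) ∧
    (∀ r x, ‖x‖ ≤ phDist a r x + L * |r|) ∧ ∀ x, phDist a 0 x ≤ L * ‖x‖ := by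
  obtain ⟨L, hL, hb⟩ := exists_gr_bound ha
  have hpi := Real.pi_pos
  have hpi3 := Real.pi_gt_three
  refine ⟨L + 2 * π, by linarith, fun r r' x x' => ?_, fun r x => ?_, fun x => ?_⟩
  · obtain ⟨ζ, hζ, h⟩ := exists_phDist_eq hd ha r' x'
    have hζ0 : ζ ≠ 0 := by rintro rfl; simp at hζ
    refine (phDist_le ha r x hζ0).trans ?_
    have h2 : phGrad a r x ζ = phGrad a r' x' ζ + ((2 * π) • (x - x') + (r - r') • gr a ζ) := by
      simp only [phGrad, smul_sub, sub_smul]; abel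
    rw [h2, h]
    refine (norm_add_le _ _).trans ?_
    gcongr
    refine (norm_add_le _ _).trans ?_
    rw [norm_smul, norm_smul, Real.norm_eq_abs, Real.norm_eq_abs, abs_of_pos (by positivity)]
    have := hb ζ hζ0
    nlinarith [abs_nonneg (r - r'), norm_nonneg (x - x'),
      mul_le_mul_of_nonneg_left this (abs_nonneg (r - r'))]
  · obtain ⟨ζ, hζ, h⟩ := exists_phDist_eq hd ha r x
    have hζ0 : ζ ≠ 0 := by rintro rfl; simp at hζ
    have h2 : (2 * π) • x = phGrad a r x ζ - r • gr a ζ := by simp [phGrad]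
    have h3 : 2 * π * ‖x‖ ≤ ‖phGrad a r x ζ‖ + |r| * ‖gr a ζ‖ := by
      have := norm_sub_le (phGrad a r x ζ) (r • gr a ζ)
      rw [← h2, norm_smul, norm_smul, Real.norm_eq_abs, Real.norm_eq_abs,
        abs_of_pos (by positivity)] at this
      exact this
    rw [h]
    have := hb ζ hζ0
    nlinarith [abs_nonneg r, norm_nonneg x, mul_le_mul_of_nonneg_left this (abs_nonneg r)]
  · obtain ⟨ζ, hζ, h⟩ := exists_phDist_eq hd ha 0 x
    rw [h, phGrad, zero_smul, add_zero, norm_smul, Real.norm_eq_abs, abs_of_pos (by positivity)]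
    nlinarith [norm_nonneg x]

lemma measurable_gr (a : Rd d → ℝ) : Measurable (gr a) := by
  have h : gr a = fun ζ => (InnerProductSpace.toDual ℝ (Rd d)).symm (fderiv ℝ a ζ) := rfl
  rw [h]
  exact (LinearIsometryEquiv.continuous _).measurable.comp (measurable_fderiv ℝ a)

end phdist

/-- A weak polynomial growth of sublevel sets gives integrability of negative powers. -/
lemma lintegral_layer {α : Type*} [MeasurableSpace α] (μ : Measure α) {h : α → ℝ}
    (hm : Measurable h) (h0 : ∀ x, 0 ≤ h x) {V : ℝ} (hV : 0 ≤ V) (m : ℕ)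
    (hμ : ∀ t : ℝ, 1 ≤ t → μ {x | h x ≤ t} ≤ ENNReal.ofReal (V * t ^ m)) :
    ∫⁻ x, ENNReal.ofReal (1 / (1 + h x) ^ (m + 1)) ∂μ ≤ ENNReal.ofReal (2 ^ (m + 1) * V) := by
  have hms : ∀ k : ℕ, MeasurableSet {x | h x ≤ 2 ^ (k + 1)} := fun k =>
    measurableSet_le hm measurable_const
  have h1 : ∀ x, ENNReal.ofReal (1 / (1 + h x) ^ (m + 1)) ≤
      ∑' k : ℕ, {x | h x ≤ 2 ^ (k + 1)}.indicator
        (fun _ => ENNReal.ofReal (((1 : ℝ) / 2 ^ (m + 1)) ^ k)) x := by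
    intro x
    obtain ⟨k, hk1, hk2⟩ := exists_nat_pow_near (show (1 : ℝ) ≤ 1 + h x by linarith [h0 x])
      (show (1 : ℝ) < 2 by norm_num)
    refine le_trans ?_ (ENNReal.le_tsum k)
    rw [indicator_of_mem (show x ∈ {x | h x ≤ 2 ^ (k + 1)} by simp only [mem_ofPred_eq]; linarith)]
    apply ENNReal.ofReal_le_ofReal
    rw [div_pow, one_pow, ← pow_mul, mul_comm, pow_mul]
    gcongr
  calc _ ≤ ∫⁻ x, ∑' k : ℕ, {x | h x ≤ 2 ^ (k + 1)}.indicator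
        (fun _ => ENNReal.ofReal (((1 : ℝ) / 2 ^ (m + 1)) ^ k)) x ∂μ := lintegral_mono h1
    _ = ∑' k : ℕ, ENNReal.ofReal (((1 : ℝ) / 2 ^ (m + 1)) ^ k) * μ {x | h x ≤ 2 ^ (k + 1)} := by
        rw [lintegral_tsum fun k => (measurable_const.indicator (hms k)).aemeasurable]
        simp_rw [lintegral_indicator_const (hms _)]
    _ ≤ ∑' k : ℕ, ENNReal.ofReal (2 ^ m * V * (1 / 2) ^ k) := by
        refine ENNReal.tsum_le_tsum fun k => ?_
        refine (mul_le_mul_right (hμ _ (one_le_pow₀ one_le_two)) _).trans ?_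
        rw [← ENNReal.ofReal_mul (by positivity)]
        apply ENNReal.ofReal_le_ofReal
        apply le_of_eq
        rw [div_pow, div_pow, one_pow, ← pow_mul, ← pow_mul]
        field_simp
        ring
    _ = ENNReal.ofReal (2 ^ (m + 1) * V) := by
        rw [← ENNReal.ofReal_tsum_of_nonneg (fun k => by positivity)
          (summable_geometric_two.mul_left _), tsum_mul_left, tsum_geometric_two]
        congr 1
        ring

section decay
variable {d : ℕ} {a : Rd d → ℝ}

lemma oscKer_neg (u : Rd d → ℝ) (a : Rd d → ℝ) (r : ℝ) (x : Rd d) :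
    oscKer u a (-r) (-x) = (starRingEnd ℂ) (oscKer u a r x) := by
  unfold oscKer
  rw [← integral_conj]
  congr 1
  ext ξ
  simp only [map_mul, Complex.conj_ofReal, ← Complex.exp_conj, Complex.conj_I, inner_neg_left,
    map_ofNat]
  push_cast
  ring_nf

lemma one_add_phDist_le (ha : IsDistFn a) {C : ℝ} {r : ℝ} (hr : 1 ≤ r) {x ζ : Rd d} (hC : 0 < C)
    (h : ∀ v : Rd d, ∃ z, z ≠ 0 ∧
      ‖gr a z - v‖ ≤ C * (|⟪ζ, gr a ζ - v⟫| + ‖gr a ζ - v‖ ^ 2)) :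
    1 + phDist a r x ≤ (1 + C) * (1 + packetSize a r x ζ) ^ 2 := by
  have hr0 : 0 < r := by linarith
  obtain ⟨z, hz, hz'⟩ := h (-(r⁻¹ • ((2 * π) • x)))
  have key : ∀ z, phGrad a r x z = r • (gr a z - -(r⁻¹ • ((2 * π) • x))) := by
    intro z
    rw [phGrad, sub_neg_eq_add, smul_add, smul_smul r, mul_inv_cancel₀ hr0.ne', one_smul, add_comm]
  set v := -(r⁻¹ • ((2 * π) • x)) with hv
  have h1 := phDist_le ha r x hz
  rw [key, norm_smul, Real.norm_eq_abs, abs_of_pos hr0] at h1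
  have hp : packetSize a r x ζ = r * |⟪ζ, gr a ζ - v⟫| + √r * ‖gr a ζ - v‖ := by
    rw [packetSize, key, norm_smul, inner_smul_right, abs_mul, Real.norm_eq_abs, abs_of_pos hr0,
      ← mul_assoc]
    congr 2
    field_simp
    exact (Real.sq_sqrt hr0.le).symm
  set A := |⟪ζ, gr a ζ - v⟫| with hA
  set B := ‖gr a ζ - v‖ with hB
  have hA0 : 0 ≤ A := abs_nonneg _
  have hB0 : 0 ≤ B := norm_nonneg _
  have h2 : r * B ^ 2 = (√r * B) ^ 2 := by rw [mul_pow, Real.sq_sqrt hr0.le]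
  have h3 : r * ‖gr a z - v‖ ≤ r * (C * (A + B ^ 2)) := by gcongr
  have h4 : 0 ≤ √r * B := by positivity
  have h5 : 0 ≤ r * A := by positivity
  rw [hp]
  set s := √r * B
  set t := r * A with ht
  have h6 : phDist a r x ≤ C * (t + s ^ 2) := by
    calc _ ≤ r * (C * (A + B ^ 2)) := h1.trans h3
      _ = C * (t + s ^ 2) := by rw [← h2, ht]; ring
  have h7 : t + s ^ 2 ≤ (1 + (t + s)) ^ 2 := by nlinarith
  have h8 : 1 ≤ (1 + (t + s)) ^ 2 := by nlinarith
  nlinarith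

lemma oscKer_decay_large (hd : 1 ≤ d) (ha : IsDistFn a) (hc : CurvNondeg a) {u : Rd d → ℝ}
    {m M : ℝ} (hu : IsAmp u m M) (N : ℕ) :
    ∃ C : ℝ, 0 ≤ C ∧ ∃ r₀ : ℝ, 1 ≤ r₀ ∧ ∀ r, r₀ ≤ r → ∀ x,
      ‖oscKer u a r x‖ ≤ C / (√r ^ (d - 1) * (1 + phDist a r x) ^ N) := by
  have hm := hu.pos
  set K : Set (Rd d) := {ζ : Rd d | m / 4 ≤ ‖ζ‖ ∧ ‖ζ‖ ≤ M + m} with hK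
  have hKc : IsClosed K := (isClosed_le continuous_const continuous_norm).inter
      (isClosed_le continuous_norm continuous_const)
  have hKcomp : IsCompact K := (isCompact_closedBall (0 : Rd d) (M + m)).of_isClosed_subset hKc
    fun ζ hζ => by simpa using hζ.2
  have hK0 : (0 : Rd d) ∉ K := fun h => by have := h.1; simp at this; linarith
  obtain ⟨C₁, hC₁, hcr⟩ := exists_critical ha hc hKcomp hK0
  obtain ⟨C₂, hC₂, hvol⟩ := volume_gr_near hd ha hc hKcomp hK0
  obtain ⟨C₃, hC₃, r₀, hr₀, hpk⟩ := oscKer_le_packets ha hu (2 * N + (d - 1 + 1))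
  refine ⟨C₃ * (1 + C₁) ^ N * (2 ^ (d - 1 + 1) * C₂), by positivity, r₀, hr₀, fun r hr x => ?_⟩
  have hr1 : 1 ≤ r := hr₀.trans hr
  have hr0 : 0 < r := by linarith
  have hsr : 0 < √r := Real.sqrt_pos.2 hr0
  have hD := phDist_nonneg (a := a) r x
  have hmeas : Measurable (packetSize a r x) := by
    have := measurable_gr a
    unfold packetSize phGrad
    fun_prop
  have hlay := lintegral_layer (volume.restrict K) hmeas (packetSize_nonneg r x)
    (V := C₂ / √r ^ (d - 1)) (by positivity) (d - 1) (fun t ht => by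
      rw [Measure.restrict_apply (measurableSet_le hmeas measurable_const)]
      refine (measure_mono ?_).trans ((hvol (t / √r) (by positivity)
        (-(r⁻¹ • ((2 * π) • x)))).trans (ENNReal.ofReal_le_ofReal ?_))
      · rintro ζ ⟨h1, h2⟩
        refine ⟨h2, ?_⟩
        have h3 : phGrad a r x ζ = r • (gr a ζ - -(r⁻¹ • ((2 * π) • x))) := by
          rw [phGrad, sub_neg_eq_add, smul_add, smul_smul r, mul_inv_cancel₀ hr0.ne', one_smul,
            add_comm]
        have h4 : (√r)⁻¹ * ‖phGrad a r x ζ‖ ≤ t := by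
          refine le_trans ?_ h1
          rw [packetSize]
          linarith [abs_nonneg ⟪ζ, phGrad a r x ζ⟫]
        rw [h3, norm_smul, Real.norm_eq_abs, abs_of_pos hr0] at h4
        rw [le_div_iff₀ hsr]
        calc _ = (√r)⁻¹ * (√r * √r * ‖gr a ζ - -(r⁻¹ • ((2 * π) • x))‖) := by
              field_simp
          _ ≤ t := by rwa [Real.mul_self_sqrt hr0.le]
      · rw [div_pow]
        apply le_of_eq
        ring)
  have h1 := hpk r hr x
  have h2 : ‖oscKer u a r x‖ₑ ≤ ENNReal.ofReal (C₃ * (1 + C₁) ^ N / (1 + phDist a r x) ^ N) *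
      ENNReal.ofReal (2 ^ (d - 1 + 1) * (C₂ / √r ^ (d - 1))) := by
    refine h1.trans (le_trans ?_ (mul_le_mul_right hlay _))
    rw [← lintegral_const_mul _ (by fun_prop)]
    refine setLIntegral_mono' hKc.measurableSet fun ζ hζ => ?_
    rw [← ENNReal.ofReal_mul (by positivity)]
    apply ENNReal.ofReal_le_ofReal
    have h3 := one_add_phDist_le ha hr1 (x := x) hC₁ (hcr ζ hζ)
    have h4 := packetSize_nonneg (a := a) r x ζ
    have h5 : (1 + phDist a r x) ^ N ≤ (1 + C₁) ^ N * (1 + packetSize a r x ζ) ^ (2 * N) := by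
      rw [pow_mul, ← mul_pow]
      gcongr
    rw [pow_add, div_mul_div_comm, mul_one, div_le_div_iff₀ (by positivity) (by positivity)]
    calc C₃ * ((1 + phDist a r x) ^ N * (1 + packetSize a r x ζ) ^ (d - 1 + 1))
        ≤ C₃ * (((1 + C₁) ^ N * (1 + packetSize a r x ζ) ^ (2 * N)) *
          (1 + packetSize a r x ζ) ^ (d - 1 + 1)) := by gcongr
      _ = _ := by ring
  rw [← ENNReal.ofReal_mul (by positivity), ← ofReal_norm] at h2
  rw [ENNReal.ofReal_le_ofReal_iff (by positivity)] at h2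
  refine h2.trans (le_of_eq ?_)
  field_simp

lemma oscKer_decay_small (hd : 1 ≤ d) (ha : IsDistFn a) {u : Rd d → ℝ}
    {m M : ℝ} (hu : IsAmp u m M) (N : ℕ) (r₀ : ℝ) (hr₀ : 0 ≤ r₀) :
    ∃ C : ℝ, 0 ≤ C ∧ ∀ r, |r| ≤ r₀ → ∀ x,
      ‖oscKer u a r x‖ ≤ C / (1 + phDist a r x) ^ N := by
  have hm := hu.pos
  obtain ⟨b, hb, hba⟩ := ha.exists_contDiff (show 0 < m / 8 by positivity)
  obtain ⟨L, hL, hlip, -, hD0⟩ := exists_phDist_lipschitz hd ha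
  let A : Rd d → ℝ → ℂ := fun v r => (u v : ℂ) * Complex.exp (Complex.I * (r * b v : ℝ))
  have hu' := hu.smooth
  have hA : ContDiff ℝ (⊤ : ℕ∞) (fun z : Rd d × ℝ => A z.1 z.2) := by
    have h1 : ContDiff ℝ (⊤ : ℕ∞) (fun z : Rd d × ℝ => u z.1) := by fun_prop
    have h2 : ContDiff ℝ (⊤ : ℕ∞) (fun z : Rd d × ℝ => z.2 * b z.1) := by fun_prop
    exact (Complex.ofRealCLM.contDiff.comp h1).mul
      ((contDiff_const.mul (Complex.ofRealCLM.contDiff.comp h2)).cexp)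
  obtain ⟨C, hC, hdec⟩ := uniform_fourier_decay (volume : Measure (Rd d)) hA
    (K := Metric.closedBall 0 M) (isCompact_closedBall _ _)
    (fun v q hv => by
      have : u v = 0 := by
        by_contra! h
        exact hv (by simpa using (hu.supp v h).2)
      simp [A, this])
    (S := Icc (-r₀) r₀) isCompact_Icc N
  refine ⟨(1 + L + L * r₀) ^ N * C, by positivity, fun r hr x => ?_⟩
  let w : Rd d →L[ℝ] ℝ := (2 * π) • innerSL ℝ x
  have hw : ∀ v, w v = 2 * π * ⟪x, v⟫ := fun v => by simp [w]
  have hwn : ‖x‖ ≤ ‖w‖ := by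
    rw [norm_smul, innerSL_apply_norm, Real.norm_eq_abs, abs_of_pos (by positivity)]
    nlinarith [Real.pi_gt_three, norm_nonneg x]
  have hosc : oscKer u a r x = ∫ v, Complex.exp (Complex.I * (w v : ℝ)) * A v r := by
    unfold oscKer
    congr 1
    ext ξ
    by_cases h0 : u ξ = 0
    · simp [A, h0]
    · have := hba ξ (by linarith [(hu.supp ξ h0).1])
      simp only [A]
      rw [hw, mul_comm, ← mul_assoc, mul_comm (Complex.exp _), mul_assoc,
        mul_left_comm (Complex.exp _), this]
      congr 2
      · congr 1; push_cast; ring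
      · congr 1; push_cast; ring
  have h1 := hdec r (abs_le.1 hr) w
  have hD := phDist_nonneg (a := a) r x
  have h2 : 1 + phDist a r x ≤ (1 + L + L * r₀) * (1 + ‖w‖) := by
    have h3 := hlip r 0 x x
    simp only [sub_zero, sub_self, norm_zero, add_zero] at h3
    have h4 := hD0 x
    have h5 : L * |r| ≤ L * r₀ := by gcongr
    have h6 : L * ‖x‖ ≤ L * ‖w‖ := by gcongr
    have h7 : 0 ≤ L * r₀ * ‖w‖ := by positivity
    nlinarith [norm_nonneg w]
  rw [hosc, le_div_iff₀ (by positivity)]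
  calc _ ≤ ‖∫ v, Complex.exp (Complex.I * (w v : ℝ)) * A v r‖ *
        ((1 + L + L * r₀) * (1 + ‖w‖)) ^ N := by gcongr
    _ = (1 + L + L * r₀) ^ N *
        ((1 + ‖w‖) ^ N * ‖∫ v, Complex.exp (Complex.I * (w v : ℝ)) * A v r‖) := by
        rw [mul_pow]; ring
    _ ≤ _ := by gcongr

/-- Dispersive decay of the kernel, concentrated near the light cone. -/
lemma oscKer_decay (hd : 1 ≤ d) (ha : IsDistFn a) (hc : CurvNondeg a) {u : Rd d → ℝ}
    {m M : ℝ} (hu : IsAmp u m M) (N : ℕ) :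
    ∃ C : ℝ, 0 < C ∧ ∀ r x,
      ‖oscKer u a r x‖ ≤ C / (√(1 + |r|) ^ (d - 1) * (1 + phDist a r x) ^ N) := by
  obtain ⟨C₁, hC₁, r₀, hr₀, h1⟩ := oscKer_decay_large hd ha hc hu N
  obtain ⟨C₂, hC₂, h2⟩ := oscKer_decay_small hd ha hu N r₀ (by linarith)
  refine ⟨√2 ^ (d - 1) * C₁ + √(1 + r₀) ^ (d - 1) * C₂ + 1, by positivity, ?_⟩
  have hpos : ∀ r, 0 ≤ r → ∀ x, ‖oscKer u a r x‖ ≤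
      (√2 ^ (d - 1) * C₁ + √(1 + r₀) ^ (d - 1) * C₂ + 1) /
        (√(1 + |r|) ^ (d - 1) * (1 + phDist a r x) ^ N) := by
    intro r hr0 x
    have hD := phDist_nonneg (a := a) r x
    have hs : 0 < √(1 + |r|) := Real.sqrt_pos.2 (by positivity)
    rcases le_total r₀ r with hr | hr
    · have hrp : 0 < r := by linarith
      have hsr : 0 < √r := Real.sqrt_pos.2 hrp
      refine (h1 r hr x).trans ?_
      rw [div_le_div_iff₀ (by positivity) (by positivity)]
      have h3 : √(1 + |r|) ≤ √2 * √r := by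
        rw [← Real.sqrt_mul (by norm_num), abs_of_pos hrp]
        exact Real.sqrt_le_sqrt (by linarith)
      have h4 : √(1 + |r|) ^ (d - 1) ≤ √2 ^ (d - 1) * √r ^ (d - 1) := by
        rw [← mul_pow]; gcongr
      calc C₁ * (√(1 + |r|) ^ (d - 1) * (1 + phDist a r x) ^ N)
          ≤ C₁ * ((√2 ^ (d - 1) * √r ^ (d - 1)) * (1 + phDist a r x) ^ N) := by gcongr
        _ = √2 ^ (d - 1) * C₁ * (√r ^ (d - 1) * (1 + phDist a r x) ^ N) := by ring
        _ ≤ _ := by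
            gcongr
            have : 0 ≤ √(1 + r₀) ^ (d - 1) * C₂ := by positivity
            linarith
    · refine (h2 r (by rwa [abs_of_nonneg hr0]) x).trans ?_
      rw [div_le_div_iff₀ (by positivity) (by positivity)]
      have h3 : √(1 + |r|) ≤ √(1 + r₀) := by
        rw [abs_of_nonneg hr0]; gcongr
      have h4 : √(1 + |r|) ^ (d - 1) ≤ √(1 + r₀) ^ (d - 1) := by gcongr
      calc C₂ * (√(1 + |r|) ^ (d - 1) * (1 + phDist a r x) ^ N)
          ≤ C₂ * (√(1 + r₀) ^ (d - 1) * (1 + phDist a r x) ^ N) := by gcongr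
        _ = √(1 + r₀) ^ (d - 1) * C₂ * (1 + phDist a r x) ^ N := by ring
        _ ≤ _ := by
            gcongr
            have : 0 ≤ √2 ^ (d - 1) * C₁ := by positivity
            linarith
  intro r x
  rcases le_total 0 r with hr | hr
  · exact hpos r hr x
  · have h3 := hpos (-r) (by linarith) (-x)
    rwa [phDist_neg hd ha, abs_neg, oscKer_neg, RCLike.norm_conj] at h3

end decay

section conevol
variable {d : ℕ} {a : Rd d → ℝ}

lemma exists_gr_lipschitz (ha : IsDistFn a) : ∃ L : ℝ, 0 < L ∧ ∀ ζ : Rd d, 1 ≤ ‖ζ‖ → ‖ζ‖ ≤ 2 →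
    ∀ z, ‖z - ζ‖ < 1 / 2 → ‖gr a z - gr a ζ‖ ≤ L * ‖z - ζ‖ := by
  set K : Set (Rd d) := {ζ : Rd d | 1 / 2 ≤ ‖ζ‖ ∧ ‖ζ‖ ≤ 5 / 2} with hK
  have hKc : IsClosed K := (isClosed_le continuous_const continuous_norm).inter
      (isClosed_le continuous_norm continuous_const)
  have hKcomp : IsCompact K := (isCompact_closedBall (0 : Rd d) (5 / 2)).of_isClosed_subset hKc
    fun ζ hζ => by simpa using hζ.2
  have hK0 : ∀ ζ ∈ K, ζ ≠ 0 := fun ζ hζ h => by have := hζ.1; rw [h] at this; norm_num at this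
  have hcont : ContinuousOn (fun ζ => ‖fderiv ℝ (gr a) ζ‖) K := fun ζ hζ =>
    (((contDiffAt_gr ha (hK0 ζ hζ)).fderiv_right (m := (⊤ : ℕ∞)) (by exact
      le_rfl)).continuousAt.norm).continuousWithinAt
  obtain ⟨L, hL⟩ := hKcomp.bddAbove_image hcont
  refine ⟨max L 1, by positivity, fun ζ h1 h2 z hz => ?_⟩
  have hsub : Metric.ball ζ (1 / 2) ⊆ K := by
    intro y hy
    rw [mem_ball_iff_norm] at hy
    have h3 := norm_le_norm_add_norm_sub' ζ y
    have h4 := norm_le_norm_add_norm_sub' y ζ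
    rw [norm_sub_rev] at h3
    exact ⟨by linarith, by linarith⟩
  refine (convex_ball ζ (1 / 2)).norm_image_sub_le_of_norm_fderiv_le (𝕜 := ℝ)
    (fun y hy => (contDiffAt_gr ha (hK0 y (hsub hy))).differentiableAt (by simp))
    (fun y hy => (hL ⟨y, hsub hy, rfl⟩).trans (le_max_left L 1)) ?_ ?_
  · simp
  · rwa [mem_ball_iff_norm]

lemma volume_tube_ge (hd : 1 ≤ d) : ∃ c : ℝ, 0 < c ∧ ∀ ζ : Rd d, ‖ζ‖ = 1 → ∀ θ : ℝ, 0 < θ → θ ≤ 1 →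
    ENNReal.ofReal (c * θ ^ (d - 1)) ≤
      volume {z : Rd d | ∃ t : ℝ, 1 ≤ t ∧ t ≤ 2 ∧ ‖z - t • ζ‖ < θ / 2} := by
  set ω := (volume (Metric.ball (0 : Rd d) 1)).toReal with hω
  have hω' : volume (Metric.ball (0 : Rd d) 1) = ENNReal.ofReal ω :=
    (ENNReal.ofReal_toReal measure_ball_lt_top.ne).symm
  have hω0 : 0 < ω := ENNReal.toReal_pos (Metric.measure_ball_pos _ _ one_pos).ne'
    measure_ball_lt_top.ne
  refine ⟨(1 / 2) ^ d * ω, by positivity, fun ζ hζ θ hθ hθ1 => ?_⟩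
  set N := ⌊1 / θ⌋₊ + 1 with hN
  have hN1 : 1 / θ ≤ N := by rw [hN]; push_cast; exact (Nat.lt_floor_add_one _).le
  have hsub : (⋃ i ∈ Finset.range N, Metric.ball ((1 + i * θ) • ζ) (θ / 2)) ⊆
      {z : Rd d | ∃ t : ℝ, 1 ≤ t ∧ t ≤ 2 ∧ ‖z - t • ζ‖ < θ / 2} := by
    intro z hz
    simp only [mem_iUnion, Finset.mem_range] at hz
    obtain ⟨i, hi, hz⟩ := hz
    refine ⟨1 + i * θ, by nlinarith [Nat.cast_nonneg (α := ℝ) i], ?_, by rwa [mem_ball_iff_norm] at hz⟩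
    have h1 : (i : ℝ) ≤ 1 / θ := by
      have : i ≤ ⌊1 / θ⌋₊ := by omega
      exact (Nat.le_floor_iff (by positivity)).1 this
    have h2 : i * θ ≤ 1 := by rwa [le_div_iff₀ hθ] at h1
    linarith
  refine le_trans ?_ (measure_mono hsub)
  rw [measure_biUnion_finset]
  · simp_rw [Measure.addHaar_ball_of_pos volume _ (half_pos hθ), hω']
    simp only [finrank_euclideanSpace, Fintype.card_fin, Finset.sum_const, Finset.card_range,
      nsmul_eq_mul]
    rw [← ENNReal.ofReal_mul (by positivity), ← ENNReal.ofReal_natCast,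
      ← ENNReal.ofReal_mul (by positivity)]
    apply ENNReal.ofReal_le_ofReal
    have h3 : θ ^ d = θ * θ ^ (d - 1) := by rw [← pow_succ', Nat.sub_add_cancel hd]
    rw [div_le_iff₀ hθ] at hN1
    rw [div_pow θ, h3]
    calc _ = 1 * ((1 / 2) ^ d * ω * θ ^ (d - 1)) := by ring
      _ ≤ (N * θ) * ((1 / 2) ^ d * ω * θ ^ (d - 1)) := by gcongr
      _ = _ := by rw [div_pow, one_pow]; ring
  · intro i _ j _ hij
    apply Metric.ball_disjoint_ball
    rw [dist_eq_norm, ← sub_smul, norm_smul, hζ, mul_one, Real.norm_eq_abs]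
    have h4 : (1 : ℝ) ≤ |(i : ℝ) - j| := by
      have : (1 : ℤ) ≤ |(i : ℤ) - j| := Int.one_le_abs (by
        rw [sub_ne_zero]; exact_mod_cast hij)
      exact_mod_cast this
    have h5 : (1 + i * θ) - (1 + j * θ) = (i - j) * θ := by ring
    rw [h5, abs_mul, abs_of_pos hθ]
    nlinarith
  · exact fun _ _ => measurableSet_ball

/-- Volume of neighbourhoods of the light cone slices. -/
lemma volume_phDist_le (hd : 1 ≤ d) (ha : IsDistFn a) : ∃ C : ℝ, 0 < C ∧ ∀ (r δ : ℝ), 0 < δ →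
    volume {x : Rd d | phDist a r x ≤ δ} ≤ ENNReal.ofReal (C * (δ * (δ + |r|) ^ (d - 1))) := by
  obtain ⟨L, hL, hlip⟩ := exists_gr_lipschitz ha
  obtain ⟨c, hc, htube⟩ := volume_tube_ge hd
  obtain ⟨L', hL', hcont, -, -⟩ := exists_phDist_lipschitz hd ha
  set ω := (volume (Metric.ball (0 : Rd d) 1)).toReal with hω
  have hω' : volume (Metric.ball (0 : Rd d) 1) = ENNReal.ofReal ω :=
    (ENNReal.ofReal_toReal measure_ball_lt_top.ne).symm
  have hω0 : 0 ≤ ω := ENNReal.toReal_nonneg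
  set Q := 1 + L with hQ
  set B := Q ^ d * ω * (3 ^ d * ω) with hB
  refine ⟨(B + 1) / c, by positivity, fun r δ hδ => ?_⟩
  have hδr : 0 < δ + |r| := by positivity
  set θ := δ / (δ + |r|) with hθ
  have hθ0 : 0 < θ := by positivity
  have hθ1 : θ ≤ 1 := by rw [hθ, div_le_one hδr]; linarith [abs_nonneg r]
  have hrθ : |r| * θ ≤ δ := by
    rw [hθ, mul_div_assoc', div_le_iff₀ hδr]; nlinarith [abs_nonneg r]
  set S := {x : Rd d | phDist a r x ≤ δ} with hS
  have hSm : MeasurableSet S := by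
    have : Continuous (phDist a r) := by
      refine LipschitzWith.continuous (K := L'.toNNReal) (LipschitzWith.of_le_add_mul _ ?_)
      intro x y
      have := hcont r r x y
      rw [sub_self, abs_zero, zero_add] at this
      rwa [Real.coe_toNNReal _ (by linarith), dist_eq_norm]
    exact measurableSet_le this.measurable measurable_const
  set K : Set (Rd d) := Metric.ball 0 3
  let T : Set (Rd d × Rd d) := {p | ‖phGrad a r p.1 p.2‖ ≤ Q * δ}
  have hTm : MeasurableSet T := by
    have := measurable_gr a
    refine measurableSet_le ?_ measurable_const
    unfold phGrad
    fun_prop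
  have h1 : ∀ x ∈ S, ENNReal.ofReal (c * θ ^ (d - 1)) ≤
      (volume.restrict K) (Prod.mk x ⁻¹' T) := by
    intro x hx
    obtain ⟨ζ, hζ, hD⟩ := exists_phDist_eq hd ha r x
    refine (htube ζ hζ θ hθ0 hθ1).trans ?_
    rw [Measure.restrict_apply (measurable_prodMk_left hTm)]
    refine measure_mono ?_
    rintro z ⟨t, ht1, ht2, hz⟩
    have htn : ‖t • ζ‖ = t := by
      rw [norm_smul, hζ, mul_one, Real.norm_eq_abs, abs_of_pos (by linarith)]
    have h2 := hlip (t • ζ) (by rw [htn]; exact ht1) (by rw [htn]; exact ht2) z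
      (by linarith)
    rw [gr_smul ha (by linarith)] at h2
    constructor
    · change ‖phGrad a r x z‖ ≤ Q * δ
      have h3 : phGrad a r x z = phGrad a r x ζ + r • (gr a z - gr a ζ) := by
        simp only [phGrad, smul_sub]; abel
      rw [h3]
      have hxS : phDist a r x ≤ δ := hx
      calc _ ≤ ‖phGrad a r x ζ‖ + |r| * ‖gr a z - gr a ζ‖ := by
            refine (norm_add_le _ _).trans ?_
            rw [norm_smul, Real.norm_eq_abs]
        _ ≤ δ + |r| * (L * (θ / 2)) := by
            rw [← hD]
            have : L * ‖z - t • ζ‖ ≤ L * (θ / 2) := by gcongr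
            gcongr
            exact h2.trans this
        _ ≤ Q * δ := by
            have : L * (|r| * θ) ≤ L * δ := by gcongr
            rw [hQ]; nlinarith [mul_nonneg (abs_nonneg r) hθ0.le]
    · rw [mem_ball_zero_iff]
      have := norm_le_norm_add_norm_sub' z (t • ζ)
      linarith
  have h2 : ∀ z, volume ((fun x => (x, z)) ⁻¹' T) ≤ ENNReal.ofReal ((Q * δ) ^ d * ω) := by
    intro z
    have : (fun x => (x, z)) ⁻¹' T ⊆
        Metric.closedBall (-((2 * π)⁻¹ • (r • gr a z))) (Q * δ) := by
      intro x hx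
      have hx : ‖phGrad a r x z‖ ≤ Q * δ := hx
      rw [mem_closedBall_iff_norm, sub_neg_eq_add]
      have h3 : phGrad a r x z = (2 * π) • (x + (2 * π)⁻¹ • (r • gr a z)) := by
        rw [smul_add, smul_smul, mul_inv_cancel₀ (by positivity), one_smul, phGrad]
      rw [h3, norm_smul, Real.norm_eq_abs, abs_of_pos (by positivity)] at hx
      refine le_trans ?_ hx
      nlinarith [Real.pi_gt_three, norm_nonneg (x + (2 * π)⁻¹ • (r • gr a z))]
    refine (measure_mono this).trans (le_of_eq ?_)
    rw [Measure.addHaar_closedBall volume _ (by positivity), hω', ← ENNReal.ofReal_mul (by positivity)]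
    simp
  have h3 : ENNReal.ofReal (c * θ ^ (d - 1)) * volume S ≤
      ENNReal.ofReal ((Q * δ) ^ d * ω) * ENNReal.ofReal (3 ^ d * ω) := by
    calc _ = ∫⁻ _ in S, ENNReal.ofReal (c * θ ^ (d - 1)) := by simp
      _ ≤ ∫⁻ x in S, (volume.restrict K) (Prod.mk x ⁻¹' T) := setLIntegral_mono' hSm h1
      _ ≤ ∫⁻ x, (volume.restrict K) (Prod.mk x ⁻¹' T) := setLIntegral_le_lintegral _ _
      _ = (volume.prod (volume.restrict K)) T := (Measure.prod_apply hTm).symm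
      _ = ∫⁻ z in K, volume ((fun x => (x, z)) ⁻¹' T) := Measure.prod_apply_symm hTm
      _ ≤ ∫⁻ z in K, ENNReal.ofReal ((Q * δ) ^ d * ω) := lintegral_mono fun z => h2 z
      _ = _ := by
        rw [setLIntegral_const, Measure.addHaar_ball_of_pos volume _ (by norm_num), hω',
          ← ENNReal.ofReal_mul (by positivity)]
        simp
  have hcθ : 0 < c * θ ^ (d - 1) := by positivity
  rw [mul_comm, ← ENNReal.le_div_iff_mul_le (Or.inl (by simpa using hcθ)) (Or.inl (by simp)),
    ← ENNReal.ofReal_mul (by positivity), ← ENNReal.ofReal_div_of_pos hcθ] at h3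
  refine h3.trans (ENNReal.ofReal_le_ofReal ?_)
  rw [hθ, div_pow]
  have h4 : δ ^ d = δ * δ ^ (d - 1) := by rw [← pow_succ', Nat.sub_add_cancel hd]
  calc _ = B / c * (δ * (δ + |r|) ^ (d - 1)) := by
        rw [mul_pow, h4, hB]; field_simp
    _ ≤ _ := by gcongr; linarith

end conevol

section plancherel
variable {d : ℕ} {a : Rd d → ℝ}

lemma oscKer_congr {u a b : Rd d → ℝ} (h : ∀ ξ, u ξ ≠ 0 → b ξ = a ξ) (r : ℝ) (x : Rd d) :
    oscKer u a r x = ∫ ξ, (u ξ : ℂ) *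
      Complex.exp (Complex.I * (r * b ξ + 2 * π * ⟪x, ξ⟫ : ℝ)) := by
  unfold oscKer
  congr 1
  ext ξ
  by_cases h0 : u ξ = 0
  · simp [h0]
  · rw [mul_assoc, ← Complex.exp_add, h ξ h0]
    congr 2
    push_cast
    ring

lemma IsAmp.hasCompactSupport {u : Rd d → ℝ} {m M : ℝ} (hu : IsAmp u m M) :
    HasCompactSupport u :=
  HasCompactSupport.intro (isCompact_closedBall 0 M) fun ξ hξ => by
    by_contra h0
    exact hξ (by simpa using (hu.supp ξ h0).2)

lemma continuous_oscKer (ha : IsDistFn a) {u : Rd d → ℝ} {m M : ℝ} (hu : IsAmp u m M) :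
    Continuous (fun z : ℝ × Rd d => oscKer u a z.1 z.2) := by
  obtain ⟨b, hb, hba⟩ := ha.exists_contDiff hu.pos
  have h : ∀ ξ, u ξ ≠ 0 → b ξ = a ξ := fun ξ hξ => hba ξ (hu.supp ξ hξ).1
  simp_rw [oscKer_congr h]
  have hb := hb.continuous
  have hu' := hu.smooth.continuous
  refine continuous_of_dominated (bound := fun ξ => ‖u ξ‖) (fun z => ?_) (fun z => ?_)
    (hu'.norm.integrable_of_hasCompactSupport hu.hasCompactSupport.norm) ?_
  · exact Continuous.aestronglyMeasurable (by fun_prop)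
  · refine Filter.Eventually.of_forall fun ξ => ?_
    rw [norm_mul, mul_comm Complex.I, Complex.norm_exp_ofReal_mul_I, mul_one, Complex.norm_real]
  · exact Filter.Eventually.of_forall fun ξ => by fun_prop

/-- Plancherel for two translates of the kernels. -/
lemma integral_oscKer_mul_conj (ha : IsDistFn a) {u : Rd d → ℝ} {m M : ℝ} (hu : IsAmp u m M)
    (r r' : ℝ) (y y' : Rd d) :
    ∫ x, oscKer u a r (x - y) * (starRingEnd ℂ) (oscKer u a r' (x - y')) =
      oscKer (fun ξ => u ξ ^ 2) a (r - r') (y' - y) := by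
  obtain ⟨b, hb, hba⟩ := ha.exists_contDiff hu.pos
  have h : ∀ ξ, u ξ ≠ 0 → b ξ = a ξ := fun ξ hξ => hba ξ (hu.supp ξ hξ).1
  let F : ℝ → Rd d → Rd d → ℂ := fun r y ξ => (u ξ : ℂ) *
    Complex.exp (Complex.I * (r * b ξ - 2 * π * ⟪y, ξ⟫ : ℝ))
  have hF1 : ∀ r y, HasCompactSupport (F r y) := fun r y =>
    HasCompactSupport.mul_right (hu.hasCompactSupport.comp_left (g := fun t : ℝ => (t : ℂ)) rfl)
  have hF2 : ∀ r y, ContDiff ℝ (⊤ : ℕ∞) (F r y) := fun r y => by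
    have hu' := hu.smooth
    exact (Complex.ofRealCLM.contDiff.comp hu').mul
      ((contDiff_const.mul (Complex.ofRealCLM.contDiff.comp
        (f := fun ξ => (r * b ξ - 2 * π * ⟪y, ξ⟫ : ℝ))
        ((contDiff_const.mul hb).sub (contDiff_const.mul (innerSL ℝ y).contDiff)))).cexp)
  let S : ℝ → Rd d → SchwartzMap (Rd d) ℂ := fun r y => (hF1 r y).toSchwartzMap (hF2 r y)
  have hS : ∀ r y x, oscKer u a r (x - y) = 𝓕 (S r y) (-x) := by
    intro r y x
    rw [oscKer_congr h, SchwartzMap.fourier_coe, Real.fourier_eq']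
    congr 1
    ext ξ
    simp only [S, F, HasCompactSupport.toSchwartzMap_toFun, smul_eq_mul]
    rw [mul_left_comm, ← Complex.exp_add]
    congr 2
    simp only [inner_sub_left, inner_neg_right, real_inner_comm x]
    push_cast
    ring
  simp_rw [hS]
  rw [integral_neg_eq_self (fun x => 𝓕 (S r y) x * (starRingEnd ℂ) (𝓕 (S r' y') x))]
  have := SchwartzMap.integral_inner_fourier_fourier (S r' y') (S r y)
  simp only [RCLike.inner_apply] at this
  rw [this, oscKer_congr (b := b) (fun ξ hξ => h ξ (by simpa using hξ))]
  congr 1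
  ext ξ
  simp only [S, F, HasCompactSupport.toSchwartzMap_toFun, map_mul, Complex.conj_ofReal,
    ← Complex.exp_conj, Complex.conj_I, inner_sub_left]
  rw [mul_mul_mul_comm, ← Complex.exp_add]
  push_cast
  rw [← pow_two]
  congr 2
  ring

lemma exists_comparable (hd : 1 ≤ d) (ha : IsDistFn a) : ∃ c : ℝ, 0 < c ∧ ∃ C : ℝ, 0 < C ∧
    ∀ ξ, c * ‖ξ‖ ≤ a ξ ∧ a ξ ≤ C * ‖ξ‖ := by
  have : NeZero d := ⟨by omega⟩
  have hne : ∀ z ∈ Metric.sphere (0 : Rd d) 1, z ≠ 0 := by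
    intro z hz h0
    rw [mem_sphere_zero_iff_norm, h0] at hz
    simp at hz
  have hcont : ContinuousOn a (Metric.sphere 0 1) := ha.smooth.continuousOn.mono hne
  obtain ⟨z₁, hz₁, h1⟩ := (isCompact_sphere (0 : Rd d) 1).exists_isMinOn
    (NormedSpace.sphere_nonempty.2 zero_le_one) hcont
  obtain ⟨z₂, hz₂, h2⟩ := (isCompact_sphere (0 : Rd d) 1).exists_isMaxOn
    (NormedSpace.sphere_nonempty.2 zero_le_one) hcont
  refine ⟨a z₁, ha.pos _ (hne _ hz₁), a z₂, ha.pos _ (hne _ hz₂), fun ξ => ?_⟩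
  rcases eq_or_ne ξ 0 with rfl | h
  · have := ha.homog 2 two_pos 0
    rw [smul_zero] at this
    have h0 : a 0 = 0 := by linarith
    simp [h0]
  · have hn : 0 < ‖ξ‖ := norm_pos_iff.2 h
    have hs : ‖ξ‖⁻¹ • ξ ∈ Metric.sphere (0 : Rd d) 1 := by
      rw [mem_sphere_zero_iff_norm, norm_smul, norm_inv, norm_norm, inv_mul_cancel₀ hn.ne']
    have h3 : a ξ = a (‖ξ‖⁻¹ • ξ) * ‖ξ‖ := by
      rw [ha.homog _ (inv_pos.2 hn)]; field_simp
    rw [h3]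
    exact ⟨mul_le_mul_of_nonneg_right (h1 hs) hn.le, mul_le_mul_of_nonneg_right (h2 hs) hn.le⟩

lemma IsBump.isAmp (hd : 1 ≤ d) (ha : IsDistFn a) {η : ℝ → ℝ} (hη : IsBump η) :
    ∃ m M, IsAmp (fun ξ => η (a ξ)) m M := by
  obtain ⟨c, hc, C, hC, h⟩ := exists_comparable hd ha
  refine ⟨1 / (8 * C), 8 / c, ?_, by positivity, fun ξ hξ => ?_⟩
  · rw [contDiff_iff_contDiffAt]
    intro ξ
    rcases eq_or_ne ξ 0 with rfl | h0
    · refine (contDiffAt_const (c := (0 : ℝ))).congr_of_eventuallyEq ?_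
      filter_upwards [Metric.ball_mem_nhds (0 : Rd d) (show 0 < 1 / (8 * C) by positivity)] with ξ hξ
      apply hη.supp
      rintro ⟨h1, -⟩
      rw [mem_ball_zero_iff, lt_div_iff₀ (by positivity)] at hξ
      have := (h ξ).2
      linarith
    · exact hη.smooth.contDiffAt.comp ξ (ha.contDiffAt h0)
  · have h1 : a ξ ∈ Icc (1 / 8 : ℝ) 8 := by
      by_contra h1
      exact hξ (hη.supp _ h1)
    constructor
    · rw [div_le_iff₀ (by positivity)]
      have := (h ξ).2; have := h1.1
      linarith
    · rw [le_div_iff₀ hc]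
      have := (h ξ).1; have := h1.2
      linarith

lemma IsAmp.sq {u : Rd d → ℝ} {m M : ℝ} (hu : IsAmp u m M) : IsAmp (fun ξ => u ξ ^ 2) m M :=
  ⟨hu.smooth.pow 2, hu.pos, fun ξ hξ => hu.supp ξ (by simpa using hξ)⟩

end plancherel

/-- The structural properties of the distance to a family of dilated hypersurfaces. -/
structure IsConeDist {d : ℕ} (D : ℝ → Rd d → ℝ) (L : ℝ) : Prop where
  one_le : 1 ≤ L
  nonneg : ∀ r x, 0 ≤ D r x
  neg : ∀ r x, D (-r) (-x) = D r x
  lip : ∀ r r' x x', D r x ≤ D r' x' + L * (|r - r'| + ‖x - x'‖)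
  lower : ∀ r x, ‖x‖ ≤ D r x + L * |r|
  vol : ∀ r δ : ℝ, 0 < δ →
    volume {x | D r x ≤ δ} ≤ ENNReal.ofReal (L * (δ * (δ + |r|) ^ (d - 1)))

/-- A continuous kernel with dispersive decay, concentrated where `D` is small. -/
structure IsDispKer {d : ℕ} (D : ℝ → Rd d → ℝ) (k : ℝ → Rd d → ℂ) : Prop where
  cont : Continuous (fun z : ℝ × Rd d => k z.1 z.2)
  decay : ∀ N : ℕ, ∃ C : ℝ, 0 < C ∧ ∀ r x,
    ‖k r x‖ ≤ C / (√(1 + |r|) ^ (d - 1) * (1 + D r x) ^ N)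

section disp
variable {d : ℕ} {D : ℝ → Rd d → ℝ} {L : ℝ} {k : ℝ → Rd d → ℂ}

lemma isConeDist_phDist (hd : 1 ≤ d) {a : Rd d → ℝ} (ha : IsDistFn a) :
    ∃ L, IsConeDist (phDist a) L := by
  obtain ⟨L, hL, h1, h2, -⟩ := exists_phDist_lipschitz hd ha
  obtain ⟨C, hC, h3⟩ := volume_phDist_le hd ha
  refine ⟨max L C, le_max_of_le_left hL, phDist_nonneg, phDist_neg hd ha, fun r r' x x' => ?_,
    fun r x => ?_, fun r δ hδ => (h3 r δ hδ).trans (ENNReal.ofReal_le_ofReal ?_)⟩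
  · refine (h1 r r' x x').trans ?_
    gcongr
    exact le_max_left _ _
  · refine (h2 r x).trans ?_
    gcongr
    exact le_max_left _ _
  · gcongr
    exact le_max_right _ _

lemma isDispKer_oscKer (hd : 1 ≤ d) {a : Rd d → ℝ} (ha : IsDistFn a) (hc : CurvNondeg a)
    {u : Rd d → ℝ} {m M : ℝ} (hu : IsAmp u m M) : IsDispKer (phDist a) (oscKer u a) :=
  ⟨continuous_oscKer ha hu, fun N => oscKer_decay hd ha hc hu N⟩

lemma IsConeDist.continuous (hD : IsConeDist D L) :
    Continuous (fun z : ℝ × Rd d => D z.1 z.2) := by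
  have hL := hD.one_le
  refine LipschitzWith.continuous (K := (2 * L).toNNReal) (LipschitzWith.of_le_add_mul _ ?_)
  rintro ⟨r, x⟩ ⟨r', x'⟩
  refine (hD.lip r r' x x').trans ?_
  rw [Real.coe_toNNReal _ (by linarith), Prod.dist_eq, ← Real.dist_eq, ← dist_eq_norm]
  have h1 := le_max_left (dist r r') (dist x x')
  have h2 := le_max_right (dist r r') (dist x x')
  simp only
  nlinarith

lemma IsConeDist.continuous_right (hD : IsConeDist D L) (r : ℝ) : Continuous (D r) :=
  hD.continuous.comp (Continuous.prodMk_right r)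

lemma sqrt_pow_mul_self {t : ℝ} (ht : 0 ≤ t) (m : ℕ) : √t ^ m * √t ^ m = t ^ m := by
  rw [← mul_pow, Real.mul_self_sqrt ht]

lemma IsConeDist.lintegral_le (hd : 1 ≤ d) (hD : IsConeDist D L) (r : ℝ) {δ : ℝ} (hδ : 0 < δ) :
    ∫⁻ x, ENNReal.ofReal (1 / (1 + D r x / δ) ^ (d + 1)) ≤
      ENNReal.ofReal (2 ^ (d + 1) * L * (δ * (δ + |r|) ^ (d - 1))) := by
  have hL := hD.one_le
  have h := lintegral_layer volume (h := fun x => D r x / δ)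
    ((hD.continuous_right r).measurable.div_const δ)
    (fun x => div_nonneg (hD.nonneg r x) hδ.le) (V := L * (δ * (δ + |r|) ^ (d - 1)))
    (by positivity) d (fun t ht => by
      have h1 : {x | D r x / δ ≤ t} = {x | D r x ≤ t * δ} := by
        ext x; simp only [mem_ofPred_eq]; rw [div_le_iff₀ hδ]
      rw [h1]
      refine (hD.vol r (t * δ) (by positivity)).trans (ENNReal.ofReal_le_ofReal ?_)
      have h2 : t ^ d = t * t ^ (d - 1) := by rw [← pow_succ', Nat.sub_add_cancel hd]
      have h3 : t * δ + |r| ≤ t * (δ + |r|) := by nlinarith [abs_nonneg r]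
      calc L * (t * δ * (t * δ + |r|) ^ (d - 1)) ≤ L * (t * δ * (t * (δ + |r|)) ^ (d - 1)) := by
            gcongr
        _ = _ := by rw [h2, mul_pow]; ring)
  refine h.trans (le_of_eq ?_)
  congr 1; ring

/-- Tail bound for the mass of a dispersive kernel away from the cone. -/
lemma IsDispKer.lintegral_tail_le (hd : 1 ≤ d) (hD : IsConeDist D L) (hk : IsDispKer D k) :
    ∃ C : ℝ, 0 < C ∧ ∀ (r τ : ℝ), 0 < τ →
      ∫⁻ x in {x | τ ≤ D r x ^ d}, ‖k r x‖ₑ ≤ ENNReal.ofReal (C * √(1 + |r|) ^ (d - 1) / τ) := by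
  have hL := hD.one_le
  obtain ⟨C, hC, hdec⟩ := hk.decay (d + (d + 1))
  refine ⟨C * (2 ^ (d + 1) * L * 1), by positivity, fun r τ hτ => ?_⟩
  have hs : 0 < √(1 + |r|) := Real.sqrt_pos.2 (by positivity)
  have hms : MeasurableSet {x | τ ≤ D r x ^ d} :=
    measurableSet_le measurable_const ((hD.continuous_right r).measurable.pow_const d)
  have hm : Measurable fun x => ENNReal.ofReal (1 / (1 + D r x / 1) ^ (d + 1)) := by
    have := (hD.continuous_right r).measurable
    fun_prop
  calc _ ≤ ∫⁻ x in {x | τ ≤ D r x ^ d}, ENNReal.ofReal (C / √(1 + |r|) ^ (d - 1) / τ) *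
        ENNReal.ofReal (1 / (1 + D r x / 1) ^ (d + 1)) := by
        refine setLIntegral_mono' hms fun x hx => ?_
        have h0 := hD.nonneg r x
        have hx : τ ≤ D r x ^ d := hx
        rw [← ENNReal.ofReal_mul (by positivity), ← ofReal_norm]
        apply ENNReal.ofReal_le_ofReal
        refine (hdec r x).trans ?_
        rw [div_one, div_div, div_mul_div_comm, mul_one, pow_add]
        apply div_le_div_of_nonneg_left hC.le (by positivity)
        have : τ ≤ (1 + D r x) ^ d := hx.trans (by gcongr; linarith)
        calc _ ≤ √(1 + |r|) ^ (d - 1) * (1 + D r x) ^ d * (1 + D r x) ^ (d + 1) := by gcongr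
          _ = _ := by ring
    _ ≤ ∫⁻ x, ENNReal.ofReal (C / √(1 + |r|) ^ (d - 1) / τ) *
        ENNReal.ofReal (1 / (1 + D r x / 1) ^ (d + 1)) := setLIntegral_le_lintegral _ _
    _ ≤ ENNReal.ofReal (C / √(1 + |r|) ^ (d - 1) / τ) *
        ENNReal.ofReal (2 ^ (d + 1) * L * (1 * (1 + |r|) ^ (d - 1))) := by
        rw [lintegral_const_mul _ hm]
        gcongr
        exact hD.lintegral_le hd r one_pos
    _ = _ := by
        rw [← ENNReal.ofReal_mul (by positivity),
          ← sqrt_pow_mul_self (show (0 : ℝ) ≤ 1 + |r| by positivity) (d - 1)]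
        congr 1
        field_simp

lemma IsDispKer.lintegral_le (hd : 1 ≤ d) (hD : IsConeDist D L) (hk : IsDispKer D k) :
    ∃ C : ℝ, 0 < C ∧ ∀ r : ℝ,
      ∫⁻ x, ‖k r x‖ₑ ≤ ENNReal.ofReal (C * √(1 + |r|) ^ (d - 1)) := by
  have hL := hD.one_le
  obtain ⟨C, hC, hdec⟩ := hk.decay (d + 1)
  refine ⟨C * (2 ^ (d + 1) * L * 1), by positivity, fun r => ?_⟩
  have hs : 0 < √(1 + |r|) := Real.sqrt_pos.2 (by positivity)
  have hm : Measurable fun x => ENNReal.ofReal (1 / (1 + D r x / 1) ^ (d + 1)) := by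
    have := (hD.continuous_right r).measurable
    fun_prop
  calc _ ≤ ∫⁻ x, ENNReal.ofReal (C / √(1 + |r|) ^ (d - 1)) *
        ENNReal.ofReal (1 / (1 + D r x / 1) ^ (d + 1)) := by
        refine lintegral_mono fun x => ?_
        have h0 := hD.nonneg r x
        rw [← ENNReal.ofReal_mul (by positivity), ← ofReal_norm]
        apply ENNReal.ofReal_le_ofReal
        refine (hdec r x).trans (le_of_eq ?_)
        rw [div_one, div_mul_div_comm, mul_one]
    _ ≤ ENNReal.ofReal (C / √(1 + |r|) ^ (d - 1)) *
        ENNReal.ofReal (2 ^ (d + 1) * L * (1 * (1 + |r|) ^ (d - 1))) := by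
        rw [lintegral_const_mul _ hm]
        gcongr
        exact hD.lintegral_le hd r one_pos
    _ = _ := by
        rw [← ENNReal.ofReal_mul (by positivity),
          ← sqrt_pow_mul_self (show (0 : ℝ) ≤ 1 + |r| by positivity) (d - 1)]
        congr 1
        field_simp

end disp

/-- The square function expansion: a `TT*` identity with part of the pairs kept in physical
space. -/
lemma lintegral_sq_le_split {X Y : Type*} [MeasurableSpace X] [MeasurableSpace Y]
    {μ : Measure X} {ν : Measure Y} [SFinite μ] [SFinite ν] {F : X → Y → ℂ}
    (hF : Measurable (Function.uncurry F))
    (hint : ∫⁻ x, (∫⁻ y, ‖F x y‖ₑ ∂ν) * ∫⁻ y, ‖F x y‖ₑ ∂ν ∂μ < ∞) {S : Set (Y × Y)}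
    (hS : MeasurableSet S) :
    ∫⁻ x, ‖∫ y, F x y ∂ν‖ₑ ^ 2 ∂μ ≤
      ∫⁻ z in S, ‖∫ x, F x z.1 * starRingEnd ℂ (F x z.2) ∂μ‖ₑ ∂(ν.prod ν) +
      ∫⁻ x, ‖∫ z in Sᶜ, F x z.1 * starRingEnd ℂ (F x z.2) ∂(ν.prod ν)‖ₑ ∂μ := by
  set H : X × (Y × Y) → ℂ := fun q => F q.1 q.2.1 * starRingEnd ℂ (F q.1 q.2.2) with hH
  have hHm : Measurable H :=
    (hF.comp (measurable_fst.prodMk measurable_snd.fst)).mul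
      (Complex.continuous_conj.measurable.comp (hF.comp (measurable_fst.prodMk measurable_snd.snd)))
  have hFx : ∀ x, Measurable (F x) := fun x => hF.comp measurable_prodMk_left
  have hHi : Integrable H (μ.prod (ν.prod ν)) := by
    refine ⟨hHm.aestronglyMeasurable, ?_⟩
    rw [HasFiniteIntegral, lintegral_prod _ hHm.enorm.aemeasurable]
    refine lt_of_le_of_lt (lintegral_mono fun x => ?_) hint
    rw [lintegral_prod _ (by fun_prop), ← lintegral_mul_const _ (hFx x).enorm]
    refine lintegral_mono fun y => ?_
    rw [← lintegral_const_mul _ (hFx x).enorm]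
    refine lintegral_mono fun y' => ?_
    simp [hH, enorm_mul]
  have hae : ∀ᵐ x ∂μ, Integrable (fun z => H (x, z)) (ν.prod ν) := hHi.prod_right_ae
  have hHS : Integrable H (μ.prod ((ν.prod ν).restrict S)) := by
    refine hHi.mono_measure ?_
    exact Measure.prod_mono le_rfl Measure.restrict_le_self
  have hHS' : Integrable H (μ.prod ((ν.prod ν).restrict Sᶜ)) := by
    refine hHi.mono_measure ?_
    exact Measure.prod_mono le_rfl Measure.restrict_le_self
  have hsq : ∀ x, ∫ z, H (x, z) ∂(ν.prod ν) = ((‖∫ y, F x y ∂ν‖ ^ 2 : ℝ) : ℂ) := by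
    intro x
    simp only [hH]
    rw [integral_prod_mul (F x) (fun y => starRingEnd ℂ (F x y)), integral_conj, Complex.mul_conj,
      Complex.normSq_eq_norm_sq]
  have hi0 : Integrable (fun x => ∫ z, H (x, z) ∂(ν.prod ν)) μ := hHi.integral_prod_left
  have hi1 := hHS.integral_prod_left
  have hi2 := hHS'.integral_prod_left
  have h0 : ∫⁻ x, ‖∫ y, F x y ∂ν‖ₑ ^ 2 ∂μ = ‖∫ x, ∫ z, H (x, z) ∂(ν.prod ν) ∂μ‖ₑ := by
    have h1 : ∀ x, ‖∫ y, F x y ∂ν‖ₑ ^ 2 = ‖∫ z, H (x, z) ∂(ν.prod ν)‖ₑ := by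
      intro x
      rw [hsq, ← ofReal_norm, ← ofReal_norm, Complex.norm_real, norm_pow, norm_norm,
        ENNReal.ofReal_pow (norm_nonneg _)]
    have h2 : ∫ x, ∫ z, H (x, z) ∂(ν.prod ν) ∂μ =
        ((∫ x, ‖∫ z, H (x, z) ∂(ν.prod ν)‖ ∂μ : ℝ) : ℂ) := by
      rw [← integral_complex_ofReal]
      congr 1
      ext x
      rw [hsq, Complex.norm_real, norm_pow, norm_norm]
    simp_rw [h1]
    rw [h2, ← ofReal_norm, Complex.norm_real, Real.norm_of_nonneg
      (integral_nonneg fun x => norm_nonneg _), ofReal_integral_norm_eq_lintegral_enorm hi0]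
  have h3 : ∫ x, ∫ z, H (x, z) ∂(ν.prod ν) ∂μ =
      ∫ x, ∫ z in S, H (x, z) ∂(ν.prod ν) ∂μ + ∫ x, ∫ z in Sᶜ, H (x, z) ∂(ν.prod ν) ∂μ := by
    rw [← integral_add hi1 hi2]
    refine integral_congr_ae ?_
    filter_upwards [hae] with x hx
    exact (integral_add_compl hS hx).symm
  rw [h0, h3]
  refine (enorm_add_le _ _).trans (add_le_add ?_ (enorm_integral_le_lintegral_enorm _))
  rw [integral_integral_swap hHS]
  exact enorm_integral_le_lintegral_enorm _

section dispL2
variable {d : ℕ} {D : ℝ → Rd d → ℝ} {L : ℝ} {k k' : ℝ → Rd d → ℂ}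

lemma one_le_sqrt_pow (r : ℝ) (m : ℕ) : 1 ≤ √(1 + |r|) ^ m :=
  one_le_pow₀ (Real.one_le_sqrt.2 (by linarith [abs_nonneg r]))

lemma IsDispKer.bound (hk : IsDispKer D k) :
    ∃ C : ℝ, 0 < C ∧ ∀ r x, ‖k r x‖ ≤ C := by
  obtain ⟨C, hC, h⟩ := hk.decay 0
  refine ⟨C, hC, fun r x => (h r x).trans ?_⟩
  rw [pow_zero, mul_one]
  exact div_le_self hC.le (one_le_sqrt_pow r _)

lemma IsDispKer.measurable (hk : IsDispKer D k) : Measurable (fun z : ℝ × Rd d => k z.1 z.2) :=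
  hk.cont.measurable

/-- Absolute `L¹` estimate for superpositions of a dispersive kernel. -/
lemma IsDispKer.lintegral_superposition_le (hd : 1 ≤ d) (hD : IsConeDist D L)
    (hk : IsDispKer D k) : ∃ C : ℝ, 0 < C ∧ ∀ {Y : Type} [MeasurableSpace Y] (ν : Measure Y)
      [SFinite ν] (P : Y → ℝ × Rd d), Measurable P → ∀ φ : Y → ℂ, Measurable φ →
      ∫⁻ x, ∫⁻ y, ‖k (P y).1 (x - (P y).2) * φ y‖ₑ ∂ν ≤
        ENNReal.ofReal C * ∫⁻ y, ENNReal.ofReal (√(1 + |(P y).1|) ^ (d - 1)) * ‖φ y‖ₑ ∂ν := by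
  obtain ⟨C, hC, h⟩ := hk.lintegral_le hd hD
  refine ⟨C, hC, fun {Y} _ ν _ P hP φ hφ => ?_⟩
  have hkm := hk.measurable
  have hm : Measurable (Function.uncurry fun (x : Rd d) (y : Y) =>
      ‖k (P y).1 (x - (P y).2) * φ y‖ₑ) := by
    have h1 : Measurable fun q : Rd d × Y => k (P q.2).1 (q.1 - (P q.2).2) :=
      hkm.comp ((hP.fst.comp measurable_snd).prodMk
        (measurable_fst.sub (hP.snd.comp measurable_snd)))
    exact (h1.mul (hφ.comp measurable_snd)).enorm
  rw [lintegral_lintegral_swap hm.aemeasurable, ← lintegral_const_mul _ (by fun_prop)]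
  refine lintegral_mono fun y => ?_
  have h2 : Measurable fun x => ‖k (P y).1 (x - (P y).2)‖ₑ :=
    (hkm.comp (measurable_const.prodMk (measurable_id.sub_const _))).enorm
  simp only [enorm_mul]
  rw [lintegral_mul_const _ h2, ← mul_assoc,
    lintegral_sub_right_eq_self (fun x => ‖k (P y).1 x‖ₑ), ← ENNReal.ofReal_mul hC.le]
  gcongr
  exact h _

lemma IsDispKer.lintegral_sq_split (hd : 1 ≤ d) (hD : IsConeDist D L) (hk : IsDispKer D k)
    (hkk : ∀ r r' y y', ∫ x, k r (x - y) * starRingEnd ℂ (k r' (x - y')) = k' (r - r') (y' - y))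
    {Y : Type} [MeasurableSpace Y] {ν : Measure Y} [SFinite ν] {P : Y → ℝ × Rd d}
    (hP : Measurable P) {φ : Y → ℂ} (hφ : Measurable φ)
    (hfin : ∫⁻ y, ENNReal.ofReal (√(1 + |(P y).1|) ^ (d - 1)) * ‖φ y‖ₑ ∂ν < ∞)
    {S : Set (Y × Y)} (hS : MeasurableSet S) :
    ∫⁻ x, ‖∫ y, k (P y).1 (x - (P y).2) * φ y ∂ν‖ₑ ^ 2 ≤
      ∫⁻ z in S, ‖φ z.1‖ₑ * ‖φ z.2‖ₑ *
        ‖k' ((P z.1).1 - (P z.2).1) ((P z.2).2 - (P z.1).2)‖ₑ ∂(ν.prod ν) +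
      ∫⁻ x, ‖∫ z in Sᶜ, (k (P z.1).1 (x - (P z.1).2) * φ z.1) *
        starRingEnd ℂ (k (P z.2).1 (x - (P z.2).2) * φ z.2) ∂(ν.prod ν)‖ₑ := by
  obtain ⟨C, hC, hb⟩ := hk.bound
  obtain ⟨C', hC', hsup⟩ := hk.lintegral_superposition_le hd hD
  have hkm := hk.measurable
  have hF : Measurable (Function.uncurry fun (x : Rd d) (y : Y) =>
      k (P y).1 (x - (P y).2) * φ y) :=
    (hkm.comp ((hP.fst.comp measurable_snd).prodMk
        (measurable_fst.sub (hP.snd.comp measurable_snd)))).mul (hφ.comp measurable_snd)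
  have hφfin : ∫⁻ y, ‖φ y‖ₑ ∂ν < ∞ := by
    refine lt_of_le_of_lt (lintegral_mono fun y => ?_) hfin
    refine le_mul_of_one_le_left' ?_
    rw [← ENNReal.ofReal_one]
    exact ENNReal.ofReal_le_ofReal (one_le_sqrt_pow _ _)
  have hint : ∫⁻ x, (∫⁻ y, ‖k (P y).1 (x - (P y).2) * φ y‖ₑ ∂ν) *
      ∫⁻ y, ‖k (P y).1 (x - (P y).2) * φ y‖ₑ ∂ν < ∞ := by
    have h1 : ∀ x, ∫⁻ y, ‖k (P y).1 (x - (P y).2) * φ y‖ₑ ∂ν ≤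
        ENNReal.ofReal C * ∫⁻ y, ‖φ y‖ₑ ∂ν := by
      intro x
      rw [← lintegral_const_mul _ hφ.enorm]
      refine lintegral_mono fun y => ?_
      rw [enorm_mul]
      gcongr
      rw [← ofReal_norm]
      exact ENNReal.ofReal_le_ofReal (hb _ _)
    calc _ ≤ ∫⁻ x, (ENNReal.ofReal C * ∫⁻ y, ‖φ y‖ₑ ∂ν) *
          ∫⁻ y, ‖k (P y).1 (x - (P y).2) * φ y‖ₑ ∂ν := by
          refine lintegral_mono fun x => ?_
          gcongr
          exact h1 x
      _ = (ENNReal.ofReal C * ∫⁻ y, ‖φ y‖ₑ ∂ν) *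
          ∫⁻ x, ∫⁻ y, ‖k (P y).1 (x - (P y).2) * φ y‖ₑ ∂ν :=
          lintegral_const_mul _ hF.enorm.lintegral_prod_right'
      _ ≤ (ENNReal.ofReal C * ∫⁻ y, ‖φ y‖ₑ ∂ν) * (ENNReal.ofReal C' *
          ∫⁻ y, ENNReal.ofReal (√(1 + |(P y).1|) ^ (d - 1)) * ‖φ y‖ₑ ∂ν) := by
          gcongr
          exact hsup ν P hP φ hφ
      _ < ∞ := ENNReal.mul_lt_top (ENNReal.mul_lt_top ENNReal.ofReal_lt_top hφfin)
          (ENNReal.mul_lt_top ENNReal.ofReal_lt_top hfin)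
  refine (lintegral_sq_le_split hF hint hS).trans_eq ?_
  congr 1
  refine lintegral_congr fun z => ?_
  have : ∀ x, k (P z.1).1 (x - (P z.1).2) * φ z.1 *
      starRingEnd ℂ (k (P z.2).1 (x - (P z.2).2) * φ z.2) =
      φ z.1 * starRingEnd ℂ (φ z.2) * (k (P z.1).1 (x - (P z.1).2) *
        starRingEnd ℂ (k (P z.2).1 (x - (P z.2).2))) := by
    intro x; rw [map_mul]; ring
  simp_rw [this]
  rw [integral_const_mul, hkk, enorm_mul, enorm_mul, RCLike.enorm_conj]

end dispL2

lemma ENNReal.mul_le_sq_add_sq (a b : ℝ≥0∞) : a * b ≤ a ^ 2 + b ^ 2 := by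
  rcases le_total a b with h | h
  · calc a * b ≤ b * b := by gcongr
      _ = b ^ 2 := (sq b).symm
      _ ≤ _ := le_add_self
  · calc a * b ≤ a * a := by gcongr
      _ = a ^ 2 := (sq a).symm
      _ ≤ _ := le_self_add

/-- Near-diagonal pairs are controlled by the square function of the slices. -/
lemma enorm_integral_near_le {E : Type*} [MeasurableSpace E] {ν : Measure E} [SFinite ν]
    {F : ℝ × E → ℂ} (hFm : Measurable F) (hF : Integrable F (volume.prod ν)) {ℓ : ℝ}
    (hℓ : 0 < ℓ) :
    ‖∫ z in {z : (ℝ × E) × (ℝ × E) | ℓ < |z.1.1 - z.2.1|}ᶜ, F z.1 * starRingEnd ℂ (F z.2)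
      ∂((volume.prod ν).prod (volume.prod ν))‖ₑ ≤
      ENNReal.ofReal (4 * ℓ) * ∫⁻ r, ‖∫ y, F (r, y) ∂ν‖ₑ ^ 2 := by
  set S := {z : (ℝ × E) × (ℝ × E) | ℓ < |z.1.1 - z.2.1|} with hS
  have hSm : MeasurableSet S := measurableSet_lt measurable_const (by fun_prop)
  set T : ℝ → ℂ := fun r => ∫ y, F (r, y) ∂ν with hT
  have hTm : Measurable T := (hFm.stronglyMeasurable.integral_prod_right').measurable
  set N : ℝ → ℝ → ℂ := fun r r' => if |r - r'| ≤ ℓ then 1 else 0 with hN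
  have hNm : Measurable (Function.uncurry N) :=
    Measurable.ite (measurableSet_le (by fun_prop) measurable_const) measurable_const
      measurable_const
  have hNr : ∀ r, Measurable (N r) := fun r => hNm.comp measurable_prodMk_left
  have hN1 : ∀ r r', ‖N r r'‖ ≤ 1 := fun r r' => by simp only [hN]; split_ifs <;> simp
  have hFc : Integrable (fun P => starRingEnd ℂ (F P)) (volume.prod ν) :=
    hF.congr' (Complex.continuous_conj.measurable.comp hFm).aestronglyMeasurable
      (Filter.Eventually.of_forall fun P => by simp)
  have hprod := hF.mul_prod hFc
  have h1 : ∫ z in Sᶜ, F z.1 * starRingEnd ℂ (F z.2) ∂((volume.prod ν).prod (volume.prod ν)) =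
      ∫ P, F P * ∫ P', N P.1 P'.1 * starRingEnd ℂ (F P') ∂(volume.prod ν) ∂(volume.prod ν) := by
    rw [← integral_indicator hSm.compl]
    have hi : Integrable (Sᶜ.indicator fun z : (ℝ × E) × (ℝ × E) =>
        F z.1 * starRingEnd ℂ (F z.2)) ((volume.prod ν).prod (volume.prod ν)) :=
      hprod.indicator hSm.compl
    rw [integral_prod _ hi]
    congr 1
    ext P
    rw [← integral_const_mul]
    congr 1
    ext P'
    simp only [Set.indicator, mem_compl_iff, hS, mem_ofPred_eq, not_lt, hN]
    split_ifs <;> simp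
  set H : ℝ → ℂ := fun r => ∫ r', N r r' * starRingEnd ℂ (T r') with hH
  have h2 : ∀ r, ∫ P', N r P'.1 * starRingEnd ℂ (F P') ∂(volume.prod ν) = H r := by
    intro r
    have hi : Integrable (fun P' : ℝ × E => N r P'.1 * starRingEnd ℂ (F P')) (volume.prod ν) :=
      hFc.bdd_mul ((hNr r).comp measurable_fst).aestronglyMeasurable
        (Filter.Eventually.of_forall fun P' => hN1 r P'.1)
    rw [integral_prod _ hi]
    simp only [hH, hT]
    congr 1
    ext r'
    rw [integral_const_mul, integral_conj]
  have hHm : Measurable H := by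
    refine (StronglyMeasurable.integral_prod_right' (ν := volume)
      (f := fun q : ℝ × ℝ => N q.1 q.2 * starRingEnd ℂ (T q.2)) ?_).measurable
    exact (hNm.mul (Complex.continuous_conj.measurable.comp
      (hTm.comp measurable_snd))).stronglyMeasurable
  have hHb : ∀ r, ‖H r‖ ≤ ∫ P, ‖F P‖ ∂(volume.prod ν) := by
    intro r
    rw [← h2]
    refine norm_integral_le_of_norm_le hF.norm (Filter.Eventually.of_forall fun P => ?_)
    rw [norm_mul, RCLike.norm_conj]
    exact mul_le_of_le_one_left (norm_nonneg _) (hN1 _ _)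
  have h3 : ∫ P, F P * ∫ P', N P.1 P'.1 * starRingEnd ℂ (F P') ∂(volume.prod ν) ∂(volume.prod ν) =
      ∫ r, T r * H r := by
    simp only [h2]
    have hi : Integrable (fun P : ℝ × E => F P * H P.1) (volume.prod ν) :=
      hF.mul_bdd (hHm.comp measurable_fst).aestronglyMeasurable
        (Filter.Eventually.of_forall fun P => hHb P.1)
    rw [integral_prod _ hi]
    simp only [hT]
    congr 1
    ext r
    rw [integral_mul_const]
  rw [h1, h3]
  set g : ℝ → ℝ → ℝ≥0∞ := fun r r' => ‖N r r'‖ₑ with hg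
  have hgm : Measurable (Function.uncurry g) := hNm.enorm
  have hgr : ∀ r, Measurable (g r) := fun r => hgm.comp measurable_prodMk_left
  have hgs : ∀ r r', g r r' = g r' r := fun r r' => by simp only [hg, hN, abs_sub_comm]
  have hgi : ∀ r, ∫⁻ r', g r r' = ENNReal.ofReal (2 * ℓ) := by
    intro r
    have : ∀ r', g r r' = (Metric.closedBall r ℓ).indicator 1 r' := by
      intro r'
      simp only [hg, hN, Set.indicator, Metric.mem_closedBall, Real.dist_eq, abs_sub_comm r']
      split_ifs <;> simp
    simp_rw [this]
    rw [lintegral_indicator_one Metric.isClosed_closedBall.measurableSet, Real.volume_closedBall]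
  set A : ℝ → ℝ≥0∞ := fun r => ‖T r‖ₑ ^ 2 with hA
  have hAm : Measurable A := hTm.enorm.pow_const 2
  have hAg : ∫⁻ r, ∫⁻ r', g r r' * A r = ENNReal.ofReal (2 * ℓ) * ∫⁻ r, A r := by
    rw [← lintegral_const_mul _ hAm]
    congr 1
    ext r
    rw [lintegral_mul_const _ (hgr r), hgi]
  calc _ ≤ ∫⁻ r, ‖T r * H r‖ₑ := enorm_integral_le_lintegral_enorm _
    _ ≤ ∫⁻ r, ∫⁻ r', (g r r' * A r + g r r' * A r') := by
      refine lintegral_mono fun r => ?_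
      rw [enorm_mul]
      calc _ ≤ ‖T r‖ₑ * ∫⁻ r', ‖N r r' * starRingEnd ℂ (T r')‖ₑ := by
            gcongr; exact enorm_integral_le_lintegral_enorm _
        _ = ∫⁻ r', ‖T r‖ₑ * ‖N r r' * starRingEnd ℂ (T r')‖ₑ := by
            rw [lintegral_const_mul]
            exact ((hNr r).mul (Complex.continuous_conj.measurable.comp hTm)).enorm
        _ ≤ _ := by
            refine lintegral_mono fun r' => ?_
            rw [enorm_mul, RCLike.enorm_conj]
            calc ‖T r‖ₑ * (‖N r r'‖ₑ * ‖T r'‖ₑ) = g r r' * (‖T r‖ₑ * ‖T r'‖ₑ) := by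
                  simp only [hg]; ring
              _ ≤ g r r' * (A r + A r') := by
                  gcongr; exact ENNReal.mul_le_sq_add_sq _ _
              _ = _ := mul_add _ _ _
    _ = (∫⁻ r, ∫⁻ r', g r r' * A r) + ∫⁻ r, ∫⁻ r', g r r' * A r' := by
      rw [← lintegral_add_left]
      · congr 1; ext r
        exact lintegral_add_left ((hgr r).mul_const _) _
      · exact Measurable.lintegral_prod_right' (f := fun q : ℝ × ℝ => g q.1 q.2 * A q.1)
          (hgm.mul (hAm.comp measurable_fst))
    _ = (ENNReal.ofReal (2 * ℓ) * ∫⁻ r, A r) + ENNReal.ofReal (2 * ℓ) * ∫⁻ r, A r := by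
      rw [hAg]
      congr 1
      rw [lintegral_lintegral_swap (hgm.mul (hAm.comp measurable_snd)).aemeasurable, ← hAg]
      congr 1; ext r; congr 1; ext r'
      rw [hgs]
    _ = _ := by
      rw [← add_mul, ← ENNReal.ofReal_add (by positivity) (by positivity)]
      congr 2; ring

section dispL2
variable {d : ℕ} {D : ℝ → Rd d → ℝ} {L : ℝ} {k k' : ℝ → Rd d → ℂ}

lemma IsDispKer.lintegral_slice_sq_le (hd : 1 ≤ d) (hD : IsConeDist D L) (hk : IsDispKer D k)
    (hk' : IsDispKer D k')
    (hkk : ∀ r r' y y', ∫ x, k r (x - y) * starRingEnd ℂ (k r' (x - y')) =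
      k' (r - r') (y' - y)) :
    ∃ C : ℝ, 0 < C ∧ ∀ r, ∀ φ : Rd d → ℂ, Measurable φ → ∫⁻ y, ‖φ y‖ₑ < ∞ →
      ∫⁻ x, ‖∫ y, k r (x - y) * φ y‖ₑ ^ 2 ≤ ENNReal.ofReal C * ∫⁻ y, ‖φ y‖ₑ ^ 2 := by
  obtain ⟨C, hC, h⟩ := hk'.lintegral_le hd hD
  refine ⟨2 * C, by positivity, fun r φ hφ hfin => ?_⟩
  have h0 := hk.lintegral_sq_split hd hD hkk (ν := volume) (P := fun y => (r, y)) (by fun_prop)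
    hφ (by
      simp only
      rw [lintegral_const_mul _ hφ.enorm]
      exact ENNReal.mul_lt_top ENNReal.ofReal_lt_top hfin) MeasurableSet.univ
  simp only [compl_univ, Measure.restrict_empty, integral_zero_measure, enorm_zero, lintegral_zero,
    add_zero, Measure.restrict_univ, sub_self] at h0
  refine h0.trans ?_
  have hkm : Measurable (k' 0) := hk'.measurable.comp measurable_prodMk_left
  set g : Rd d → Rd d → ℝ≥0∞ := fun y y' => ‖k' 0 (y' - y)‖ₑ with hg
  have hgm : Measurable (Function.uncurry g) :=
    (hkm.comp (measurable_snd.sub measurable_fst)).enorm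
  have hg1 : ∀ y, Measurable (g y) := fun y => hgm.comp measurable_prodMk_left
  have hg2 : ∀ y, Measurable fun x => g x y := fun y => hgm.comp measurable_prodMk_right
  have hI : ∫⁻ x, ‖k' 0 x‖ₑ ≤ ENNReal.ofReal C := by simpa using h 0
  set A : Rd d → ℝ≥0∞ := fun y => ‖φ y‖ₑ ^ 2 with hA
  have hAm : Measurable A := hφ.enorm.pow_const 2
  have h1 : ∫⁻ y, ∫⁻ y', g y y' * A y ≤ ENNReal.ofReal C * ∫⁻ y, A y := by
    rw [← lintegral_const_mul _ hAm]
    refine lintegral_mono fun y => ?_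
    rw [lintegral_mul_const _ (hg1 y)]
    gcongr
    simp only [hg]
    rw [lintegral_sub_right_eq_self (fun x => ‖k' 0 x‖ₑ)]
    exact hI
  have h2 : ∫⁻ y, ∫⁻ y', g y y' * A y' ≤ ENNReal.ofReal C * ∫⁻ y, A y := by
    rw [lintegral_lintegral_swap (hgm.mul (hAm.comp measurable_snd)).aemeasurable,
      ← lintegral_const_mul _ hAm]
    refine lintegral_mono fun y => ?_
    rw [lintegral_mul_const _ (hg2 y)]
    gcongr
    simp only [hg]
    rw [lintegral_sub_left_eq_self (fun x => ‖k' 0 x‖ₑ)]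
    exact hI
  have hm : Measurable fun z : Rd d × Rd d => ‖φ z.1‖ₑ * ‖φ z.2‖ₑ * ‖k' 0 (z.2 - z.1)‖ₑ :=
    ((hφ.comp measurable_fst).enorm.mul (hφ.comp measurable_snd).enorm).mul hgm
  rw [lintegral_prod _ hm.aemeasurable]
  calc _ ≤ ∫⁻ y, ∫⁻ y', (g y y' * A y + g y y' * A y') := by
        refine lintegral_mono fun y => lintegral_mono fun y' => ?_
        simp only
        rw [← mul_add, mul_comm]
        exact mul_le_mul_right (ENNReal.mul_le_sq_add_sq _ _) _
    _ = (∫⁻ y, ∫⁻ y', g y y' * A y) + ∫⁻ y, ∫⁻ y', g y y' * A y' := by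
      rw [← lintegral_add_left]
      · congr 1; ext y
        exact lintegral_add_left ((hg1 y).mul_const _) _
      · exact Measurable.lintegral_prod_right' (f := fun q : Rd d × Rd d => g q.1 q.2 * A q.1)
          (hgm.mul (hAm.comp measurable_fst))
    _ ≤ (ENNReal.ofReal C * ∫⁻ y, A y) + ENNReal.ofReal C * ∫⁻ y, A y := add_le_add h1 h2
    _ = _ := by
      rw [← add_mul, ← ENNReal.ofReal_add hC.le hC.le]
      congr 2; ring

/-- `L²` estimate: the near-diagonal pairs cost a factor `ℓ`, the remaining pairs are estimated
absolutely. -/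
lemma IsDispKer.lintegral_sq_le (hd : 1 ≤ d) (hD : IsConeDist D L) (hk : IsDispKer D k)
    (hk' : IsDispKer D k')
    (hkk : ∀ r r' y y', ∫ x, k r (x - y) * starRingEnd ℂ (k r' (x - y')) =
      k' (r - r') (y' - y)) :
    ∃ C : ℝ, 0 < C ∧ ∀ ℓ, 0 < ℓ → ∀ f : ℝ × Rd d → ℂ, Measurable f →
      ∫⁻ P, ENNReal.ofReal (√(1 + |P.1|) ^ (d - 1)) * ‖f P‖ₑ < ∞ →
      ∫⁻ x, ‖∫ P, k P.1 (x - P.2) * f P‖ₑ ^ 2 ≤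
        (ENNReal.ofReal (C * ℓ) * ∫⁻ P, ‖f P‖ₑ ^ 2) +
        ∫⁻ z in {z : (ℝ × Rd d) × (ℝ × Rd d) | ℓ < |z.1.1 - z.2.1|},
          ‖f z.1‖ₑ * ‖f z.2‖ₑ * ‖k' (z.1.1 - z.2.1) (z.2.2 - z.1.2)‖ₑ := by
  obtain ⟨C, hC, hsl⟩ := hk.lintegral_slice_sq_le hd hD hk' hkk
  obtain ⟨C', hC', hsup⟩ := hk.lintegral_superposition_le hd hD
  refine ⟨4 * C, by positivity, fun ℓ hℓ f hf hfin => ?_⟩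
  have hSm : MeasurableSet {z : (ℝ × Rd d) × (ℝ × Rd d) | ℓ < |z.1.1 - z.2.1|} :=
    measurableSet_lt measurable_const (by fun_prop)
  have h0 := hk.lintegral_sq_split hd hD hkk (ν := volume) (P := id) measurable_id hf hfin hSm
  simp only [id] at h0
  refine h0.trans ?_
  rw [add_comm (ENNReal.ofReal _ * _)]
  refine add_le_add_right ?_ _
  have hFm : Measurable fun q : Rd d × (ℝ × Rd d) => k q.2.1 (q.1 - q.2.2) * f q.2 :=
    (hk.measurable.comp ((measurable_snd.fst).prodMk (measurable_fst.sub measurable_snd.snd))).mul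
      (hf.comp measurable_snd)
  have hfin1 : ∀ᵐ x : Rd d, ∫⁻ P : ℝ × Rd d, ‖k P.1 (x - P.2) * f P‖ₑ < ∞ := by
    refine ae_lt_top (hFm.enorm.lintegral_prod_right') ?_
    refine ne_top_of_le_ne_top ?_ (hsup volume id measurable_id f hf)
    exact ENNReal.mul_ne_top ENNReal.ofReal_ne_top hfin.ne
  have hfin2 : ∀ᵐ r : ℝ, ∫⁻ y : Rd d, ‖f (r, y)‖ₑ < ∞ := by
    refine ae_lt_top (hf.enorm.lintegral_prod_right') ?_
    have : ∫⁻ r : ℝ, ∫⁻ y : Rd d, ‖f (r, y)‖ₑ = ∫⁻ P, ‖f P‖ₑ :=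
      (lintegral_prod _ hf.enorm.aemeasurable).symm
    rw [this]
    refine ne_top_of_le_ne_top hfin.ne (lintegral_mono fun P => ?_)
    have h1 : (1 : ℝ≥0∞) ≤ ENNReal.ofReal (√(1 + |P.1|) ^ (d - 1)) := by
      rw [← ENNReal.ofReal_one]
      exact ENNReal.ofReal_le_ofReal (one_le_sqrt_pow _ _)
    simpa using mul_le_mul_left h1 ‖f P‖ₑ
  have hTm : Measurable fun q : Rd d × ℝ => ‖∫ y, k q.2 (q.1 - y) * f (q.2, y)‖ₑ ^ 2 := by
    refine (StronglyMeasurable.integral_prod_right' (ν := volume)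
      (f := fun q : (Rd d × ℝ) × Rd d => k q.1.2 (q.1.1 - q.2) * f (q.1.2, q.2))
      ?_).measurable.enorm.pow_const 2
    exact (hFm.comp ((measurable_fst.fst).prodMk
      ((measurable_fst.snd).prodMk measurable_snd))).stronglyMeasurable
  calc _ ≤ ∫⁻ x, ENNReal.ofReal (4 * ℓ) * ∫⁻ r, ‖∫ y, k r (x - y) * f (r, y)‖ₑ ^ 2 := by
        refine lintegral_mono_ae ?_
        filter_upwards [hfin1] with x hx
        have hm : Measurable fun P : ℝ × Rd d => k P.1 (x - P.2) * f P :=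
          hFm.comp measurable_prodMk_left
        exact enorm_integral_near_le hm ⟨hm.aestronglyMeasurable, hx⟩ hℓ
    _ = ENNReal.ofReal (4 * ℓ) * ∫⁻ r, ∫⁻ x, ‖∫ y, k r (x - y) * f (r, y)‖ₑ ^ 2 := by
        rw [lintegral_const_mul _ hTm.lintegral_prod_right', lintegral_lintegral_swap]
        exact hTm.aemeasurable
    _ ≤ ENNReal.ofReal (4 * ℓ) * ∫⁻ r, ENNReal.ofReal C * ∫⁻ y, ‖f (r, y)‖ₑ ^ 2 := by
        gcongr 1
        refine lintegral_mono_ae ?_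
        filter_upwards [hfin2] with r hr
        exact hsl r _ (hf.comp measurable_prodMk_left) hr
    _ = _ := by
        have hm : Measurable fun P : ℝ × Rd d => ‖f P‖ₑ ^ 2 := hf.enorm.pow_const 2
        rw [lintegral_const_mul _ hm.lintegral_prod_right', Measure.volume_eq_prod ℝ (Rd d),
          lintegral_prod _ hm.aemeasurable, ← mul_assoc, ← ENNReal.ofReal_mul (by positivity)]
        congr 2; ring

end dispL2

section vitali
variable {d : ℕ}

open Metric in
lemma exists_volume_closedBall_prod (d : ℕ) : ∃ c : ℝ, 0 < c ∧ ∀ (P : ℝ × Rd d) (t : ℝ), 0 ≤ t →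
    volume (closedBall P t) = ENNReal.ofReal (c * t ^ (d + 1)) := by
  have hH : (volume : Measure (ℝ × Rd d)).IsAddHaarMeasure := by
    rw [Measure.volume_eq_prod]; infer_instance
  have hfin : volume (ball (0 : ℝ × Rd d) 1) ≠ ∞ := measure_ball_lt_top.ne
  refine ⟨(volume (ball (0 : ℝ × Rd d) 1)).toReal,
    ENNReal.toReal_pos (measure_ball_pos _ _ one_pos).ne' hfin, fun P t ht => ?_⟩
  rw [Measure.addHaar_closedBall volume P ht, Module.finrank_prod, Module.finrank_self,
    finrank_euclideanSpace_fin, mul_comm, ENNReal.ofReal_mul ENNReal.toReal_nonneg,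
    ENNReal.ofReal_toReal hfin, add_comm 1 d]

/-- The weighted measure `(1+|r|)^{d-1} dr dy` of a set. -/
def shellMass (A : Set (ℝ × Rd d)) : ℝ≥0∞ := ∫⁻ P in A, ENNReal.ofReal ((1 + |P.1|) ^ (d - 1))

lemma volume_le_shellMass {A : Set (ℝ × Rd d)} : volume A ≤ shellMass A := by
  rw [← setLIntegral_one]
  refine lintegral_mono fun P => ?_
  rw [← ENNReal.ofReal_one]
  exact ENNReal.ofReal_le_ofReal (one_le_pow₀ (by linarith [abs_nonneg P.1]))

open Metric in
/-- Removing from `A` the balls on which it is too dense, by Vitali's covering lemma. -/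
lemma IsConeDist.exists_good_set {D : ℝ → Rd d → ℝ} {L : ℝ}
    (hD : IsConeDist D L) :
    ∃ C : ℝ, 0 < C ∧ ∀ Θ : ℝ, 1 ≤ Θ → ∀ A : Set (ℝ × Rd d), MeasurableSet A → shellMass A < ∞ →
      ∃ E ⊆ A, MeasurableSet E ∧ ∃ Ω : Set (Rd d), MeasurableSet Ω ∧
        (∀ P ∈ E, ∀ t, 1 ≤ t → t < (1 + |P.1|) / 20 →
          volume (E ∩ closedBall P t) ≤ ENNReal.ofReal (Θ * t)) ∧
        volume Ω ≤ ENNReal.ofReal (C / Θ) * shellMass A ∧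
        ∀ x ∉ Ω, ∀ P ∈ A \ E, Θ ≤ C * D P.1 (x - P.2) ^ d := by
  have hL := hD.one_le
  obtain ⟨c, hc, hvol⟩ := exists_volume_closedBall_prod d
  set K : ℝ := L * ((10 * L + 1) * (2 * (10 * L + 2)) ^ (d - 1)) with hK
  refine ⟨max c K, lt_max_of_lt_left hc, fun Θ hΘ A hA hfin => ?_⟩
  have hAfin : volume A ≠ ∞ := (volume_le_shellMass.trans_lt hfin).ne
  set I : Set ((ℝ × Rd d) × ℝ) := {i | i.1 ∈ A ∧ 1 ≤ i.2 ∧ i.2 < (1 + |i.1.1|) / 20 ∧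
    ENNReal.ofReal (Θ * i.2) < volume (A ∩ closedBall i.1 i.2)} with hI
  have hIb : ∀ i ∈ I, i.2 ≤ (volume A).toReal := by
    rintro i ⟨-, h1, -, h2⟩
    have h3 := h2.trans_le (measure_mono inter_subset_left)
    have h4 := (ENNReal.ofReal_lt_iff_lt_toReal (by positivity) hAfin).1 h3
    nlinarith
  obtain ⟨u, huI, hdisj, hcov⟩ := Vitali.exists_disjoint_subfamily_covering_enlargement_closedBall
    I (fun i => i.1) (fun i => i.2) _ hIb 5 (by norm_num)
  have hucount : u.Countable := by
    refine hdisj.countable_of_nonempty_interior fun i hi => ?_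
    have h1 : 0 < i.2 := by linarith [(huI hi).2.1]
    exact ⟨i.1, ball_subset_interior_closedBall (mem_ball_self h1)⟩
  set V : Set (ℝ × Rd d) := ⋃ i ∈ u, closedBall i.1 (5 * i.2) with hV
  have hVm : MeasurableSet V :=
    MeasurableSet.biUnion hucount fun i _ => isClosed_closedBall.measurableSet
  set O : (ℝ × Rd d) × ℝ → Set (Rd d) := fun i => {x | D i.1.1 (x - i.1.2) ≤ (10 * L + 1) * i.2}
    with hO
  have hOm : ∀ i, MeasurableSet (O i) := fun i => measurableSet_le
    ((hD.continuous_right i.1.1).measurable.comp (measurable_id.sub_const _)) measurable_const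
  refine ⟨A \ V, sdiff_subset, hA.diff hVm, ⋃ i ∈ u, O i,
    MeasurableSet.biUnion hucount fun i _ => hOm i, ?_, ?_, ?_⟩
  · intro P hP t ht1 ht2
    by_contra! hcon
    have hPI : (P, t) ∈ I := ⟨hP.1, ht1, ht2, hcon.trans_le
      (measure_mono (inter_subset_inter_left _ sdiff_subset))⟩
    obtain ⟨b, hb, hsub⟩ := hcov _ hPI
    exact hP.2 (mem_biUnion hb (hsub (mem_closedBall_self (by simp only; linarith))))
  · have hball : ∀ i ∈ u, volume (O i) ≤ ENNReal.ofReal (max c K / Θ) *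
        ∫⁻ P in A ∩ closedBall i.1 i.2, ENNReal.ofReal ((1 + |P.1|) ^ (d - 1)) := by
      intro i hi
      obtain ⟨-, h1, h2, h3⟩ := huI hi
      set w := 1 + |i.1.1| with hw
      have hw1 : 1 ≤ w := by linarith [abs_nonneg i.1.1]
      have hOi : volume (O i) ≤ ENNReal.ofReal (K * (i.2 * (w / 2) ^ (d - 1))) := by
        have : volume (O i) = volume {x | D i.1.1 x ≤ (10 * L + 1) * i.2} :=
          (measurePreserving_sub_right volume i.1.2).measure_preimage
            (measurableSet_le (hD.continuous_right _).measurable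
              measurable_const).nullMeasurableSet
        rw [this]
        refine (hD.vol _ _ (by positivity)).trans (ENNReal.ofReal_le_ofReal ?_)
        have h4 : (10 * L + 1) * i.2 + |i.1.1| ≤ (2 * (10 * L + 2)) * (w / 2) := by nlinarith
        calc _ ≤ L * ((10 * L + 1) * i.2 * ((2 * (10 * L + 2)) * (w / 2)) ^ (d - 1)) := by
              gcongr
          _ = _ := by rw [mul_pow, hK]; ring
      have hlow : ENNReal.ofReal ((w / 2) ^ (d - 1)) * ENNReal.ofReal (Θ * i.2) ≤
          ∫⁻ P in A ∩ closedBall i.1 i.2, ENNReal.ofReal ((1 + |P.1|) ^ (d - 1)) := by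
        calc _ ≤ ENNReal.ofReal ((w / 2) ^ (d - 1)) * volume (A ∩ closedBall i.1 i.2) := by
              gcongr
          _ = ∫⁻ P in A ∩ closedBall i.1 i.2, ENNReal.ofReal ((w / 2) ^ (d - 1)) := by
              rw [setLIntegral_const]
          _ ≤ _ := by
              refine setLIntegral_mono' (hA.inter isClosed_closedBall.measurableSet)
                fun P hP => ENNReal.ofReal_le_ofReal ?_
              have h5 : |P.1 - i.1.1| ≤ i.2 := by
                have := (le_max_left _ _).trans (mem_closedBall.1 hP.2)
                rwa [Real.dist_eq] at this
              have h6 : |i.1.1| ≤ |P.1| + |P.1 - i.1.1| := by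
                have := abs_sub_abs_le_abs_sub i.1.1 P.1
                rw [abs_sub_comm] at this
                linarith
              gcongr
              linarith
      refine hOi.trans ?_
      calc _ ≤ ENNReal.ofReal (max c K / Θ * ((w / 2) ^ (d - 1) * (Θ * i.2))) := by
            apply ENNReal.ofReal_le_ofReal
            have : max c K / Θ * ((w / 2) ^ (d - 1) * (Θ * i.2)) =
              max c K * (i.2 * (w / 2) ^ (d - 1)) := by field_simp
            rw [this]
            gcongr
            exact le_max_right _ _
        _ = ENNReal.ofReal (max c K / Θ) *
            (ENNReal.ofReal ((w / 2) ^ (d - 1)) * ENNReal.ofReal (Θ * i.2)) := by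
            rw [ENNReal.ofReal_mul (by positivity), ENNReal.ofReal_mul (by positivity)]
        _ ≤ _ := by gcongr
    calc volume (⋃ i ∈ u, O i) ≤ ∑' i : u, volume (O i) := measure_biUnion_le _ hucount _
      _ ≤ ∑' i : u, ENNReal.ofReal (max c K / Θ) *
          ∫⁻ P in A ∩ closedBall i.1.1 i.1.2, ENNReal.ofReal ((1 + |P.1|) ^ (d - 1)) :=
          ENNReal.tsum_le_tsum fun i => hball i.1 i.2
      _ = ENNReal.ofReal (max c K / Θ) *
          ∫⁻ P in ⋃ i ∈ u, A ∩ closedBall i.1 i.2, ENNReal.ofReal ((1 + |P.1|) ^ (d - 1)) := by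
          rw [ENNReal.tsum_mul_left, lintegral_biUnion hucount
            (fun i _ => hA.inter isClosed_closedBall.measurableSet)]
          exact hdisj.mono fun i => inter_subset_right
      _ ≤ _ := by
          gcongr
          exact lintegral_mono_set (iUnion₂_subset fun i _ => inter_subset_left)
  · intro x hx P hP
    have hPV : P ∈ V := by
      by_contra h; exact hP.2 ⟨hP.1, h⟩
    obtain ⟨i, hi, hPi⟩ := mem_iUnion₂.1 hPV
    obtain ⟨-, h1, -, h3⟩ := huI hi
    have hxi : (10 * L + 1) * i.2 < D i.1.1 (x - i.1.2) := by
      by_contra! h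
      exact hx (mem_biUnion hi h)
    have hdist := mem_closedBall.1 hPi
    have hr : |P.1 - i.1.1| ≤ 5 * i.2 := by
      have := (le_max_left _ _).trans hdist
      rwa [Real.dist_eq] at this
    have hy : ‖P.2 - i.1.2‖ ≤ 5 * i.2 := by
      have := (le_max_right _ _).trans hdist
      rwa [dist_eq_norm] at this
    have hl := hD.lip i.1.1 P.1 (x - i.1.2) (x - P.2)
    rw [abs_sub_comm, show x - i.1.2 - (x - P.2) = P.2 - i.1.2 by abel] at hl
    have hDt : i.2 ≤ D P.1 (x - P.2) := by nlinarith
    have h4 := h3.trans_le (measure_mono inter_subset_right)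
    rw [hvol _ _ (by linarith), ENNReal.ofReal_lt_ofReal_iff (by positivity)] at h4
    have h5 : Θ < c * i.2 ^ d := by
      have : c * i.2 ^ (d + 1) = c * i.2 ^ d * i.2 := by ring
      rw [this] at h4
      exact lt_of_mul_lt_mul_right h4 (by linarith)
    calc Θ ≤ c * i.2 ^ d := h5.le
      _ ≤ _ := by
        gcongr
        exact le_max_left _ _

end vitali

section bad
variable {d : ℕ} {D : ℝ → Rd d → ℝ} {L : ℝ} {k : ℝ → Rd d → ℂ}

/-- The contribution far from the cones of the points. -/
lemma IsDispKer.lintegral_far_cone_le (hd : 1 ≤ d) (hD : IsConeDist D L) (hk : IsDispKer D k) :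
    ∃ C : ℝ, 0 < C ∧ ∀ τ : ℝ, 0 < τ → ∀ A : Set (ℝ × Rd d), MeasurableSet A →
      ∫⁻ x, ∫⁻ P in A, {x | τ ≤ D P.1 x ^ d}.indicator
        (fun x => ENNReal.ofReal (√(1 + |P.1|) ^ (d - 1)) * ‖k P.1 x‖ₑ) (x - P.2) ≤
        ENNReal.ofReal (C / τ) * shellMass A := by
  obtain ⟨C, hC, h⟩ := hk.lintegral_tail_le hd hD
  refine ⟨C, hC, fun τ hτ A hA => ?_⟩
  have hsub : Measurable fun q : Rd d × (ℝ × Rd d) => (q.2.1, q.1 - q.2.2) :=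
    (measurable_snd.fst).prodMk (measurable_fst.sub measurable_snd.snd)
  have hS : MeasurableSet {z : ℝ × Rd d | τ ≤ D z.1 z.2 ^ d} :=
    measurableSet_le measurable_const (hD.continuous.measurable.pow_const d)
  have hm : Measurable (Function.uncurry fun (x : Rd d) (P : ℝ × Rd d) =>
      {x | τ ≤ D P.1 x ^ d}.indicator
        (fun x => ENNReal.ofReal (√(1 + |P.1|) ^ (d - 1)) * ‖k P.1 x‖ₑ) (x - P.2)) := by
    have h1 : Measurable fun z : ℝ × Rd d =>
        ENNReal.ofReal (√(1 + |z.1|) ^ (d - 1)) * ‖k z.1 z.2‖ₑ :=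
      Measurable.mul (by fun_prop) hk.measurable.enorm
    exact (h1.indicator hS).comp hsub
  rw [lintegral_lintegral_swap hm.aemeasurable, shellMass, ← lintegral_const_mul _ (by fun_prop)]
  refine lintegral_mono fun P => ?_
  have hS1 : MeasurableSet {x : Rd d | τ ≤ D P.1 x ^ d} :=
    measurableSet_le measurable_const ((hD.continuous_right P.1).measurable.pow_const d)
  have hk1 : Measurable fun x => ‖k P.1 x‖ₑ :=
    (hk.measurable.comp measurable_prodMk_left).enorm
  simp only
  rw [lintegral_sub_right_eq_self, lintegral_indicator hS1, lintegral_const_mul _ hk1]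
  refine (mul_le_mul_right (h P.1 τ hτ) _).trans (le_of_eq ?_)
  rw [← ENNReal.ofReal_mul (by positivity), ← ENNReal.ofReal_mul (by positivity),
    ← sqrt_pow_mul_self (show (0 : ℝ) ≤ 1 + |P.1| by positivity) (d - 1)]
  congr 1; ring

end bad

lemma lintegral_inv_sqrt_pow_le {α : Type*} [MeasurableSpace α] (μ : Measure α) {S : Set α}
    (hS : MeasurableSet S) {g : α → ℝ} (hg : Measurable g) {ℓ V : ℝ} (hℓ : 0 < ℓ) (hV : 0 ≤ V)
    {n : ℕ} (hn : 3 ≤ n) (hSg : ∀ x ∈ S, ℓ ≤ g x)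
    (hμ : ∀ t, 1 ≤ t → μ (S ∩ {x | g x ≤ t * ℓ}) ≤ ENNReal.ofReal (V * t)) :
    ∫⁻ x in S, ENNReal.ofReal (1 / √(g x) ^ n) ∂μ ≤ ENNReal.ofReal (64 * V / √ℓ ^ n) := by
  have hsℓ : 0 < √ℓ := Real.sqrt_pos.2 hℓ
  have hm : Measurable fun x => √(g x) / √ℓ := by fun_prop
  have h := lintegral_layer (μ.restrict S) (h := fun x => √(g x) / √ℓ) hm
    (fun x => by positivity) hV 2 (fun t ht => by
      rw [Measure.restrict_apply (measurableSet_le hm measurable_const), inter_comm]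
      refine (measure_mono ?_).trans (hμ (t ^ 2) (by nlinarith))
      refine inter_subset_inter_right _ fun x hx => ?_
      have hx : √(g x) / √ℓ ≤ t := hx
      rw [div_le_iff₀ hsℓ] at hx
      have h2 := Real.sqrt_le_iff.1 hx
      change g x ≤ t ^ 2 * ℓ
      rw [mul_pow, Real.sq_sqrt hℓ.le] at h2
      exact h2.2)
  have hm2 : Measurable fun x => ENNReal.ofReal (1 / (1 + √(g x) / √ℓ) ^ (2 + 1)) := by fun_prop
  calc _ ≤ ∫⁻ x in S, ENNReal.ofReal (8 / √ℓ ^ n) *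
        ENNReal.ofReal (1 / (1 + √(g x) / √ℓ) ^ (2 + 1)) ∂μ := by
        refine setLIntegral_mono' hS fun x hx => ?_
        rw [← ENNReal.ofReal_mul (by positivity)]
        apply ENNReal.ofReal_le_ofReal
        set u := √(g x) / √ℓ with hu
        have hu1 : 1 ≤ u := by
          rw [hu, one_le_div hsℓ]; exact Real.sqrt_le_sqrt (hSg x hx)
        have h3 : √(g x) = u * √ℓ := by rw [hu]; field_simp
        have h4 : (1 + u) ^ 3 ≤ 8 * u ^ n := by
          calc (1 + u) ^ 3 ≤ (2 * u) ^ 3 := by gcongr; linarith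
            _ = 8 * u ^ 3 := by ring
            _ ≤ 8 * u ^ n := by gcongr
        rw [h3, mul_pow, div_mul_div_comm, div_le_div_iff₀ (by positivity) (by positivity)]
        have h5 : 0 < √ℓ ^ n := by positivity
        norm_num
        nlinarith
    _ ≤ ENNReal.ofReal (8 / √ℓ ^ n) * ENNReal.ofReal (2 ^ (2 + 1) * V) := by
        rw [lintegral_const_mul _ hm2]
        gcongr
    _ = _ := by
        rw [← ENNReal.ofReal_mul (by positivity)]
        congr 1; ring

section far
variable {d : ℕ} {D : ℝ → Rd d → ℝ} {L : ℝ} {k : ℝ → Rd d → ℂ}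

/-- A majorant for dispersive kernels. -/
def dispMaj (D : ℝ → Rd d → ℝ) (s : ℝ) (x : Rd d) : ℝ :=
  1 / (√(1 + max |s| ‖x‖) ^ (d - 1) * (1 + D s x) ^ (d + 1))

lemma dispMaj_neg (hD : IsConeDist D L) (s : ℝ) (x : Rd d) :
    dispMaj D (-s) (-x) = dispMaj D s x := by
  rw [dispMaj, dispMaj, hD.neg, abs_neg, norm_neg]

lemma IsConeDist.measurable_dispMaj (hD : IsConeDist D L) :
    Measurable fun z : ℝ × Rd d => dispMaj D z.1 z.2 := by
  have := hD.continuous.measurable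
  unfold dispMaj
  fun_prop

lemma IsDispKer.le_dispMaj (hD : IsConeDist D L) (hk : IsDispKer D k) :
    ∃ C : ℝ, 0 < C ∧ ∀ s x, ‖k s x‖ ≤ C * dispMaj D s x := by
  have hL := hD.one_le
  obtain ⟨C, hC, h⟩ := hk.decay ((d - 1) + (d + 1))
  refine ⟨C * L ^ (d - 1), by positivity, fun s x => (h s x).trans ?_⟩
  have h0 := hD.nonneg s x
  have h1 : 1 + max |s| ‖x‖ ≤ L * ((1 + |s|) * (1 + D s x)) := by
    have h2 := hD.lower s x
    have h3 : max |s| ‖x‖ ≤ L * |s| + D s x :=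
      max_le (by nlinarith [abs_nonneg s]) (by linarith)
    nlinarith [abs_nonneg s, mul_nonneg (abs_nonneg s) h0]
  have h4 : √(1 + max |s| ‖x‖) ≤ L * (√(1 + |s|) * (1 + D s x)) := by
    refine (Real.sqrt_le_sqrt h1).trans ?_
    rw [Real.sqrt_mul (by linarith), Real.sqrt_mul (by positivity)]
    have h5 : √L ≤ L := Real.sqrt_le_iff.2 ⟨by linarith, by nlinarith⟩
    have h6 : √(1 + D s x) ≤ 1 + D s x := 
      Real.sqrt_le_iff.2 ⟨by linarith, by nlinarith⟩
    gcongr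
  have hp : 0 < √(1 + max |s| ‖x‖) := Real.sqrt_pos.2 (by positivity)
  have hp' : 0 < √(1 + |s|) := Real.sqrt_pos.2 (by positivity)
  rw [dispMaj, mul_one_div, div_le_div_iff₀ (by positivity) (by positivity)]
  calc C * (√(1 + max |s| ‖x‖) ^ (d - 1) * (1 + D s x) ^ (d + 1))
      ≤ C * ((L * (√(1 + |s|) * (1 + D s x))) ^ (d - 1) * (1 + D s x) ^ (d + 1)) := by gcongr
    _ = _ := by rw [mul_pow, mul_pow, pow_add]; ring

end far

section far
variable {d : ℕ} {D : ℝ → Rd d → ℝ} {L : ℝ} {k : ℝ → Rd d → ℂ}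

lemma dist_prod_eq (P P' : ℝ × Rd d) : dist P' P = max |P.1 - P'.1| ‖P'.2 - P.2‖ := by
  rw [Prod.dist_eq, Real.dist_eq, dist_eq_norm, abs_sub_comm]

/-- A set whose mass in balls, of radius small compared to the distance to `r = 0`, grows at
most linearly. -/
def IsThin (E : Set (ℝ × Rd d)) (Θ : ℝ) : Prop :=
  ∀ P ∈ E, ∀ t, 1 ≤ t → t < (1 + |P.1|) / 20 →
    volume (E ∩ Metric.closedBall P t) ≤ ENNReal.ofReal (Θ * t)

lemma IsConeDist.dispMaj_nonneg (hD : IsConeDist D L) (s : ℝ) (x : Rd d) : 0 ≤ dispMaj D s x := by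
  have := hD.nonneg s x
  unfold dispMaj
  positivity

lemma IsThin.lintegral_near_le (hd : 4 ≤ d) (hD : IsConeDist D L) {E : Set (ℝ × Rd d)}
    (hE : MeasurableSet E) {Θ ℓ : ℝ} (hΘ : 1 ≤ Θ) (hℓ : 1 ≤ ℓ) (hg : IsThin E Θ) {P : ℝ × Rd d}
    (hP : P ∈ E) :
    ∫⁻ P' in {P' | P' ∈ E ∧ |P'.1| ≤ |P.1| ∧ ℓ < dist P' P ∧ dist P' P < (1 + |P.1|) / 40},
      ENNReal.ofReal (√(1 + |P'.1|) ^ (d - 1) * dispMaj D (P.1 - P'.1) (P'.2 - P.2)) ≤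
      ENNReal.ofReal (64 * (Θ * ℓ / √ℓ ^ (d - 1) * √(1 + |P.1|) ^ (d - 1))) := by
  set S := {P' | P' ∈ E ∧ |P'.1| ≤ |P.1| ∧ ℓ < dist P' P ∧ dist P' P < (1 + |P.1|) / 40} with hS
  have hgm : Measurable fun P' : ℝ × Rd d => dist P' P := by fun_prop
  have hSm : MeasurableSet S := by
    refine hE.inter (MeasurableSet.inter ?_ (MeasurableSet.inter ?_ ?_))
    · exact measurableSet_le (measurable_norm.comp measurable_fst) measurable_const
    · exact measurableSet_lt measurable_const hgm
    · exact measurableSet_lt hgm measurable_const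
  have key := lintegral_inv_sqrt_pow_le volume hSm hgm (ℓ := ℓ) (V := Θ * ℓ) (by linarith)
    (by positivity) (n := d - 1) (by omega) (fun x hx => hx.2.2.1.le) (fun t ht => by
      rcases (S ∩ {x | dist x P ≤ t * ℓ}).eq_empty_or_nonempty with h0 | ⟨P0, h0, -⟩
      · rw [h0]; simp
      · have h1 : 1 < (1 + |P.1|) / 40 := by linarith [h0.2.2.1, h0.2.2.2]
        calc _ ≤ volume (E ∩ Metric.closedBall P (min (t * ℓ) ((1 + |P.1|) / 40))) := by
              refine measure_mono fun x hx => ⟨hx.1.1, ?_⟩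
              exact le_min hx.2 hx.1.2.2.2.le
          _ ≤ _ := hg P hP _ (le_min (by nlinarith) h1.le)
              ((min_le_right _ _).trans_lt (by linarith))
          _ ≤ _ := by
              apply ENNReal.ofReal_le_ofReal
              have := min_le_left (t * ℓ) ((1 + |P.1|) / 40)
              nlinarith)
  have hm : Measurable fun x : ℝ × Rd d => ENNReal.ofReal (1 / √(dist x P) ^ (d - 1)) := by
    fun_prop
  calc _ ≤ ∫⁻ P' in S, ENNReal.ofReal (√(1 + |P.1|) ^ (d - 1)) *
        ENNReal.ofReal (1 / √(dist P' P) ^ (d - 1)) := by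
        refine setLIntegral_mono' hSm fun P' hP' => ?_
        rw [← ENNReal.ofReal_mul (by positivity)]
        apply ENNReal.ofReal_le_ofReal
        have h1 := hP'.2.1
        have h2 : 0 < √(dist P' P) := Real.sqrt_pos.2 (by linarith [hP'.2.2.1])
        have h3 : dispMaj D (P.1 - P'.1) (P'.2 - P.2) ≤ 1 / √(dist P' P) ^ (d - 1) := by
          rw [dispMaj, ← dist_prod_eq]
          have h4 := hD.nonneg (P.1 - P'.1) (P'.2 - P.2)
          apply one_div_le_one_div_of_le (by positivity)
          have h5 : √(dist P' P) ≤ √(1 + dist P' P) := Real.sqrt_le_sqrt (by linarith)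
          have h6 : 1 ≤ (1 + D (P.1 - P'.1) (P'.2 - P.2)) ^ (d + 1) :=
            one_le_pow₀ (by linarith)
          calc √(dist P' P) ^ (d - 1) ≤ √(1 + dist P' P) ^ (d - 1) := by gcongr
            _ ≤ _ := le_mul_of_one_le_right (by positivity) h6
        have h7 := hD.dispMaj_nonneg (P.1 - P'.1) (P'.2 - P.2)
        gcongr
    _ ≤ ENNReal.ofReal (√(1 + |P.1|) ^ (d - 1)) *
          ENNReal.ofReal (64 * (Θ * ℓ) / √ℓ ^ (d - 1)) := by
        rw [lintegral_const_mul _ hm]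
        gcongr
    _ = _ := by
        rw [← ENNReal.ofReal_mul (by positivity)]
        congr 1; ring

/-- The average of `dispMaj` over balls comparable to the distance to `r = 0`. -/
def avgMaj (D : ℝ → Rd d → ℝ) (P Q : ℝ × Rd d) : ℝ :=
  √(1 + |Q.1|) ^ (d - 1) / (√(1 + |Q.1| + |P.1 - Q.1|) ^ (d - 1) *
    (1 + D (P.1 - Q.1) (Q.2 - P.2) / (1 + |Q.1|)) ^ (d + 1) * (1 + |Q.1|) ^ (d + 1))

lemma weight_comparable {P' Q : ℝ × Rd d} (h3 : dist P' Q ≤ (1 + |P'.1|) / 200) :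
    199 * (1 + |P'.1|) ≤ 200 * (1 + |Q.1|) ∧ 200 * (1 + |Q.1|) ≤ 201 * (1 + |P'.1|) := by
  have h4 : |P'.1 - Q.1| ≤ dist P' Q := by
    rw [Prod.dist_eq, ← Real.dist_eq]; exact le_max_left _ _
  have h5 := abs_abs_sub_abs_le P'.1 Q.1
  have h6 := abs_le.1 (h5.trans (h4.trans h3))
  constructor <;> linarith [h6.1, h6.2]

lemma IsConeDist.dispMaj_le_avgMaj (hD : IsConeDist D L) {P P' Q : ℝ × Rd d}
    (h1 : |P'.1| ≤ |P.1|) (h2 : (1 + |P.1|) / 40 ≤ dist P' P)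
    (h3 : dist P' Q ≤ (1 + |P'.1|) / 200) :
    √(1 + |P'.1|) ^ (d - 1) * dispMaj D (P.1 - P'.1) (P'.2 - P.2) / (1 + |P'.1|) ^ (d + 1) ≤
      20 ^ (d - 1) * (8 * L) ^ (d + 1) * avgMaj D P Q := by
  have hL := hD.one_le
  obtain ⟨ha, hb⟩ := weight_comparable h3
  have hr : |P'.1 - Q.1| ≤ dist P' Q := by
    rw [Prod.dist_eq, ← Real.dist_eq]; exact le_max_left _ _
  have hy : ‖P'.2 - Q.2‖ ≤ dist P' Q := by
    rw [Prod.dist_eq, ← dist_eq_norm]; exact le_max_right _ _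
  have hrr : |P.1 - P'.1| ≤ dist P' P := by
    rw [dist_prod_eq]; exact le_max_left _ _
  have hs : |P.1 - Q.1| ≤ |P.1 - P'.1| + |P'.1 - Q.1| := abs_sub_le _ _ _
  have hlip := hD.lip (P.1 - Q.1) (P.1 - P'.1) (Q.2 - P.2) (P'.2 - P.2)
  rw [show P.1 - Q.1 - (P.1 - P'.1) = P'.1 - Q.1 by ring,
    show Q.2 - P.2 - (P'.2 - P.2) = -(P'.2 - Q.2) by abel, norm_neg] at hlip
  set ρ := dist P' P
  set w := 1 + |P'.1| with hw
  set v := 1 + |Q.1| with hv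
  have hv1 : 1 ≤ v := by rw [hv]; linarith [abs_nonneg Q.1]
  have hw1 : 1 ≤ w := by rw [hw]; linarith [abs_nonneg P'.1]
  have hD0 := hD.nonneg (P.1 - P'.1) (P'.2 - P.2)
  have hDQ := hD.nonneg (P.1 - Q.1) (Q.2 - P.2)
  have e1 : √w ≤ 2 * √v := by
    rw [show (2 : ℝ) = √4 by rw [show (4 : ℝ) = 2 ^ 2 by norm_num]; simp, ← Real.sqrt_mul (by norm_num)]
    exact Real.sqrt_le_sqrt (by linarith)
  have e2 : √(v + |P.1 - Q.1|) ≤ 10 * √(1 + ρ) := by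
    rw [show (10 : ℝ) = √100 by rw [show (100 : ℝ) = 10 ^ 2 by norm_num]; simp, ← Real.sqrt_mul (by norm_num)]
    exact Real.sqrt_le_sqrt (by linarith)
  have e3 : 1 + D (P.1 - Q.1) (Q.2 - P.2) / v ≤
      4 * L * (1 + D (P.1 - P'.1) (P'.2 - P.2)) := by
    have : D (P.1 - Q.1) (Q.2 - P.2) / v ≤ D (P.1 - P'.1) (P'.2 - P.2) + L := by
      rw [div_le_iff₀ (by linarith)]
      have i1 : L * (|P'.1 - Q.1| + ‖P'.2 - Q.2‖) ≤ L * v :=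
        mul_le_mul_of_nonneg_left (by linarith) (by linarith)
      nlinarith
    nlinarith
  have e4 : v ≤ 2 * w := by linarith
  have q1 : 0 < √(1 + ρ) := Real.sqrt_pos.2 (by positivity)
  have q2 : 0 < √(v + |P.1 - Q.1|) := Real.sqrt_pos.2 (by positivity)
  rw [dispMaj, avgMaj, ← dist_prod_eq, mul_one_div, div_div, mul_div_assoc',
    div_le_div_iff₀ (by positivity) (by positivity), ← hv]
  calc √w ^ (d - 1) * (√(v + |P.1 - Q.1|) ^ (d - 1) *
        (1 + D (P.1 - Q.1) (Q.2 - P.2) / v) ^ (d + 1) * v ^ (d + 1))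
      ≤ (2 * √v) ^ (d - 1) * ((10 * √(1 + ρ)) ^ (d - 1) *
        (4 * L * (1 + D (P.1 - P'.1) (P'.2 - P.2))) ^ (d + 1) * (2 * w) ^ (d + 1)) := by
        gcongr
    _ = _ := by
        have : (8 : ℝ) ^ (d + 1) = 4 ^ (d + 1) * 2 ^ (d + 1) := by rw [← mul_pow]; norm_num
        have h20 : (20 : ℝ) ^ (d - 1) = 2 ^ (d - 1) * 10 ^ (d - 1) := by rw [← mul_pow]; norm_num
        simp only [mul_pow, this, h20]
        ring

lemma IsThin.volume_le : ∃ C : ℝ, 0 < C ∧ ∀ (E : Set (ℝ × Rd d)) (Θ : ℝ), 1 ≤ Θ → IsThin E Θ →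
    ∀ Q : ℝ × Rd d, volume {P' | P' ∈ E ∧ dist P' Q ≤ (1 + |P'.1|) / 200} ≤
      ENNReal.ofReal (C * (Θ * (1 + |Q.1|))) := by
  obtain ⟨c, hc, hvol⟩ := exists_volume_closedBall_prod d
  refine ⟨c + 1, by positivity, fun E Θ hΘ hg Q => ?_⟩
  have hQ := abs_nonneg Q.1
  have hΘQ : 1 ≤ Θ * (1 + |Q.1|) := by nlinarith
  rcases {P' | P' ∈ E ∧ dist P' Q ≤ (1 + |P'.1|) / 200}.eq_empty_or_nonempty with h0 | ⟨P0, h0, h00⟩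
  · rw [h0]; simp
  have hsub : {P' | P' ∈ E ∧ dist P' Q ≤ (1 + |P'.1|) / 200} ⊆
      E ∩ Metric.closedBall P0 ((1 + |P0.1|) / 40) := by
    rintro P' ⟨h1, h2⟩
    refine ⟨h1, ?_⟩
    have h3 := dist_triangle_right P' P0 Q
    obtain ⟨a1, a2⟩ := weight_comparable h2
    obtain ⟨b1, b2⟩ := weight_comparable h00
    rw [Metric.mem_closedBall]
    linarith
  obtain ⟨b1, b2⟩ := weight_comparable h00
  refine (measure_mono hsub).trans ?_
  rcases le_or_gt 1 ((1 + |P0.1|) / 40) with h | h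
  · refine (hg P0 h0 _ h (by linarith)).trans (ENNReal.ofReal_le_ofReal ?_)
    have : Θ * ((1 + |P0.1|) / 40) ≤ Θ * (1 + |Q.1|) := by
      gcongr; linarith
    nlinarith
  · calc _ ≤ volume (Metric.closedBall P0 1) :=
          measure_mono (inter_subset_right.trans (Metric.closedBall_subset_closedBall h.le))
      _ = ENNReal.ofReal (c * 1 ^ (d + 1)) := hvol _ _ (by norm_num)
      _ ≤ _ := by
          apply ENNReal.ofReal_le_ofReal
          rw [one_pow]
          nlinarith

end far

section far
variable {d : ℕ} {D : ℝ → Rd d → ℝ} {L : ℝ} {k : ℝ → Rd d → ℂ}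

lemma IsConeDist.measurable_avgMaj (hD : IsConeDist D L) (P : ℝ × Rd d) :
    Measurable fun Q => avgMaj D P Q := by
  have h : Measurable fun Q : ℝ × Rd d => D (P.1 - Q.1) (Q.2 - P.2) :=
    hD.continuous.measurable.comp
      (f := fun Q : ℝ × Rd d => ((P.1 - Q.1, Q.2 - P.2) : ℝ × Rd d)) (by fun_prop)
  have key : ∀ G : ℝ × Rd d → ℝ, Measurable G → Measurable fun Q : ℝ × Rd d =>
      √(1 + |Q.1|) ^ (d - 1) / (√(1 + |Q.1| + |P.1 - Q.1|) ^ (d - 1) *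
        (1 + G Q / (1 + |Q.1|)) ^ (d + 1) * (1 + |Q.1|) ^ (d + 1)) := by
    intro G hG
    fun_prop
  exact key _ h

lemma IsConeDist.lintegral_avgMaj_le (hd : 4 ≤ d) (hD : IsConeDist D L) {P : ℝ × Rd d} {r : ℝ}
    (hr : 1 + |r| ≤ 2 * (1 + |P.1|)) {B : ℝ} (hB : 0 ≤ B) :
    ∫⁻ y, ENNReal.ofReal (avgMaj D P (r, y)) * ENNReal.ofReal (B * (1 + |r|)) ≤
      ENNReal.ofReal (2 ^ (d + 1) * L * 3 ^ (d - 1) * B * √(1 + |P.1|) ^ (d - 1)) *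
        ENNReal.ofReal (1 / √(1 + |r|) ^ (d - 1)) := by
  have hL := hD.one_le
  set v := 1 + |r| with hv
  set s := |P.1 - r| with hs
  have hv1 : 1 ≤ v := by rw [hv]; linarith [abs_nonneg r]
  have hs0 : 0 ≤ s := abs_nonneg _
  have hw1 : 1 ≤ 1 + |P.1| := by linarith [abs_nonneg P.1]
  have hsv : 0 < √v := Real.sqrt_pos.2 (by linarith)
  have hsvs : 0 < √(v + s) := Real.sqrt_pos.2 (by linarith)
  have h0 := hD.lintegral_le (by omega) (P.1 - r) (δ := v) (by linarith)
  rw [← lintegral_sub_right_eq_self _ P.2] at h0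
  have hm : Measurable fun y => ENNReal.ofReal (1 / (1 + D (P.1 - r) (y - P.2) / v) ^ (d + 1)) := by
    have h1 : Measurable fun y => D (P.1 - r) (y - P.2) :=
      (hD.continuous_right (P.1 - r)).measurable.comp (by fun_prop)
    exact ((((h1.div_const v).const_add 1).pow_const (d + 1)).const_div 1).ennreal_ofReal
  have h3 : √(v + s) ≤ 3 * √(1 + |P.1|) := by
    rw [show (3 : ℝ) = √9 by rw [show (9 : ℝ) = 3 ^ 2 by norm_num]; simp,
      ← Real.sqrt_mul (by norm_num)]
    apply Real.sqrt_le_sqrt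
    have := abs_sub P.1 r
    linarith [abs_nonneg P.1]
  calc _ = ∫⁻ y, ENNReal.ofReal (B * v * √v ^ (d - 1) / (√(v + s) ^ (d - 1) * v ^ (d + 1))) *
        ENNReal.ofReal (1 / (1 + D (P.1 - r) (y - P.2) / v) ^ (d + 1)) := by
        refine lintegral_congr fun y => ?_
        have h4 := hD.nonneg (P.1 - r) (y - P.2)
        rw [avgMaj, ← ENNReal.ofReal_mul (by positivity), ← ENNReal.ofReal_mul (by positivity)]
        congr 1
        simp only [← hv, ← hs]
        field_simp
    _ ≤ ENNReal.ofReal (B * v * √v ^ (d - 1) / (√(v + s) ^ (d - 1) * v ^ (d + 1))) *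
        ENNReal.ofReal (2 ^ (d + 1) * L * (v * (v + s) ^ (d - 1))) := by
        rw [lintegral_const_mul _ hm]
        gcongr
    _ ≤ _ := by
        rw [← ENNReal.ofReal_mul (by positivity), ← ENNReal.ofReal_mul (by positivity)]
        apply ENNReal.ofReal_le_ofReal
        have h5 : v ^ (d + 1) = v ^ 2 * (√v ^ (d - 1) * √v ^ (d - 1)) := by
          rw [sqrt_pow_mul_self (by linarith), ← pow_add]
          congr 1; omega
        have h6 : (v + s) ^ (d - 1) = √(v + s) ^ (d - 1) * √(v + s) ^ (d - 1) :=
          (sqrt_pow_mul_self (by linarith) _).symm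
        rw [h5, h6]
        calc _ = 2 ^ (d + 1) * L * B * √(v + s) ^ (d - 1) * (1 / √v ^ (d - 1)) := by
              field_simp
          _ ≤ 2 ^ (d + 1) * L * B * (3 * √(1 + |P.1|)) ^ (d - 1) * (1 / √v ^ (d - 1)) := by
              gcongr
          _ = _ := by rw [mul_pow]; ring

lemma lintegral_one_add_abs_le {n : ℕ} (hn : 3 ≤ n) {ℓ : ℝ} (hℓ : 0 < ℓ) :
    ∫⁻ r in {r : ℝ | ℓ / 2 ≤ 1 + |r|}, ENNReal.ofReal (1 / √(1 + |r|) ^ n) ≤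
      ENNReal.ofReal (64 * 2 ^ n * (ℓ / √ℓ ^ n)) := by
  have hS : MeasurableSet {r : ℝ | ℓ / 2 ≤ 1 + |r|} :=
    measurableSet_le measurable_const (by fun_prop)
  refine (lintegral_inv_sqrt_pow_le volume hS (g := fun r : ℝ => 1 + |r|) (by fun_prop) (ℓ := ℓ / 2)
    (V := ℓ) (by linarith) hℓ.le hn (fun x hx => hx) (fun t ht => ?_)).trans ?_
  · calc _ ≤ volume (Icc (-(t * (ℓ / 2))) (t * (ℓ / 2))) := by
          refine measure_mono fun r hr => ?_
          have h1 : 1 + |r| ≤ t * (ℓ / 2) := hr.2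
          exact abs_le.1 (by linarith)
      _ = ENNReal.ofReal (ℓ * t) := by
          rw [Real.volume_Icc]; congr 1; ring
  · apply ENNReal.ofReal_le_ofReal
    have h1 : √ℓ ≤ 2 * √(ℓ / 2) := by
      rw [show (2 : ℝ) * √(ℓ / 2) = √4 * √(ℓ / 2) by
        rw [show (4 : ℝ) = 2 ^ 2 by norm_num]; simp, ← Real.sqrt_mul (by norm_num)]
      exact Real.sqrt_le_sqrt (by linarith)
    have h2 : 0 < √ℓ := Real.sqrt_pos.2 hℓ
    have h3 : 0 < √(ℓ / 2) := Real.sqrt_pos.2 (by linarith)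
    rw [mul_div_assoc', div_le_div_iff₀ (by positivity) (by positivity)]
    calc 64 * ℓ * √ℓ ^ n ≤ 64 * ℓ * (2 * √(ℓ / 2)) ^ n := by gcongr
      _ = _ := by rw [mul_pow]; ring

lemma IsConeDist.lintegral_thin_away_le (hd : 4 ≤ d) (hD : IsConeDist D L) :
    ∃ C : ℝ, 0 < C ∧ ∀ (Θ ℓ : ℝ), 1 ≤ Θ → 1 ≤ ℓ → ∀ E : Set (ℝ × Rd d), MeasurableSet E →
      IsThin E Θ → (∀ P ∈ E, ℓ ≤ 1 + |P.1|) → ∀ P : ℝ × Rd d,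
      ∫⁻ P' in {P' | P' ∈ E ∧ |P'.1| ≤ |P.1| ∧ (1 + |P.1|) / 40 ≤ dist P' P},
        ENNReal.ofReal (√(1 + |P'.1|) ^ (d - 1) * dispMaj D (P.1 - P'.1) (P'.2 - P.2)) ≤
      ENNReal.ofReal (C * (Θ * ℓ / √ℓ ^ (d - 1) * √(1 + |P.1|) ^ (d - 1))) := by
  have hL := hD.one_le
  obtain ⟨c, hc, hvol⟩ := exists_volume_closedBall_prod d
  obtain ⟨C2, hC2, hthin⟩ := IsThin.volume_le (d := d)
  set C0 : ℝ := 20 ^ (d - 1) * (8 * L) ^ (d + 1) with hC0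
  have hC0p : 0 < C0 := by positivity
  set C3 : ℝ := 2 ^ (d + 1) * L * 3 ^ (d - 1) with hC3
  have hC3p : 0 < C3 := by positivity
  refine ⟨200 ^ (d + 1) / c * C0 * (C3 * C2 * (64 * 2 ^ (d - 1))), by positivity,
    fun Θ ℓ hΘ hℓ E hE hg hEℓ P => ?_⟩
  set S := {P' | P' ∈ E ∧ |P'.1| ≤ |P.1| ∧ (1 + |P.1|) / 40 ≤ dist P' P} with hS
  have hgm : Measurable fun P' : ℝ × Rd d => dist P' P := by fun_prop
  have hSm : MeasurableSet S := by
    refine hE.inter (MeasurableSet.inter ?_ ?_)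
    · exact measurableSet_le (measurable_norm.comp measurable_fst) measurable_const
    · exact measurableSet_le measurable_const hgm
  set N : Set ((ℝ × Rd d) × (ℝ × Rd d)) := {z | dist z.1 z.2 ≤ (1 + |z.1.1|) / 200} with hN
  have hNm : MeasurableSet N := by
    refine (isClosed_le ?_ ?_).measurableSet <;> fun_prop
  have hma := hD.measurable_avgMaj P
  set F : (ℝ × Rd d) → (ℝ × Rd d) → ℝ≥0∞ := fun P' Q =>
    N.indicator (fun z => ENNReal.ofReal (avgMaj D P z.2)) (P', Q) with hF
  have hFm : Measurable (Function.uncurry F) :=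
    Measurable.indicator (hma.comp measurable_snd).ennreal_ofReal hNm
  have hFm1 : ∀ P', Measurable (F P') := fun P' => hFm.comp measurable_prodMk_left
  have havg0 : ∀ Q, 0 ≤ avgMaj D P Q := fun Q => by
    have := hD.nonneg (P.1 - Q.1) (Q.2 - P.2)
    unfold avgMaj; positivity
  have step1 : ∀ P' ∈ S, ENNReal.ofReal
      (√(1 + |P'.1|) ^ (d - 1) * dispMaj D (P.1 - P'.1) (P'.2 - P.2)) ≤
      ENNReal.ofReal (200 ^ (d + 1) / c * C0) * ∫⁻ Q, F P' Q := by
    intro P' hP'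
    have hw : 0 < 1 + |P'.1| := by positivity
    set X := √(1 + |P'.1|) ^ (d - 1) * dispMaj D (P.1 - P'.1) (P'.2 - P.2) with hX
    have hX0 : 0 ≤ X := mul_nonneg (by positivity) (hD.dispMaj_nonneg _ _)
    have h1 : ∫⁻ Q in Metric.closedBall P' ((1 + |P'.1|) / 200),
        ENNReal.ofReal (X / (1 + |P'.1|) ^ (d + 1)) ≤ ENNReal.ofReal C0 * ∫⁻ Q, F P' Q := by
      rw [← lintegral_const_mul _ (hFm1 P'), ← lintegral_indicator Metric.isClosed_closedBall.measurableSet]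
      refine lintegral_mono fun Q => ?_
      by_cases hQ : Q ∈ Metric.closedBall P' ((1 + |P'.1|) / 200)
      · rw [indicator_of_mem hQ]
        have hQ' : (P', Q) ∈ N := by
          rw [Metric.mem_closedBall, dist_comm] at hQ; exact hQ
        simp only [hF]
        rw [indicator_of_mem hQ', ← ENNReal.ofReal_mul hC0p.le]
        exact ENNReal.ofReal_le_ofReal (hD.dispMaj_le_avgMaj hP'.2.1 hP'.2.2 hQ')
      · rw [indicator_of_notMem hQ]; exact zero_le
    rw [setLIntegral_const, hvol _ _ (by positivity), ← ENNReal.ofReal_mul (by positivity)] at h1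
    have h2 : X = 200 ^ (d + 1) / c *
        (X / (1 + |P'.1|) ^ (d + 1) * (c * ((1 + |P'.1|) / 200) ^ (d + 1))) := by
      rw [div_pow]; field_simp
    rw [h2, ENNReal.ofReal_mul (by positivity), ENNReal.ofReal_mul (p := 200 ^ (d + 1) / c)
      (by positivity), mul_assoc]
    gcongr
  set T : Set ℝ := {r | ℓ / 2 ≤ 1 + |r| ∧ 1 + |r| ≤ 2 * (1 + |P.1|)} with hT
  have hTm : MeasurableSet T :=
    (measurableSet_le (g := fun r : ℝ => 1 + |r|) measurable_const (by fun_prop)).inter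
      (measurableSet_le (f := fun r : ℝ => 1 + |r|) (by fun_prop) measurable_const)
  have step3 : ∀ Q, ∫⁻ P' in S, F P' Q ≤ T.indicator (fun r => ENNReal.ofReal (avgMaj D P (r, Q.2)) *
      ENNReal.ofReal (C2 * Θ * (1 + |r|))) Q.1 := by
    intro Q
    by_cases hQ : Q.1 ∈ T
    · rw [indicator_of_mem hQ]
      calc _ ≤ ∫⁻ P' in {P' | P' ∈ E ∧ dist P' Q ≤ (1 + |P'.1|) / 200},
            ENNReal.ofReal (avgMaj D P Q) := by
            have hm2 : MeasurableSet {P' | P' ∈ E ∧ dist P' Q ≤ (1 + |P'.1|) / 200} := by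
              have h0 : IsClosed {P' : ℝ × Rd d | dist P' Q ≤ (1 + |P'.1|) / 200} :=
                isClosed_le (by fun_prop) (by fun_prop)
              exact hE.inter h0.measurableSet
            rw [← lintegral_indicator hSm, ← lintegral_indicator hm2]
            refine lintegral_mono fun P' => ?_
            by_cases h1 : P' ∈ S
            · by_cases h2 : (P', Q) ∈ N
              · have h3 : P' ∈ {P' | P' ∈ E ∧ dist P' Q ≤ (1 + |P'.1|) / 200} := ⟨h1.1, h2⟩
                rw [indicator_of_mem h1, indicator_of_mem h3]
                simp only [hF]
                rw [indicator_of_mem h2]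
              · rw [indicator_of_mem h1]
                simp only [hF]
                rw [indicator_of_notMem h2]; exact zero_le
            · rw [indicator_of_notMem h1]; exact zero_le
        _ ≤ _ := by
            rw [setLIntegral_const]
            gcongr
            rw [mul_assoc]
            exact hthin E Θ hΘ hg Q
    · rw [indicator_of_notMem hQ, nonpos_iff_eq_zero]
      refine (setLIntegral_congr_fun hSm fun P' hP' => ?_).trans lintegral_zero
      simp only [hF]
      rw [indicator_of_notMem]
      intro h
      obtain ⟨a1, a2⟩ := weight_comparable (P' := P') (Q := Q) h
      apply hQ
      have b1 := hEℓ P' hP'.1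
      have b2 := hP'.2.1
      exact ⟨by linarith, by linarith⟩
  calc _ ≤ ∫⁻ P' in S, ENNReal.ofReal (200 ^ (d + 1) / c * C0) * ∫⁻ Q, F P' Q :=
        setLIntegral_mono' hSm step1
    _ = ENNReal.ofReal (200 ^ (d + 1) / c * C0) * ∫⁻ Q, ∫⁻ P' in S, F P' Q := by
        have hm7 : Measurable fun P' => ∫⁻ Q, F P' Q := hFm.lintegral_prod_right'
        rw [lintegral_const_mul _ hm7, lintegral_lintegral_swap hFm.aemeasurable]
    _ ≤ ENNReal.ofReal (200 ^ (d + 1) / c * C0) * ∫⁻ Q : ℝ × Rd d,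
          T.indicator (fun r => ENNReal.ofReal (avgMaj D P (r, Q.2)) *
            ENNReal.ofReal (C2 * Θ * (1 + |r|))) Q.1 := by
        gcongr with Q
        exact step3 Q
    _ ≤ ENNReal.ofReal (200 ^ (d + 1) / c * C0) * ∫⁻ r, T.indicator (fun r =>
          ENNReal.ofReal (C3 * (C2 * Θ) * √(1 + |P.1|) ^ (d - 1)) *
            ENNReal.ofReal (1 / √(1 + |r|) ^ (d - 1))) r := by
        gcongr
        rw [Measure.volume_eq_prod]
        have hm5 : Measurable fun Q : ℝ × Rd d => T.indicator (fun r =>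
            ENNReal.ofReal (avgMaj D P (r, Q.2)) * ENNReal.ofReal (C2 * Θ * (1 + |r|))) Q.1 := by
          have : (fun Q : ℝ × Rd d => T.indicator (fun r =>
            ENNReal.ofReal (avgMaj D P (r, Q.2)) * ENNReal.ofReal (C2 * Θ * (1 + |r|))) Q.1) =
            (Prod.fst ⁻¹' T).indicator (fun Q : ℝ × Rd d =>
            ENNReal.ofReal (avgMaj D P Q) * ENNReal.ofReal (C2 * Θ * (1 + |Q.1|))) := by
            ext Q; simp only [indicator, mem_preimage]
          rw [this]
          refine Measurable.indicator ?_ (measurable_fst hTm)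
          fun_prop
        rw [lintegral_prod _ hm5.aemeasurable]
        refine lintegral_mono fun r => ?_
        by_cases hr : r ∈ T
        · simp only [indicator_of_mem hr]
          exact hD.lintegral_avgMaj_le hd hr.2 (by positivity)
        · simp only [indicator_of_notMem hr, lintegral_zero]; exact le_rfl
    _ ≤ ENNReal.ofReal (200 ^ (d + 1) / c * C0) *
          (ENNReal.ofReal (C3 * (C2 * Θ) * √(1 + |P.1|) ^ (d - 1)) *
            ENNReal.ofReal (64 * 2 ^ (d - 1) * (ℓ / √ℓ ^ (d - 1)))) := by
        have hm6 : Measurable fun r : ℝ => ENNReal.ofReal (1 / √(1 + |r|) ^ (d - 1)) := by fun_prop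
        rw [lintegral_indicator hTm, lintegral_const_mul _ hm6]
        gcongr
        refine (lintegral_mono_set fun r hr => ?_).trans
          (lintegral_one_add_abs_le (by omega) (by linarith))
        exact hr.1
    _ = _ := by
        rw [← ENNReal.ofReal_mul (by positivity), ← ENNReal.ofReal_mul (by positivity)]
        congr 1; ring

end far

section far
variable {d : ℕ} {D : ℝ → Rd d → ℝ} {L : ℝ} {k : ℝ → Rd d → ℂ}

lemma IsConeDist.lintegral_thin_le (hd : 4 ≤ d) (hD : IsConeDist D L) :
    ∃ C : ℝ, 0 < C ∧ ∀ (Θ ℓ : ℝ), 1 ≤ Θ → 1 ≤ ℓ → ∀ E : Set (ℝ × Rd d), MeasurableSet E →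
      IsThin E Θ → (∀ P ∈ E, ℓ ≤ 1 + |P.1|) → ∀ P ∈ E,
      ∫⁻ P' in {P' | P' ∈ E ∧ |P'.1| ≤ |P.1| ∧ ℓ < |P.1 - P'.1|},
        ENNReal.ofReal (√(1 + |P'.1|) ^ (d - 1) * dispMaj D (P.1 - P'.1) (P'.2 - P.2)) ≤
      ENNReal.ofReal (C * (Θ * ℓ / √ℓ ^ (d - 1) * √(1 + |P.1|) ^ (d - 1))) := by
  obtain ⟨C, hC, h⟩ := hD.lintegral_thin_away_le hd
  refine ⟨64 + C, by positivity, fun Θ ℓ hΘ hℓ E hE hg hEℓ P hP => ?_⟩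
  refine (lintegral_mono_set (t := {P' | P' ∈ E ∧ |P'.1| ≤ |P.1| ∧ ℓ < dist P' P ∧
      dist P' P < (1 + |P.1|) / 40} ∪
    {P' | P' ∈ E ∧ |P'.1| ≤ |P.1| ∧ (1 + |P.1|) / 40 ≤ dist P' P}) ?_).trans ?_
  · rintro P' ⟨h1, h2, h3⟩
    rcases lt_or_ge (dist P' P) ((1 + |P.1|) / 40) with h4 | h4
    · exact Or.inl ⟨h1, h2, h3.trans_le (by rw [dist_prod_eq]; exact le_max_left _ _), h4⟩
    · exact Or.inr ⟨h1, h2, h4⟩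
  · refine (lintegral_union_le _ _ _).trans ?_
    rw [add_mul, ENNReal.ofReal_add (by positivity) (by positivity)]
    exact add_le_add (hg.lintegral_near_le hd hD hE hΘ hℓ hP) (h Θ ℓ hΘ hℓ E hE hg hEℓ P)

lemma IsDispKer.lintegral_thin_far_le (hd : 4 ≤ d) (hD : IsConeDist D L) (hk : IsDispKer D k) :
    ∃ C : ℝ, 0 < C ∧ ∀ (Θ ℓ : ℝ), 1 ≤ Θ → 1 ≤ ℓ → ∀ E : Set (ℝ × Rd d), MeasurableSet E →
      IsThin E Θ → (∀ P ∈ E, ℓ ≤ 1 + |P.1|) → ∀ f : ℝ × Rd d → ℂ,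
      (∀ P, ‖f P‖ₑ ≤ E.indicator (fun P => ENNReal.ofReal (√(1 + |P.1|) ^ (d - 1))) P) →
      ∫⁻ z in {z : (ℝ × Rd d) × (ℝ × Rd d) | ℓ < |z.1.1 - z.2.1|},
        ‖f z.1‖ₑ * ‖f z.2‖ₑ * ‖k (z.1.1 - z.2.1) (z.2.2 - z.1.2)‖ₑ ≤
      ENNReal.ofReal (C * (Θ * ℓ / √ℓ ^ (d - 1))) * shellMass E := by
  obtain ⟨C1, hC1, h1⟩ := hD.lintegral_thin_le hd
  obtain ⟨C2, hC2, h2⟩ := hk.le_dispMaj hD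
  refine ⟨C2 * (2 * C1), by positivity, fun Θ ℓ hΘ hℓ E hE hg hEℓ f hf => ?_⟩
  set U : Set ((ℝ × Rd d) × (ℝ × Rd d)) :=
    {z | z.1 ∈ E ∧ z.2 ∈ E ∧ |z.2.1| ≤ |z.1.1| ∧ ℓ < |z.1.1 - z.2.1|} with hU
  have hUm : MeasurableSet U := by
    refine (measurable_fst hE).inter ((measurable_snd hE).inter (MeasurableSet.inter ?_ ?_))
    · exact (isClosed_le (f := fun z : (ℝ × Rd d) × (ℝ × Rd d) => |z.2.1|)
        (g := fun z => |z.1.1|) (by fun_prop) (by fun_prop)).measurableSet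
    · exact (isOpen_lt (f := fun _ : (ℝ × Rd d) × (ℝ × Rd d) => ℓ)
        (g := fun z => |z.1.1 - z.2.1|) (by fun_prop) (by fun_prop)).measurableSet
  set g : (ℝ × Rd d) × (ℝ × Rd d) → ℝ≥0∞ := fun z =>
    ENNReal.ofReal (√(1 + |z.1.1|) ^ (d - 1)) * ENNReal.ofReal (√(1 + |z.2.1|) ^ (d - 1) *
      dispMaj D (z.1.1 - z.2.1) (z.2.2 - z.1.2)) with hgdef
  have hgm : Measurable g := by
    have h3 : Measurable fun z : (ℝ × Rd d) × (ℝ × Rd d) =>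
        dispMaj D (z.1.1 - z.2.1) (z.2.2 - z.1.2) := hD.measurable_dispMaj.comp
      (f := fun z : (ℝ × Rd d) × (ℝ × Rd d) => ((z.1.1 - z.2.1, z.2.2 - z.1.2) : ℝ × Rd d))
      (by fun_prop)
    have h4 : Measurable fun z : (ℝ × Rd d) × (ℝ × Rd d) => √(1 + |z.2.1|) ^ (d - 1) := by fun_prop
    have h5 : Measurable fun z : (ℝ × Rd d) × (ℝ × Rd d) =>
      ENNReal.ofReal (√(1 + |z.1.1|) ^ (d - 1)) := by fun_prop
    exact h5.mul (h4.mul h3).ennreal_ofReal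
  have hgs : ∀ z, g z.swap = g z := by
    rintro ⟨P, P'⟩
    simp only [hgdef, Prod.swap]
    rw [← dispMaj_neg hD, neg_sub, neg_sub, ← ENNReal.ofReal_mul (by positivity),
      ← ENNReal.ofReal_mul (by positivity)]
    congr 1; ring
  have hUg : Measurable (U.indicator g) := hgm.indicator hUm
  have step : ∫⁻ z, U.indicator g z ≤
      ENNReal.ofReal (C1 * (Θ * ℓ / √ℓ ^ (d - 1))) * shellMass E := by
    rw [Measure.volume_eq_prod, lintegral_prod _ hUg.aemeasurable]
    have hm8 : Measurable fun P : ℝ × Rd d => ENNReal.ofReal ((1 + |P.1|) ^ (d - 1)) := by fun_prop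
    rw [shellMass, ← lintegral_const_mul _ hm8, ← lintegral_indicator hE]
    refine lintegral_mono fun P => ?_
    by_cases hP : P ∈ E
    · rw [indicator_of_mem hP]
      have hSm : MeasurableSet {P' : ℝ × Rd d | P' ∈ E ∧ |P'.1| ≤ |P.1| ∧ ℓ < |P.1 - P'.1|} := by
        refine hE.inter (MeasurableSet.inter ?_ ?_)
        · exact measurableSet_le (measurable_norm.comp measurable_fst) measurable_const
        · exact measurableSet_lt measurable_const
            (measurable_norm.comp (measurable_fst.const_sub P.1))
      have hm9 : Measurable fun P' : ℝ × Rd d => ENNReal.ofReal (√(1 + |P'.1|) ^ (d - 1) *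
          dispMaj D (P.1 - P'.1) (P'.2 - P.2)) := by
        have h3 : Measurable fun z : ℝ × Rd d =>
          dispMaj D (P.1 - z.1) (z.2 - P.2) := hD.measurable_dispMaj.comp
            (f := fun z : ℝ × Rd d => ((P.1 - z.1, z.2 - P.2) : ℝ × Rd d)) (by fun_prop)
        have h4 : Measurable fun z : ℝ × Rd d => √(1 + |z.1|) ^ (d - 1) := by fun_prop
        exact (h4.mul h3).ennreal_ofReal
      calc ∫⁻ P', U.indicator g (P, P') = ENNReal.ofReal (√(1 + |P.1|) ^ (d - 1)) *
            ∫⁻ P' in {P' | P' ∈ E ∧ |P'.1| ≤ |P.1| ∧ ℓ < |P.1 - P'.1|},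
              ENNReal.ofReal (√(1 + |P'.1|) ^ (d - 1) *
                dispMaj D (P.1 - P'.1) (P'.2 - P.2)) := by
            rw [← lintegral_const_mul _ hm9, ← lintegral_indicator hSm]
            refine lintegral_congr fun P' => ?_
            by_cases hP' : (P, P') ∈ U
            · have : P' ∈ {P' : ℝ × Rd d | P' ∈ E ∧ |P'.1| ≤ |P.1| ∧ ℓ < |P.1 - P'.1|} := hP'.2
              rw [indicator_of_mem hP', indicator_of_mem this]
            · have : P' ∉ {P' : ℝ × Rd d | P' ∈ E ∧ |P'.1| ≤ |P.1| ∧ ℓ < |P.1 - P'.1|} :=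
                fun h => hP' ⟨hP, h⟩
              rw [indicator_of_notMem hP', indicator_of_notMem this]
        _ ≤ ENNReal.ofReal (√(1 + |P.1|) ^ (d - 1)) *
              ENNReal.ofReal (C1 * (Θ * ℓ / √ℓ ^ (d - 1) * √(1 + |P.1|) ^ (d - 1))) := by
            gcongr
            exact h1 Θ ℓ hΘ hℓ E hE hg hEℓ P hP
        _ = _ := by
            rw [← sqrt_pow_mul_self (by positivity : 0 ≤ 1 + |P.1|) (d - 1),
              ← ENNReal.ofReal_mul (by positivity), ← ENNReal.ofReal_mul (by positivity)]
            congr 1; ring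
    · rw [indicator_of_notMem hP, nonpos_iff_eq_zero]
      refine (lintegral_congr fun P' => ?_).trans lintegral_zero
      rw [indicator_of_notMem]
      exact fun h => hP h.1
  have hswap : ∫⁻ z : (ℝ × Rd d) × (ℝ × Rd d), U.indicator g z.swap = ∫⁻ z, U.indicator g z := by
    rw [Measure.volume_eq_prod]
    exact (Measure.measurePreserving_swap (μ := (volume : Measure (ℝ × Rd d)))
      (ν := (volume : Measure (ℝ × Rd d)))).lintegral_comp hUg
  have hZm : MeasurableSet {z : (ℝ × Rd d) × (ℝ × Rd d) | ℓ < |z.1.1 - z.2.1|} :=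
    (isOpen_lt (by fun_prop) (by fun_prop)).measurableSet
  calc _ ≤ ∫⁻ z, ENNReal.ofReal C2 * (U.indicator g z + U.indicator g z.swap) := by
        rw [← lintegral_indicator hZm]
        refine lintegral_mono fun z => ?_
        by_cases hz : z ∈ {z : (ℝ × Rd d) × (ℝ × Rd d) | ℓ < |z.1.1 - z.2.1|}
        swap
        · rw [indicator_of_notMem hz]; exact zero_le
        rw [indicator_of_mem hz]
        by_cases hz1 : z.1 ∈ E
        swap
        · have := hf z.1
          rw [indicator_of_notMem hz1, nonpos_iff_eq_zero] at this
          rw [this]; simp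
        by_cases hz2 : z.2 ∈ E
        swap
        · have := hf z.2
          rw [indicator_of_notMem hz2, nonpos_iff_eq_zero] at this
          rw [this]; simp
        have b1 := hf z.1
        have b2 := hf z.2
        rw [indicator_of_mem hz1] at b1
        rw [indicator_of_mem hz2] at b2
        have b3 : ‖k (z.1.1 - z.2.1) (z.2.2 - z.1.2)‖ₑ ≤
            ENNReal.ofReal (C2 * dispMaj D (z.1.1 - z.2.1) (z.2.2 - z.1.2)) := by
          rw [← ofReal_norm]
          exact ENNReal.ofReal_le_ofReal (h2 _ _)
        have b4 : g z ≤ U.indicator g z + U.indicator g z.swap := by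
          rcases le_total |z.2.1| |z.1.1| with h | h
          · have : z ∈ U := ⟨hz1, hz2, h, hz⟩
            rw [indicator_of_mem this]; exact le_self_add
          · have : z.swap ∈ U := ⟨hz2, hz1, h, by
              have : ℓ < |z.1.1 - z.2.1| := hz
              rw [abs_sub_comm] at this; exact this⟩
            rw [indicator_of_mem this, hgs]; exact le_add_self
        have hd0 := hD.dispMaj_nonneg (z.1.1 - z.2.1) (z.2.2 - z.1.2)
        calc _ ≤ ENNReal.ofReal (√(1 + |z.1.1|) ^ (d - 1)) *
              ENNReal.ofReal (√(1 + |z.2.1|) ^ (d - 1)) *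
              ENNReal.ofReal (C2 * dispMaj D (z.1.1 - z.2.1) (z.2.2 - z.1.2)) := by gcongr
          _ = ENNReal.ofReal C2 * g z := by
              simp only [hgdef]
              rw [ENNReal.ofReal_mul hC2.le, ENNReal.ofReal_mul (p := √(1 + |z.2.1|) ^ (d - 1))
                (by positivity)]
              ring
          _ ≤ _ := by gcongr
    _ = ENNReal.ofReal C2 * ((∫⁻ z, U.indicator g z) +
        ∫⁻ z : (ℝ × Rd d) × (ℝ × Rd d), U.indicator g z.swap) := by
        have hm10 : Measurable fun z : (ℝ × Rd d) × (ℝ × Rd d) =>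
          U.indicator g z + U.indicator g z.swap := hUg.add (hUg.comp measurable_swap)
        rw [lintegral_const_mul _ hm10, lintegral_add_left hUg]
    _ ≤ ENNReal.ofReal C2 * (ENNReal.ofReal (C1 * (Θ * ℓ / √ℓ ^ (d - 1))) * shellMass E +
          ENNReal.ofReal (C1 * (Θ * ℓ / √ℓ ^ (d - 1))) * shellMass E) := by
        rw [hswap]; gcongr
    _ = _ := by
        rw [← two_mul, show C2 * (2 * C1) * (Θ * ℓ / √ℓ ^ (d - 1)) =
          C2 * (2 * (C1 * (Θ * ℓ / √ℓ ^ (d - 1)))) by ring, ENNReal.ofReal_mul hC2.le,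
          ENNReal.ofReal_mul (by norm_num : (0 : ℝ) ≤ 2), ENNReal.ofReal_ofNat]
        ring

end far

section weak
variable {d : ℕ} {D : ℝ → Rd d → ℝ} {L : ℝ} {k k' : ℝ → Rd d → ℂ}

/-- The superposition of the kernels `k r (· - y)` with coefficients `f (r, y)`. -/
def superpos (k : ℝ → Rd d → ℂ) (f : ℝ × Rd d → ℂ) (x : Rd d) : ℂ :=
  ∫ P : ℝ × Rd d, k P.1 (x - P.2) * f P

/-- `f` is supported in `A` and bounded by `(1+|r|)^{(d-1)/2}`. -/
def IsBddOn (A : Set (ℝ × Rd d)) (f : ℝ × Rd d → ℂ) : Prop :=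
  ∀ P, ‖f P‖ₑ ≤ A.indicator (fun P => ENNReal.ofReal (√(1 + |P.1|) ^ (d - 1))) P

lemma IsBddOn.indicator {A B : Set (ℝ × Rd d)} {f : ℝ × Rd d → ℂ} (hf : IsBddOn A f) :
    IsBddOn (A ∩ B) (B.indicator f) := by
  intro P
  by_cases hP : P ∈ B
  · rw [indicator_of_mem hP, inter_comm, ← indicator_indicator, indicator_of_mem hP]
    exact hf P
  · rw [indicator_of_notMem hP]; simp

lemma IsDispKer.measurable_integrand (hk : IsDispKer D k) {f : ℝ × Rd d → ℂ} (hf : Measurable f) :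
    Measurable (Function.uncurry fun (x : Rd d) (P : ℝ × Rd d) => k P.1 (x - P.2) * f P) := by
  have h1 : Measurable fun q : Rd d × (ℝ × Rd d) => k q.2.1 (q.1 - q.2.2) :=
    hk.measurable.comp (f := fun q : Rd d × (ℝ × Rd d) => ((q.2.1, q.1 - q.2.2) : ℝ × Rd d))
      (by fun_prop)
  exact h1.mul (hf.comp measurable_snd)

lemma IsDispKer.measurable_superpos (hk : IsDispKer D k) {f : ℝ × Rd d → ℂ} (hf : Measurable f) :
    Measurable (superpos k f) :=
  (StronglyMeasurable.integral_prod_right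
    (hk.measurable_integrand hf).stronglyMeasurable).measurable

lemma IsBddOn.lintegral_le {A : Set (ℝ × Rd d)} (hA : MeasurableSet A) {f : ℝ × Rd d → ℂ}
    (hf : IsBddOn A f) :
    ∫⁻ P, ENNReal.ofReal (√(1 + |P.1|) ^ (d - 1)) * ‖f P‖ₑ ≤ shellMass A := by
  rw [shellMass, ← lintegral_indicator hA]
  refine lintegral_mono fun P => ?_
  have h := hf P
  by_cases hP : P ∈ A
  · rw [indicator_of_mem hP] at h ⊢
    rw [← sqrt_pow_mul_self (by positivity : 0 ≤ 1 + |P.1|), ENNReal.ofReal_mul (by positivity)]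
    gcongr
  · rw [indicator_of_notMem hP, nonpos_iff_eq_zero] at h
    rw [h]; simp

lemma IsBddOn.lintegral_sq_le {A : Set (ℝ × Rd d)} (hA : MeasurableSet A) {f : ℝ × Rd d → ℂ}
    (hf : IsBddOn A f) : ∫⁻ P, ‖f P‖ₑ ^ 2 ≤ shellMass A := by
  refine le_trans (lintegral_mono fun P => ?_) (hf.lintegral_le hA)
  have h := hf P
  rw [sq]
  gcongr
  by_cases hP : P ∈ A
  · rwa [indicator_of_mem hP] at h
  · rw [indicator_of_notMem hP] at h; exact h.trans zero_le

/-- The `L¹` bound. -/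
lemma IsDispKer.lintegral_superpos_le (hd : 1 ≤ d) (hD : IsConeDist D L) (hk : IsDispKer D k) :
    ∃ C : ℝ, 0 < C ∧ ∀ f : ℝ × Rd d → ℂ, Measurable f →
      ∫⁻ x, ∫⁻ P : ℝ × Rd d, ‖k P.1 (x - P.2) * f P‖ₑ ≤
        ENNReal.ofReal C * ∫⁻ P, ENNReal.ofReal (√(1 + |P.1|) ^ (d - 1)) * ‖f P‖ₑ := by
  obtain ⟨C, hC, h⟩ := hk.lintegral_superposition_le hd hD
  exact ⟨C, hC, fun f hf => h volume id measurable_id f hf⟩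

lemma IsDispKer.ae_integrable (hd : 1 ≤ d) (hD : IsConeDist D L) (hk : IsDispKer D k)
    {f : ℝ × Rd d → ℂ} (hf : Measurable f)
    (hfin : ∫⁻ P, ENNReal.ofReal (√(1 + |P.1|) ^ (d - 1)) * ‖f P‖ₑ < ∞) :
    ∀ᵐ x, Integrable fun P : ℝ × Rd d => k P.1 (x - P.2) * f P := by
  obtain ⟨C, hC, h⟩ := hk.lintegral_superpos_le hd hD
  have hm := hk.measurable_integrand hf
  have hm1 : Measurable fun x => ∫⁻ P : ℝ × Rd d, ‖k P.1 (x - P.2) * f P‖ₑ :=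
    hm.enorm.lintegral_prod_right'
  have h2 := ae_lt_top hm1 ((h f hf).trans_lt (ENNReal.mul_lt_top ENNReal.ofReal_lt_top hfin)).ne
  filter_upwards [h2] with x hx
  have hmx : Measurable fun P : ℝ × Rd d => k P.1 (x - P.2) * f P :=
    hm.comp measurable_prodMk_left
  exact ⟨hmx.aestronglyMeasurable, hx⟩

lemma superpos_indicator_add {x : Rd d} {f : ℝ × Rd d → ℂ} (B : Set (ℝ × Rd d))
    (hB : MeasurableSet B) (hx : Integrable fun P : ℝ × Rd d => k P.1 (x - P.2) * f P) :
    superpos k f x = superpos k (B.indicator f) x + superpos k (Bᶜ.indicator f) x := by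
  have e : ∀ S : Set (ℝ × Rd d), superpos k (S.indicator f) x =
      ∫ P : ℝ × Rd d, S.indicator (fun P => k P.1 (x - P.2) * f P) P := by
    intro S
    refine integral_congr_ae (Filter.Eventually.of_forall fun P => ?_)
    by_cases hP : P ∈ S
    · simp only [indicator_of_mem hP]
    · simp only [indicator_of_notMem hP, mul_zero]
  rw [e, e, integral_indicator hB, integral_indicator hB.compl, integral_add_compl hB hx]
  rfl

lemma IsDispKer.lintegral_superpos_sq_le (hd : 4 ≤ d) (hD : IsConeDist D L) (hk : IsDispKer D k)
    (hk' : IsDispKer D k')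
    (hkk : ∀ r r' y y', ∫ x, k r (x - y) * starRingEnd ℂ (k r' (x - y')) =
      k' (r - r') (y' - y)) :
    ∃ C : ℝ, 0 < C ∧ ∀ (Θ ℓ : ℝ), 1 ≤ Θ → 1 ≤ ℓ → ∀ E : Set (ℝ × Rd d), MeasurableSet E →
      IsThin E Θ → shellMass E < ∞ → ∀ f : ℝ × Rd d → ℂ, Measurable f → IsBddOn E f →
      ∫⁻ x, ‖superpos k f x‖ₑ ^ 2 ≤
        ENNReal.ofReal (C * (ℓ + Θ * ℓ / √ℓ ^ (d - 1))) * shellMass E := by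
  obtain ⟨C1, hC1, h1⟩ := hk.lintegral_sq_le (by omega) hD hk' hkk
  obtain ⟨C2, hC2, h2⟩ := hk'.lintegral_thin_far_le hd hD
  refine ⟨2 * (C1 * 3) + 2 * C2, by positivity, fun Θ ℓ hΘ hℓ E hE hg hfin f hf hfE => ?_⟩
  set B : Set (ℝ × Rd d) := {P | ℓ ≤ 1 + |P.1|} with hB
  have hBm : MeasurableSet B :=
    (isClosed_le (f := fun _ : ℝ × Rd d => ℓ) (by fun_prop) (by fun_prop)).measurableSet
  have hmono : ∀ S : Set (ℝ × Rd d), shellMass (E ∩ S) ≤ shellMass E := fun S =>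
    lintegral_mono_set inter_subset_left
  have hB1 := hfE.indicator (B := B)
  have hB2 := hfE.indicator (B := Bᶜ)
  have hm1 : Measurable (B.indicator f) := hf.indicator hBm
  have hm2 : Measurable (Bᶜ.indicator f) := hf.indicator hBm.compl
  have w1 := hB1.lintegral_le (hE.inter hBm)
  have w2 := hB2.lintegral_le (hE.inter hBm.compl)
  have a1 : ∫⁻ x, ‖superpos k (B.indicator f) x‖ₑ ^ 2 ≤
      ENNReal.ofReal (C1 * ℓ + C2 * (Θ * ℓ / √ℓ ^ (d - 1))) * shellMass E := by
    refine (h1 ℓ (by linarith) _ hm1 ((w1.trans (hmono _)).trans_lt hfin)).trans ?_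
    rw [ENNReal.ofReal_add (by positivity) (by positivity), add_mul]
    refine add_le_add ?_ ?_
    · gcongr
      exact (hB1.lintegral_sq_le (hE.inter hBm)).trans (hmono _)
    · refine (h2 Θ ℓ hΘ hℓ (E ∩ B) (hE.inter hBm) (fun P hP t ht htP => ?_) (fun P hP => hP.2) _
        hB1).trans ?_
      · exact (measure_mono (inter_subset_inter_left _ inter_subset_left)).trans
          (hg P hP.1 t ht htP)
      · gcongr
        exact hmono _
  have a2 : ∫⁻ x, ‖superpos k (Bᶜ.indicator f) x‖ₑ ^ 2 ≤
      ENNReal.ofReal (C1 * (2 * ℓ)) * shellMass E := by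
    refine (h1 (2 * ℓ) (by linarith) _ hm2 ((w2.trans (hmono _)).trans_lt hfin)).trans ?_
    have hz : ∫⁻ z in {z : (ℝ × Rd d) × (ℝ × Rd d) | 2 * ℓ < |z.1.1 - z.2.1|},
          ‖Bᶜ.indicator f z.1‖ₑ * ‖Bᶜ.indicator f z.2‖ₑ * ‖k' (z.1.1 - z.2.1) (z.2.2 - z.1.2)‖ₑ
          = 0 := by
      have hZm : MeasurableSet {z : (ℝ × Rd d) × (ℝ × Rd d) | 2 * ℓ < |z.1.1 - z.2.1|} :=
        (isOpen_lt (by fun_prop) (by fun_prop)).measurableSet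
      refine (setLIntegral_congr_fun hZm fun z hz => ?_).trans lintegral_zero
      by_cases q1 : z.1 ∈ Bᶜ
      · by_cases q2 : z.2 ∈ Bᶜ
        · exfalso
          have r1 : ¬ ℓ ≤ 1 + |z.1.1| := q1
          have r2 : ¬ ℓ ≤ 1 + |z.2.1| := q2
          have r3 : 2 * ℓ < |z.1.1 - z.2.1| := hz
          have := abs_sub z.1.1 z.2.1
          linarith
        · simp only [indicator_of_notMem q2]; simp
      · simp only [indicator_of_notMem q1]; simp
    rw [hz, add_zero]
    gcongr
    exact (hB2.lintegral_sq_le (hE.inter hBm.compl)).trans (hmono _)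
  have hs1 := (hk.measurable_superpos hm1).enorm.pow_const 2
  have hs2 := (hk.measurable_superpos hm2).enorm.pow_const 2
  calc _ ≤ ∫⁻ x, 2 * ‖superpos k (B.indicator f) x‖ₑ ^ 2 +
        2 * ‖superpos k (Bᶜ.indicator f) x‖ₑ ^ 2 := by
        refine lintegral_mono_ae ?_
        filter_upwards [hk.ae_integrable (by omega) hD hf ((hfE.lintegral_le hE).trans_lt hfin)]
          with x hx
        rw [superpos_indicator_add B hBm hx]
        have hn : ‖superpos k (B.indicator f) x + superpos k (Bᶜ.indicator f) x‖ ^ 2 ≤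
            2 * ‖superpos k (B.indicator f) x‖ ^ 2 + 2 * ‖superpos k (Bᶜ.indicator f) x‖ ^ 2 := by
          have := norm_add_le (superpos k (B.indicator f) x) (superpos k (Bᶜ.indicator f) x)
          have h0 := norm_nonneg (superpos k (B.indicator f) x + superpos k (Bᶜ.indicator f) x)
          nlinarith [sq_nonneg (‖superpos k (B.indicator f) x‖ - ‖superpos k (Bᶜ.indicator f) x‖)]
        have := ENNReal.ofReal_le_ofReal hn
        rw [ENNReal.ofReal_add (by positivity) (by positivity),
          ENNReal.ofReal_mul (by norm_num), ENNReal.ofReal_mul (by norm_num),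
          ENNReal.ofReal_pow (norm_nonneg _), ENNReal.ofReal_pow (norm_nonneg _),
          ENNReal.ofReal_pow (norm_nonneg _), ofReal_norm, ofReal_norm, ofReal_norm,
          ENNReal.ofReal_ofNat] at this
        exact this
    _ = (2 * ∫⁻ x, ‖superpos k (B.indicator f) x‖ₑ ^ 2) +
        2 * ∫⁻ x, ‖superpos k (Bᶜ.indicator f) x‖ₑ ^ 2 := by
        rw [lintegral_add_left (hs1.const_mul 2), lintegral_const_mul _ hs1,
          lintegral_const_mul _ hs2]
    _ ≤ 2 * (ENNReal.ofReal (C1 * ℓ + C2 * (Θ * ℓ / √ℓ ^ (d - 1))) * shellMass E) +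
        2 * (ENNReal.ofReal (C1 * (2 * ℓ)) * shellMass E) := by gcongr
    _ = ENNReal.ofReal (2 * (C1 * ℓ + C2 * (Θ * ℓ / √ℓ ^ (d - 1))) + 2 * (C1 * (2 * ℓ))) *
          shellMass E := by
        have e : ∀ X Y : ℝ, 0 ≤ X → 0 ≤ Y → ENNReal.ofReal (2 * X + 2 * Y) =
            2 * ENNReal.ofReal X + 2 * ENNReal.ofReal Y := fun X Y hX hY => by
          rw [ENNReal.ofReal_add (by positivity) (by positivity),
            ENNReal.ofReal_mul (by norm_num), ENNReal.ofReal_mul (by norm_num),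
            ENNReal.ofReal_ofNat]
        rw [e _ _ (by positivity) (by positivity)]
        ring
    _ ≤ _ := by
        have hX : 0 ≤ Θ * ℓ / √ℓ ^ (d - 1) := by positivity
        gcongr
        nlinarith [mul_nonneg hC1.le hX, mul_nonneg hC2.le (by linarith : 0 ≤ ℓ)]

end weak

lemma ofReal_mul_div_ofReal (x : ℝ) {y : ℝ} (hy : 0 < y) (s : ℝ≥0∞) :
    ENNReal.ofReal x * s / ENNReal.ofReal y = ENNReal.ofReal (x / y) * s := by
  rw [ENNReal.ofReal_div_of_pos hy, div_eq_mul_inv, div_eq_mul_inv, mul_right_comm]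

section weak
variable {d : ℕ} {D : ℝ → Rd d → ℝ} {L : ℝ} {k k' : ℝ → Rd d → ℂ}

lemma IsDispKer.volume_superpos_le_one (hd : 1 ≤ d) (hD : IsConeDist D L) (hk : IsDispKer D k) :
    ∃ C : ℝ, 0 < C ∧ ∀ t : ℝ, 0 < t → ∀ A : Set (ℝ × Rd d), MeasurableSet A →
      ∀ f : ℝ × Rd d → ℂ, Measurable f → IsBddOn A f →
      volume {x | t < ‖superpos k f x‖} ≤ ENNReal.ofReal (C / t) * shellMass A := by
  obtain ⟨C, hC, h⟩ := hk.lintegral_superpos_le hd hD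
  refine ⟨C, hC, fun t ht A hA f hf hfA => ?_⟩
  have hms := (hk.measurable_superpos hf).enorm
  have ht' : ENNReal.ofReal t ≠ 0 := by simpa using ht
  calc _ ≤ volume {x | ENNReal.ofReal t ≤ ‖superpos k f x‖ₑ} := by
        refine measure_mono fun x hx => ?_
        have hx : t < ‖superpos k f x‖ := hx
        change ENNReal.ofReal t ≤ ‖superpos k f x‖ₑ
        rw [← ofReal_norm]
        exact ENNReal.ofReal_le_ofReal hx.le
    _ ≤ (∫⁻ x, ‖superpos k f x‖ₑ) / ENNReal.ofReal t :=
        meas_ge_le_lintegral_div hms.aemeasurable ht' ENNReal.ofReal_ne_top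
    _ ≤ (ENNReal.ofReal C * shellMass A) / ENNReal.ofReal t := by
        gcongr
        calc _ ≤ ∫⁻ x, ∫⁻ P : ℝ × Rd d, ‖k P.1 (x - P.2) * f P‖ₑ :=
              lintegral_mono fun x => enorm_integral_le_lintegral_enorm _
          _ ≤ _ := h f hf
          _ ≤ _ := by gcongr; exact hfA.lintegral_le hA
    _ = _ := by
        exact ofReal_mul_div_ofReal _ ht _

lemma IsDispKer.volume_superpos_le (hd : 4 ≤ d) (hD : IsConeDist D L) (hk : IsDispKer D k)
    (hk' : IsDispKer D k')
    (hkk : ∀ r r' y y', ∫ x, k r (x - y) * starRingEnd ℂ (k r' (x - y')) =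
      k' (r - r') (y' - y)) :
    ∃ C : ℝ, 0 < C ∧ ∀ σ : ℝ, 1 ≤ σ → ∀ A : Set (ℝ × Rd d), MeasurableSet A →
      shellMass A < ∞ → ∀ f : ℝ × Rd d → ℂ, Measurable f → IsBddOn A f →
      volume {x | σ ^ (d + 1) < ‖superpos k f x‖} ≤
        ENNReal.ofReal (C / σ ^ (2 * (d - 1))) * shellMass A := by
  obtain ⟨C1, hC1, hgood⟩ := hD.exists_good_set
  obtain ⟨C2, hC2, hfar⟩ := hk.lintegral_far_cone_le (by omega) hD
  obtain ⟨C3, hC3, hsq⟩ := hk.lintegral_superpos_sq_le hd hD hk' hkk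
  refine ⟨C1 + 4 * (C3 * 2) + 2 * (C2 * C1), by positivity, fun σ hσ A hA hfin f hf hfA => ?_⟩
  have hσ0 : 0 < σ := by linarith
  set Θ := σ ^ (2 * (d - 1)) with hΘdef
  have hΘ : 1 ≤ Θ := one_le_pow₀ hσ
  have hΘ0 : 0 < Θ := by linarith
  set lam := σ ^ (d + 1) with hlam
  have hlam0 : 0 < lam := by positivity
  have hlam1 : 1 ≤ lam := one_le_pow₀ hσ
  obtain ⟨E, hEA, hE, Ω, hΩ, hthin, hvol, hbad⟩ := hgood Θ hΘ A hA hfin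
  have hEfin : shellMass E ≤ shellMass A := lintegral_mono_set hEA
  have hbE : IsBddOn E (E.indicator f) := by
    have := hfA.indicator (B := E)
    rwa [inter_eq_self_of_subset_right hEA] at this
  have hbB : IsBddOn (A \ E) (Eᶜ.indicator f) := hfA.indicator (B := Eᶜ)
  have hmE : Measurable (E.indicator f) := hf.indicator hE
  have hmB : Measurable (Eᶜ.indicator f) := hf.indicator hE.compl
  have hsE : Measurable fun x => ‖superpos k (E.indicator f) x‖ₑ ^ 2 :=
    (hk.measurable_superpos hmE).enorm.pow_const 2
  have hsB : Measurable (Ωᶜ.indicator fun x => ‖superpos k (Eᶜ.indicator f) x‖ₑ) :=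
    (hk.measurable_superpos hmB).enorm.indicator hΩ.compl
  have g1 : volume {x | ENNReal.ofReal (lam ^ 2 / 4) ≤ ‖superpos k (E.indicator f) x‖ₑ ^ 2} ≤
      ENNReal.ofReal (4 * (C3 * 2) / Θ) * shellMass A := by
    refine (meas_ge_le_lintegral_div hsE.aemeasurable (by simpa using by positivity)
      ENNReal.ofReal_ne_top).trans ?_
    have h1 := hsq Θ (σ ^ 4) hΘ (one_le_pow₀ hσ) E hE hthin (hEfin.trans_lt hfin) _ hmE hbE
    have h2 : √(σ ^ 4) ^ (d - 1) = Θ := by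
      rw [show σ ^ 4 = (σ ^ 2) ^ 2 by ring, Real.sqrt_sq (by positivity), ← pow_mul]
    rw [h2, mul_div_cancel_left₀ _ hΘ0.ne', ← mul_two] at h1
    calc _ ≤ (ENNReal.ofReal (C3 * (σ ^ 4 * 2)) * shellMass A) / ENNReal.ofReal (lam ^ 2 / 4) := by
          gcongr
          exact h1.trans (by gcongr)
      _ = ENNReal.ofReal (C3 * (σ ^ 4 * 2) / (lam ^ 2 / 4)) * shellMass A := by
          exact ofReal_mul_div_ofReal _ (by positivity) _
      _ = _ := by
          congr 2
          have h3 : lam ^ 2 = σ ^ 4 * Θ := by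
            rw [hlam, hΘdef, ← pow_mul, ← pow_add]; congr 1; omega
          rw [h3]
          field_simp
  have g2 : volume {x | ENNReal.ofReal (lam / 2) ≤
      Ωᶜ.indicator (fun x => ‖superpos k (Eᶜ.indicator f) x‖ₑ) x} ≤
      ENNReal.ofReal (2 * (C2 * C1) / Θ) * shellMass A := by
    refine (meas_ge_le_lintegral_div hsB.aemeasurable (by simpa using by positivity)
      ENNReal.ofReal_ne_top).trans ?_
    have h1 := hfar (Θ / C1) (by positivity) (A \ E) (hA.diff hE)
    have h2 : ∫⁻ x, Ωᶜ.indicator (fun x => ‖superpos k (Eᶜ.indicator f) x‖ₑ) x ≤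
        ENNReal.ofReal (C2 / (Θ / C1)) * shellMass (A \ E) := by
      refine (lintegral_mono fun x => ?_).trans h1
      by_cases hx : x ∈ Ω
      · rw [indicator_of_notMem (by simpa using hx)]; exact zero_le
      rw [indicator_of_mem (by simpa using hx)]
      refine (enorm_integral_le_lintegral_enorm _).trans ?_
      rw [← lintegral_indicator (hA.diff hE)]
      refine lintegral_mono fun P => ?_
      have hP1 := hbB P
      by_cases hP : P ∈ A \ E
      · rw [indicator_of_mem hP] at hP1 ⊢
        have h3 : x - P.2 ∈ {x | Θ / C1 ≤ D P.1 x ^ d} := by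
          have := hbad x hx P hP
          change Θ / C1 ≤ D P.1 (x - P.2) ^ d
          rw [div_le_iff₀ hC1]; linarith
        rw [indicator_of_mem h3, enorm_mul, mul_comm]
        gcongr
      · rw [indicator_of_notMem hP, nonpos_iff_eq_zero] at hP1
        rw [enorm_mul, hP1, mul_zero]; exact zero_le
    have hsub : shellMass (A \ E) ≤ shellMass A := lintegral_mono_set sdiff_subset
    calc _ ≤ (ENNReal.ofReal (C2 / (Θ / C1)) * shellMass A) / ENNReal.ofReal (lam / 2) := by
          gcongr
          exact h2.trans (by gcongr)
      _ = ENNReal.ofReal (C2 / (Θ / C1) / (lam / 2)) * shellMass A := by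
          exact ofReal_mul_div_ofReal _ (by positivity) _
      _ ≤ _ := by
          gcongr ENNReal.ofReal ?_ * _
          rw [show C2 / (Θ / C1) / (lam / 2) = 2 * (C2 * C1) / Θ / lam by field_simp]
          exact div_le_self (by positivity) hlam1
  have hae := hk.ae_integrable (by omega) hD hf ((hfA.lintegral_le hA).trans_lt hfin)
  have hsubset : ∀ᵐ x, x ∈ {x | lam < ‖superpos k f x‖} → x ∈ Ω ∪
      ({x | ENNReal.ofReal (lam ^ 2 / 4) ≤ ‖superpos k (E.indicator f) x‖ₑ ^ 2} ∪
      {x | ENNReal.ofReal (lam / 2) ≤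
        Ωᶜ.indicator (fun x => ‖superpos k (Eᶜ.indicator f) x‖ₑ) x}) := by
    filter_upwards [hae] with x hx hx1
    have hx1 : lam < ‖superpos k f x‖ := hx1
    by_cases hxΩ : x ∈ Ω
    · exact Or.inl hxΩ
    refine Or.inr ?_
    rw [superpos_indicator_add E hE hx] at hx1
    have h4 := norm_add_le (superpos k (E.indicator f) x) (superpos k (Eᶜ.indicator f) x)
    rcases le_or_gt (lam / 2) ‖superpos k (E.indicator f) x‖ with h | h
    · left
      change ENNReal.ofReal (lam ^ 2 / 4) ≤ ‖superpos k (E.indicator f) x‖ₑ ^ 2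
      rw [← ofReal_norm, ← ENNReal.ofReal_pow (norm_nonneg _)]
      apply ENNReal.ofReal_le_ofReal
      nlinarith
    · right
      change ENNReal.ofReal (lam / 2) ≤
        Ωᶜ.indicator (fun x => ‖superpos k (Eᶜ.indicator f) x‖ₑ) x
      rw [indicator_of_mem (by simpa using hxΩ), ← ofReal_norm]
      apply ENNReal.ofReal_le_ofReal
      linarith
  calc _ ≤ _ := measure_mono_ae hsubset
    _ ≤ ENNReal.ofReal (C1 / Θ) * shellMass A +
          (ENNReal.ofReal (4 * (C3 * 2) / Θ) * shellMass A +
            ENNReal.ofReal (2 * (C2 * C1) / Θ) * shellMass A) :=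
        (measure_union_le _ _).trans (add_le_add hvol ((measure_union_le _ _).trans
          (add_le_add g1 g2)))
    _ = _ := by
        rw [add_div, add_div, ENNReal.ofReal_add (by positivity) (by positivity),
          ENNReal.ofReal_add (by positivity) (by positivity)]
        ring

end weak

section distribution
variable {d : ℕ} {D : ℝ → Rd d → ℝ} {L : ℝ} {k k' : ℝ → Rd d → ℂ}

lemma superpos_const_mul (c : ℂ) (f : ℝ × Rd d → ℂ) (x : Rd d) :
    superpos k (fun P => c * f P) x = c * superpos k f x := by
  simp only [superpos, mul_left_comm _ c, integral_const_mul]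

lemma IsDispKer.volume_superpos_slab_le (hd : 4 ≤ d) (hD : IsConeDist D L) (hk : IsDispKer D k)
    (hk' : IsDispKer D k')
    (hkk : ∀ r r' y y', ∫ x, k r (x - y) * starRingEnd ℂ (k r' (x - y')) =
      k' (r - r') (y' - y)) :
    ∃ C : ℝ, 0 < C ∧ ∀ f : ℝ × Rd d → ℂ, Measurable f → ∀ τ : ℝ, 0 < τ →
      ∀ A : Set (ℝ × Rd d), MeasurableSet A → shellMass A < ∞ →
      (∀ P ∈ A, ‖f P‖ ≤ τ * √(1 + |P.1|) ^ (d - 1)) → ∀ s : ℝ, 0 < s →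
      volume {x | τ * s < ‖superpos k (A.indicator f) x‖} ≤ ENNReal.ofReal (C * s⁻¹) * shellMass A ∧
      (1 ≤ s → volume {x | τ * s < ‖superpos k (A.indicator f) x‖} ≤
        ENNReal.ofReal (C * s ^ (-(2 * ((d : ℝ) - 1) / ((d : ℝ) + 1)))) * shellMass A) := by
  obtain ⟨C1, hC1, h1⟩ := hk.volume_superpos_le_one (by omega) hD
  obtain ⟨C2, hC2, h2⟩ := hk.volume_superpos_le hd hD hk' hkk
  refine ⟨max C1 C2, lt_max_of_lt_left hC1, fun f hf τ hτ A hA hfin hfA s hs => ?_⟩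
  set g : ℝ × Rd d → ℂ := fun P => ((τ⁻¹ : ℝ) : ℂ) * A.indicator f P with hg
  have hgm : Measurable g := (hf.indicator hA).const_mul _
  have hgA : IsBddOn A g := by
    intro P
    by_cases hP : P ∈ A
    · rw [hg]
      simp only [indicator_of_mem hP]
      rw [← ofReal_norm]
      apply ENNReal.ofReal_le_ofReal
      rw [norm_mul, Complex.norm_real, Real.norm_of_nonneg (by positivity),
        inv_mul_le_iff₀ hτ]
      exact hfA P hP
    · rw [hg]
      simp [indicator_of_notMem hP]
  have hset : ∀ x, τ * s < ‖superpos k (A.indicator f) x‖ ↔ s < ‖superpos k g x‖ := by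
    intro x
    rw [hg, superpos_const_mul, norm_mul, Complex.norm_real, Real.norm_of_nonneg (by positivity),
      lt_inv_mul_iff₀ hτ]
  simp only [hset]
  refine ⟨(h1 s hs A hA g hgm hgA).trans ?_, fun hs1 => ?_⟩
  · rw [div_eq_mul_inv]
    gcongr
    exact le_max_left _ _
  · set σ := s ^ (((d : ℝ) + 1)⁻¹) with hσ
    have hσ1 : 1 ≤ σ := Real.one_le_rpow hs1 (by positivity)
    have e1 : σ ^ (d + 1) = s := by
      rw [hσ, ← Real.rpow_natCast, ← Real.rpow_mul hs.le]
      push_cast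
      rw [inv_mul_cancel₀ (by positivity), Real.rpow_one]
    have e2 : s ^ (-(2 * ((d : ℝ) - 1) / ((d : ℝ) + 1))) = (σ ^ (2 * (d - 1)))⁻¹ := by
      rw [Real.rpow_neg hs.le, hσ, ← Real.rpow_natCast, ← Real.rpow_mul hs.le]
      congr 2
      push_cast [Nat.cast_sub (by omega : 1 ≤ d)]
      ring
    have h3 := h2 σ hσ1 A hA hfin g hgm hgA
    rw [e1] at h3
    refine h3.trans ?_
    rw [e2, div_eq_mul_inv]
    gcongr
    exact le_max_right _ _

/-- The set where `f` exceeds `t (1+|r|)^{(d-1)/2}`. -/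
def superLevel (f : ℝ × Rd d → ℂ) (t : ℝ) : Set (ℝ × Rd d) :=
  {P | t * √(1 + |P.1|) ^ (d - 1) < ‖f P‖}

lemma measurableSet_superLevel {f : ℝ × Rd d → ℂ} (hf : Measurable f) (t : ℝ) :
    MeasurableSet (superLevel f t) :=
  measurableSet_lt (by fun_prop) hf.norm

/-- The part of `superLevel f t` where `f` is at most `2 t (1+|r|)^{(d-1)/2}`. -/
def dyadicLevel (f : ℝ × Rd d → ℂ) (t : ℝ) : Set (ℝ × Rd d) :=
  superLevel f t \ superLevel f (2 * t)

lemma hasSum_superpos_dyadicLevel {f : ℝ × Rd d → ℂ} (hf : Measurable f) {t : ℝ} (ht : 0 < t)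
    {x : Rd d} (hx : Integrable fun P : ℝ × Rd d => k P.1 (x - P.2) * f P) :
    HasSum (fun j : ℤ => superpos k ((dyadicLevel f (2 ^ j * t)).indicator f) x)
      (superpos k f x) := by
  have hm : ∀ j : ℤ, MeasurableSet (dyadicLevel f (2 ^ j * t)) := fun j =>
    (measurableSet_superLevel hf _).diff (measurableSet_superLevel hf _)
  have hdisj : Pairwise (Function.onFun Disjoint fun j : ℤ => dyadicLevel f (2 ^ j * t)) := by
    have key : ∀ i j : ℤ, i < j →
        Disjoint (dyadicLevel f (2 ^ i * t)) (dyadicLevel f (2 ^ j * t)) := by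
      intro i j hij
      rw [Set.disjoint_left]
      rintro P ⟨-, h1⟩ ⟨h2, -⟩
      apply h1
      refine lt_of_le_of_lt ?_ (show 2 ^ j * t * √(1 + |P.1|) ^ (d - 1) < ‖f P‖ from h2)
      rw [← mul_assoc 2]
      gcongr
      calc (2 : ℝ) * 2 ^ i = 2 ^ (i + 1) := by rw [zpow_add_one₀ two_ne_zero, mul_comm]
        _ ≤ 2 ^ j := zpow_le_zpow_right₀ one_le_two (by omega)
    intro i j hij
    rcases lt_or_gt_of_ne hij with h | h
    · exact key i j h
    · exact (key j i h).symm
  have hU : ∀ P, P ∉ ⋃ j : ℤ, dyadicLevel f (2 ^ j * t) → f P = 0 := by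
    intro P hP
    by_contra h0
    apply hP
    have hw : 0 < t * √(1 + |P.1|) ^ (d - 1) := by positivity
    obtain ⟨j, hj1, hj2⟩ := exists_mem_Ioc_zpow (y := (2 : ℝ))
      (div_pos (norm_pos_iff.mpr h0) hw) one_lt_two
    refine mem_iUnion.mpr ⟨j, ?_, fun h => ?_⟩
    · change 2 ^ j * t * _ < _
      rw [lt_div_iff₀ hw] at hj1
      linarith
    · change 2 * (2 ^ j * t) * _ < _ at h
      rw [div_le_iff₀ hw, zpow_add_one₀ two_ne_zero] at hj2
      linarith
  have h := hasSum_integral_iUnion hm hdisj hx.integrableOn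
  rw [setIntegral_eq_integral_of_forall_compl_eq_zero
    (fun P hP => by rw [hU P hP, mul_zero])] at h
  have key : ∀ j : ℤ, superpos k ((dyadicLevel f (2 ^ j * t)).indicator f) x =
      ∫ P in dyadicLevel f (2 ^ j * t), k P.1 (x - P.2) * f P := by
    intro j
    rw [superpos, ← integral_indicator (hm j)]
    congr 1
    ext P
    by_cases hP : P ∈ dyadicLevel f (2 ^ j * t)
    · simp [indicator_of_mem hP]
    · simp [indicator_of_notMem hP]
  simp only [key]
  exact h

end distribution

lemma summable_two_rpow_neg_mul_abs {ε : ℝ} (hε : 0 < ε) :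
    Summable fun j : ℤ => (2 : ℝ) ^ (-(ε * |(j : ℝ)|)) := by
  have h : Summable fun n : ℕ => (2 : ℝ) ^ (-(ε * (n : ℝ))) := by
    have : ∀ n : ℕ, (2 : ℝ) ^ (-(ε * (n : ℝ))) = ((2 : ℝ) ^ (-ε)) ^ n := fun n => by
      rw [← Real.rpow_natCast, ← Real.rpow_mul two_pos.le]; ring_nf
    simp only [this]
    exact summable_geometric_of_lt_one (by positivity)
      (Real.rpow_lt_one_of_one_lt_of_neg one_lt_two (by linarith))
  apply Summable.of_nat_of_neg <;> simpa using h

section interp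
variable {d : ℕ} {D : ℝ → Rd d → ℝ} {L : ℝ} {k k' : ℝ → Rd d → ℂ}

lemma IsDispKer.volume_superpos_le_tsum (hd : 4 ≤ d) (hD : IsConeDist D L) (hk : IsDispKer D k)
    (hk' : IsDispKer D k')
    (hkk : ∀ r r' y y', ∫ x, k r (x - y) * starRingEnd ℂ (k r' (x - y')) =
      k' (r - r') (y' - y))
    {p : ℝ} (hp1 : 1 < p) (hp2 : p < 2 * ((d : ℝ) - 1) / ((d : ℝ) + 1)) :
    ∃ C₀ : ℝ, 0 < C₀ ∧ ∃ c : ℤ → ℝ≥0∞,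
      ∑' j : ℤ, c j * ENNReal.ofReal (2 ^ j) ^ (-p) ≠ ∞ ∧
      ∀ f : ℝ × Rd d → ℂ, Measurable f → (∀ t, 0 < t → shellMass (superLevel f t) < ∞) →
      (∀ᵐ x, Integrable fun P : ℝ × Rd d => k P.1 (x - P.2) * f P) →
      ∀ t : ℝ, 0 < t → volume {x | C₀ * t < ‖superpos k f x‖} ≤
        ∑' j : ℤ, c j * shellMass (superLevel f (2 ^ j * t)) := by
  obtain ⟨C, hC, hslab⟩ := hk.volume_superpos_slab_le hd hD hk' hkk
  set p₁ := 2 * ((d : ℝ) - 1) / ((d : ℝ) + 1) with hp₁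
  have hp₁2 : p₁ < 2 := by
    rw [hp₁, div_lt_iff₀ (by positivity)]; linarith
  set ε := min (p - 1) (p₁ - p) / 4 with hε
  have hε0 : 0 < ε := by
    have : 0 < min (p - 1) (p₁ - p) := lt_min (by linarith) (by linarith)
    positivity
  have hεp : 4 * ε ≤ p - 1 := by
    have := min_le_left (p - 1) (p₁ - p); rw [hε]; linarith
  have hεp' : 4 * ε ≤ p₁ - p := by
    have := min_le_right (p - 1) (p₁ - p); rw [hε]; linarith
  have hsum := summable_two_rpow_neg_mul_abs hε0
  set S := ∑' j : ℤ, (2 : ℝ) ^ (-(ε * |(j : ℝ)|)) with hS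
  have hS0 : 0 < S := hsum.tsum_pos (fun j => by positivity) 0 (by positivity)
  set s : ℤ → ℝ := fun j => 2 ^ (-(j : ℝ) - ε * |(j : ℝ)|) with hs
  have hspos : ∀ j, 0 < s j := fun j => by simp only [hs]; positivity
  set c : ℤ → ℝ := fun j => if 0 ≤ j then C * (s j)⁻¹ else C * s j ^ (-p₁) with hc
  have hcle : ∀ j, c j * (2 ^ j) ^ (-p) ≤ C * 2 ^ (-(ε * |(j : ℝ)|)) := by
    intro j
    have e0 : ((2 : ℝ) ^ j) ^ (-p) = 2 ^ ((j : ℝ) * (-p)) := by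
      rw [← Real.rpow_intCast, ← Real.rpow_mul two_pos.le]
    rw [e0]
    by_cases hj : 0 ≤ j
    · have hj' : (0 : ℝ) ≤ j := by exact_mod_cast hj
      simp only [hc, hs, if_pos hj]
      rw [← Real.rpow_neg two_pos.le, mul_assoc, ← Real.rpow_add two_pos, abs_of_nonneg hj']
      gcongr
      · exact one_le_two
      · nlinarith
    · have hj' : (j : ℝ) ≤ 0 := by exact_mod_cast (not_le.mp hj).le
      simp only [hc, hs, if_neg hj]
      rw [← Real.rpow_mul two_pos.le, mul_assoc, ← Real.rpow_add two_pos, abs_of_nonpos hj']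
      gcongr
      · exact one_le_two
      · have : 0 ≤ (-(j : ℝ)) * (p₁ - p - ε * p₁ - ε) :=
          mul_nonneg (by linarith) (by nlinarith)
        nlinarith
  have hc0 : ∀ j, 0 ≤ c j := by
    intro j
    have := hspos j
    simp only [hc]; split_ifs <;> positivity
  refine ⟨2 * S, by positivity, fun j => ENNReal.ofReal (c j), ?_, fun f hf hfin hint t ht => ?_⟩
  · have h1 : ∀ j : ℤ, ENNReal.ofReal (c j) * ENNReal.ofReal (2 ^ j) ^ (-p) ≤
        ENNReal.ofReal (C * 2 ^ (-(ε * |(j : ℝ)|))) := by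
      intro j
      rw [ENNReal.ofReal_rpow_of_pos (by positivity), ← ENNReal.ofReal_mul (hc0 j)]
      exact ENNReal.ofReal_le_ofReal (hcle j)
    exact ne_top_of_le_ne_top (hsum.mul_left C).tsum_ofReal_ne_top (ENNReal.tsum_le_tsum h1)
  set A : ℤ → Set (ℝ × Rd d) := fun j => dyadicLevel f (2 ^ j * t) with hA
  have hAm : ∀ j, MeasurableSet (A j) := fun j =>
    (measurableSet_superLevel hf _).diff (measurableSet_superLevel hf _)
  have hAle : ∀ j, shellMass (A j) ≤ shellMass (superLevel f (2 ^ j * t)) := fun j =>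
    lintegral_mono_set sdiff_subset
  have hpiece : ∀ j, volume {x | 2 * (2 ^ j * t) * s j < ‖superpos k ((A j).indicator f) x‖} ≤
      ENNReal.ofReal (c j) * shellMass (superLevel f (2 ^ j * t)) := by
    intro j
    obtain ⟨h1, h2⟩ := hslab f hf (2 * (2 ^ j * t)) (by positivity) (A j) (hAm j)
      ((hAle j).trans_lt (hfin _ (by positivity))) (fun P hP => not_lt.mp hP.2) (s j) (hspos j)
    simp only [hc]
    split_ifs with hj
    · exact h1.trans (by gcongr; exact hAle j)
    · refine (h2 ?_).trans (by gcongr; exact hAle j)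
      have hj' : (j : ℝ) ≤ 0 := by exact_mod_cast (not_le.mp hj).le
      refine Real.one_le_rpow one_le_two ?_
      rw [abs_of_nonpos hj']
      nlinarith
  have hthr : ∀ j, 2 * (2 ^ j * t) * s j = 2 * t * 2 ^ (-(ε * |(j : ℝ)|)) := by
    intro j
    have : (2 : ℝ) ^ j * s j = 2 ^ (-(ε * |(j : ℝ)|)) := by
      simp only [hs]
      rw [← Real.rpow_intCast, ← Real.rpow_add two_pos]
      ring_nf
    rw [← this]; ring
  have hsub : ∀ᵐ x, x ∈ {x | 2 * S * t < ‖superpos k f x‖} →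
      x ∈ ⋃ j, {x | 2 * (2 ^ j * t) * s j < ‖superpos k ((A j).indicator f) x‖} := by
    filter_upwards [hint] with x hx hx1
    by_contra h
    simp only [mem_iUnion, not_exists, mem_ofPred_eq] at h
    have h1 := (hasSum_superpos_dyadicLevel hf ht hx)
    have h2 : HasSum (fun j : ℤ => 2 * t * (2 : ℝ) ^ (-(ε * |(j : ℝ)|))) (2 * t * S) :=
      hsum.hasSum.mul_left _
    have h3 := tsum_of_norm_bounded h2 fun j => by
      have := not_lt.mp (h j)
      rwa [hthr] at this
    rw [h1.tsum_eq] at h3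
    have hx1 : 2 * S * t < ‖superpos k f x‖ := hx1
    linarith
  calc _ ≤ _ := measure_mono_ae hsub
    _ ≤ _ := measure_iUnion_le _
    _ ≤ _ := ENNReal.tsum_le_tsum hpiece

end interp

/-- **Minkowski's integral inequality** for nonnegative functions. -/
lemma lintegral_rpow_lintegral_le {α β : Type*} [MeasurableSpace α] [MeasurableSpace β]
    {μ : Measure α} [SFinite μ] {ν : Measure β} [SigmaFinite ν] {Q : ℝ} (hQ : 1 ≤ Q)
    {G : α → β → ℝ≥0∞} (hG : Measurable (Function.uncurry G)) :
    (∫⁻ t, (∫⁻ s, G s t ∂μ) ^ Q ∂ν) ^ (1 / Q) ≤ ∫⁻ s, (∫⁻ t, G s t ^ Q ∂ν) ^ (1 / Q) ∂μ := by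
  have hG' : Measurable (Function.uncurry fun t s => G s t) := hG.comp measurable_swap
  rcases hQ.eq_or_lt with rfl | hQ1
  · simp only [ENNReal.rpow_one, div_one]
    rw [lintegral_lintegral_swap hG'.aemeasurable]
  have hQ0 : 0 < Q := by linarith
  set Φ : β → ℝ≥0∞ := fun t => ∫⁻ s, G s t ∂μ with hΦ
  have hΦm : Measurable Φ := hG'.lintegral_prod_right'
  set M := ∫⁻ s, (∫⁻ t, G s t ^ Q ∂ν) ^ (1 / Q) ∂μ with hM
  set φ : ℕ → β → ℝ≥0∞ := fun N => (spanningSets ν N).indicator fun t => min (Φ t) N with hφ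
  have hφm : ∀ N, Measurable (φ N) := fun N =>
    (hΦm.min measurable_const).indicator (measurableSet_spanningSets ν N)
  have hφle : ∀ N t, φ N t ≤ Φ t := fun N t =>
    (indicator_le_self' (fun _ _ => zero_le) t).trans (min_le_left _ _)
  have hconj := (Real.HolderConjugate.conjExponent hQ1)
  set Q' := Q.conjExponent with hQ'
  have hQQ : (Q - 1) * Q' = Q := hconj.sub_one_mul_conj
  have key : ∀ N, ∫⁻ t, φ N t ^ Q ∂ν ≤ M ^ Q := by
    intro N
    set I := ∫⁻ t, φ N t ^ Q ∂ν with hI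
    have hIfin : I ≠ ∞ := by
      have : I ≤ ∫⁻ t, (spanningSets ν N).indicator (fun _ => (N : ℝ≥0∞) ^ Q) t ∂ν := by
        refine lintegral_mono fun t => ?_
        by_cases ht : t ∈ spanningSets ν N
        · simp only [hφ, indicator_of_mem ht]
          gcongr
          exact min_le_right _ _
        · simp only [hφ, indicator_of_notMem ht, ENNReal.zero_rpow_of_pos hQ0, le_refl]
      rw [lintegral_indicator_const (measurableSet_spanningSets ν N)] at this
      exact ne_top_of_le_ne_top (ENNReal.mul_ne_top
        (ENNReal.rpow_ne_top_of_nonneg hQ0.le (ENNReal.natCast_ne_top N))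
        (measure_spanningSets_lt_top ν N).ne) this
    have h1 : I ≤ M * I ^ (1 / Q') := by
      calc I ≤ ∫⁻ t, ∫⁻ s, G s t * φ N t ^ (Q - 1) ∂μ ∂ν := by
            refine lintegral_mono fun t => ?_
            rw [lintegral_mul_const _ (hG'.of_uncurry_left)]
            calc φ N t ^ Q = φ N t * φ N t ^ (Q - 1) := by
                  conv_rhs => rw [← ENNReal.rpow_one (φ N t), ← ENNReal.rpow_mul, one_mul]
                  rw [← ENNReal.rpow_add_of_nonneg _ _ zero_le_one (by linarith)]
                  ring_nf
              _ ≤ _ := by gcongr; exact hφle N t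
        _ = ∫⁻ s, ∫⁻ t, G s t * φ N t ^ (Q - 1) ∂ν ∂μ := by
            refine lintegral_lintegral_swap (Measurable.aemeasurable ?_)
            exact hG'.mul (((hφm N).comp measurable_fst).pow_const _)
        _ ≤ ∫⁻ s, (∫⁻ t, G s t ^ Q ∂ν) ^ (1 / Q) * I ^ (1 / Q') ∂μ := by
            refine lintegral_mono fun s => ?_
            refine (ENNReal.lintegral_mul_le_Lp_mul_Lq ν hconj hG.of_uncurry_left.aemeasurable
              ((hφm N).pow_const _).aemeasurable).trans ?_
            simp only [← ENNReal.rpow_mul, hQQ, hI, le_refl]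
        _ = _ := by
            rw [lintegral_mul_const]
            exact (Measurable.lintegral_prod_right' (hG.pow_const Q)).pow_const _
    rcases eq_or_ne I 0 with h0 | h0
    · rw [h0]; exact zero_le
    have h2 : I = I ^ (1 / Q) * I ^ (1 / Q') := by
      rw [← ENNReal.rpow_add _ _ h0 hIfin, one_div, one_div, hconj.inv_add_inv_eq_one,
        ENNReal.rpow_one]
    have h3 : I ^ (1 / Q) ≤ M := by
      have h4 : I ^ (1 / Q') ≠ 0 := by
        simp [ENNReal.rpow_eq_zero_iff, h0, hIfin]
      have h5 : I ^ (1 / Q') ≠ ∞ :=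
        ENNReal.rpow_ne_top_of_nonneg (by simpa using hconj.symm.nonneg) hIfin
      exact (ENNReal.mul_le_mul_iff_left h4 h5).mp (h2.ge.trans h1)
    rwa [one_div, ENNReal.rpow_inv_le_iff hQ0] at h3
  rw [one_div, ENNReal.rpow_inv_le_iff hQ0]
  refine le_of_tendsto' (lintegral_tendsto_of_tendsto_of_monotone
    (f := fun N t => φ N t ^ Q) (F := fun t => Φ t ^ Q)
    (fun N => ((hφm N).pow_const _).aemeasurable) (ae_of_all _ fun t N N' h => ?_)
    (ae_of_all _ fun t => ?_)) key
  · refine ENNReal.rpow_le_rpow ?_ hQ0.le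
    simp only [hφ]
    refine indicator_le_indicator_of_subset (monotone_spanningSets ν h) (fun _ => zero_le) t
      |>.trans (indicator_le_indicator ?_)
    exact min_le_min le_rfl (by exact_mod_cast h)
  · refine Filter.Tendsto.ennrpow_const Q ?_
    have h1 : Filter.Tendsto (fun N : ℕ => min (Φ t) (N : ℝ≥0∞)) Filter.atTop (nhds (Φ t)) := by
      have := (tendsto_const_nhds (x := Φ t)).min ENNReal.tendsto_nat_nhds_top
      simpa using this
    refine h1.congr' ?_
    obtain ⟨N₀, hN₀⟩ := mem_iUnion.mp ((iUnion_spanningSets ν).symm ▸ mem_univ t)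
    filter_upwards [Filter.eventually_ge_atTop N₀] with N hN
    simp only [hφ, indicator_of_mem (monotone_spanningSets ν hN hN₀)]

lemma lintegral_Ioi_comp_mul_div (h : ℝ → ℝ≥0∞) {c : ℝ} (hc : 0 < c) :
    ∫⁻ t in Ioi (0 : ℝ), h (c * t) / ENNReal.ofReal t =
      ∫⁻ t in Ioi (0 : ℝ), h t / ENNReal.ofReal t := by
  have h1 := lintegral_image_eq_lintegral_abs_deriv_mul (s := Ioi (0 : ℝ)) (f := fun t => c * t)
    (f' := fun _ => c) measurableSet_Ioi
    (fun t _ => by simpa using ((hasDerivAt_id t).const_mul c).hasDerivWithinAt)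
    (fun t _ t' _ ht => mul_left_cancel₀ hc.ne' ht) (fun t => h t / ENNReal.ofReal t)
  have himg : (fun t => c * t) '' Ioi (0 : ℝ) = Ioi 0 := by
    rw [image_mul_left_Ioi hc, mul_zero]
  rw [himg] at h1
  rw [h1]
  refine setLIntegral_congr_fun measurableSet_Ioi fun t ht => ?_
  have ht : 0 < t := ht
  simp only [abs_of_pos hc]
  rw [ENNReal.ofReal_mul hc.le, div_eq_mul_inv, div_eq_mul_inv,
    ENNReal.mul_inv (Or.inl (by simpa using hc)) (Or.inl ENNReal.ofReal_ne_top),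
    mul_left_comm, ← mul_assoc (ENNReal.ofReal c),
    ENNReal.mul_inv_cancel (by simpa using hc) ENNReal.ofReal_ne_top, one_mul]

section lorentz

/-- The measure `dt / t` on `(0, ∞)`. -/
def dilationMeasure : Measure ℝ :=
  (volume.restrict (Ioi (0 : ℝ))).withDensity fun t => ((t.toNNReal⁻¹ : ℝ≥0) : ℝ≥0∞)

instance : SigmaFinite dilationMeasure :=
  inferInstanceAs (SigmaFinite (Measure.withDensity _ _))

lemma lintegral_dilationMeasure (h : ℝ → ℝ≥0∞) :
    ∫⁻ t, h t ∂dilationMeasure = ∫⁻ t in Ioi (0 : ℝ), h t / ENNReal.ofReal t := by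
  rw [dilationMeasure, lintegral_withDensity_eq_lintegral_mul_non_measurable _ (by fun_prop)
    (ae_of_all _ fun t => ENNReal.coe_lt_top)]
  refine setLIntegral_congr_fun measurableSet_Ioi fun t ht => ?_
  have ht : 0 < t := ht
  have h0 : t.toNNReal ≠ 0 := by simpa using ht
  simp only [Pi.mul_apply]
  rw [ENNReal.coe_inv h0, div_eq_mul_inv, mul_comm]
  rfl

lemma lintegral_dilationMeasure_comp_mul (h : ℝ → ℝ≥0∞) {c : ℝ} (hc : 0 < c) :
    ∫⁻ t, h (c * t) ∂dilationMeasure = ∫⁻ t, h t ∂dilationMeasure := by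
  rw [lintegral_dilationMeasure, lintegral_dilationMeasure, lintegral_Ioi_comp_mul_div h hc]

lemma ae_dilationMeasure_pos : ∀ᵐ t ∂dilationMeasure, 0 < t :=
  (withDensity_absolutelyContinuous _ _).ae_le (ae_restrict_mem measurableSet_Ioi)

variable {X E : Type*} [MeasurableSpace X] [NormedAddCommGroup E] {p : ℝ} {q : ℝ≥0∞}

lemma ofReal_mul_rpow_rpow (hp : 0 < p) (t : ℝ) (m : ℝ≥0∞) (s : ℝ) :
    (ENNReal.ofReal t * m ^ (1 / p)) ^ s = (ENNReal.ofReal t ^ p * m) ^ (s / p) := by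
  have : m = (m ^ (1 / p)) ^ p := by
    rw [← ENNReal.rpow_mul, one_div, inv_mul_cancel₀ hp.ne', ENNReal.rpow_one]
  conv_rhs => rw [this, ← ENNReal.mul_rpow_of_nonneg _ _ hp.le, ← ENNReal.rpow_mul,
    mul_div_cancel₀ _ hp.ne']

lemma lorentzNorm_rpow_eq (μ : Measure X) (hp : 0 < p) (hq : q ≠ ∞) (f : X → E) :
    lorentzNorm μ p q f ^ p =
      (∫⁻ t, (ENNReal.ofReal t ^ p * μ {x | t < ‖f x‖}) ^ (q.toReal / p) ∂dilationMeasure) ^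
        (1 / (q.toReal / p)) := by
  rw [lorentzNorm, if_neg hq, lintegral_dilationMeasure, ← ENNReal.rpow_mul]
  simp only [ofReal_mul_rpow_rpow hp]
  congr 1
  rw [one_div_div]; ring

lemma lorentzNorm_top_rpow_le_iff (μ : Measure X) (hp : 0 < p) (f : X → E) (B : ℝ≥0∞) :
    lorentzNorm μ p ∞ f ^ p ≤ B ↔ ∀ t, 0 < t → ENNReal.ofReal t ^ p * μ {x | t < ‖f x‖} ≤ B := by
  rw [lorentzNorm, if_pos rfl, ← ENNReal.le_rpow_inv_iff hp, iSup_le_iff]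
  refine ⟨fun h t ht => ?_, fun h t => ?_⟩
  · have := h t
    rwa [ENNReal.le_rpow_inv_iff hp, ofReal_mul_rpow_rpow hp, div_self hp.ne',
      ENNReal.rpow_one] at this
  · rcases le_or_gt t 0 with ht | ht
    · rw [ENNReal.ofReal_of_nonpos ht, zero_mul]; exact zero_le
    · rw [ENNReal.le_rpow_inv_iff hp, ofReal_mul_rpow_rpow hp, div_self hp.ne',
        ENNReal.rpow_one]
      exact h t ht

lemma lorentzNorm_rpow_le {R Y : Type*} [MeasurableSpace R] [MeasurableSpace Y]
    [MeasurableSpace E] [OpensMeasurableSpace E]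
    {μ : Measure X} {ν : Measure R} [SFinite ν] {m : Measure Y} [SFinite m] (hp : 0 < p)
    (hq : ENNReal.ofReal p ≤ q) {C₀ : ℝ} (hC₀ : 0 < C₀) {c : ℤ → ℝ≥0∞} {h : X → E} {F : R × Y → E}
    (hF : Measurable F)
    (H : ∀ t, 0 < t → μ {x | C₀ * t < ‖h x‖} ≤
      ∑' j : ℤ, c j * ∫⁻ y, ν {r | 2 ^ j * t < ‖F (r, y)‖} ∂m) :
    lorentzNorm μ p q h ^ p ≤
      ENNReal.ofReal C₀ ^ p * (∑' j : ℤ, c j * ENNReal.ofReal (2 ^ j) ^ (-p)) *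
        ∫⁻ y, lorentzNorm ν p q (fun r => F (r, y)) ^ p ∂m := by
  set N : Y → ℝ → ℝ≥0∞ := fun y t => ENNReal.ofReal t ^ p * ν {r | t < ‖F (r, y)‖} with hN
  have hNm : Measurable (Function.uncurry N) := by
    have h1 : MeasurableSet {z : (Y × ℝ) × R | z.1.2 < ‖F (z.2, z.1.1)‖} :=
      measurableSet_lt (by fun_prop)
        (hF.comp (f := fun z : (Y × ℝ) × R => (z.2, z.1.1)) (by fun_prop)).norm
    have h2 : Measurable fun z : Y × ℝ => ν {r | z.2 < ‖F (r, z.1)‖} :=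
      measurable_measure_prodMk_left h1
    have h3 : Measurable fun z : Y × ℝ => ENNReal.ofReal z.2 ^ p := by fun_prop
    exact h3.mul h2
  set b : ℤ → ℝ≥0∞ := fun j => ENNReal.ofReal C₀ ^ p * (c j * ENNReal.ofReal (2 ^ j) ^ (-p)) with hb
  have hbsum : ∑' j, b j =
      ENNReal.ofReal C₀ ^ p * (∑' j : ℤ, c j * ENNReal.ofReal (2 ^ j) ^ (-p)) := ENNReal.tsum_mul_left
  have key : ∀ t, 0 < t → ENNReal.ofReal (C₀ * t) ^ p * μ {x | C₀ * t < ‖h x‖} ≤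
      ∑' j : ℤ, b j * ∫⁻ y, N y (2 ^ j * t) ∂m := by
    intro t ht
    refine (mul_le_mul_right (H t ht) _).trans ?_
    rw [← ENNReal.tsum_mul_left]
    refine ENNReal.tsum_le_tsum fun j => le_of_eq ?_
    have h2j : (0 : ℝ) < 2 ^ j := by positivity
    have e1 : ENNReal.ofReal (2 ^ j) ^ (-p) * ENNReal.ofReal (2 ^ j) ^ p = 1 := by
      rw [← ENNReal.rpow_add _ _ (by simpa using h2j) ENNReal.ofReal_ne_top]
      simp
    have hmj : Measurable fun y => ν {r | 2 ^ j * t < ‖F (r, y)‖} := by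
      have h1 : MeasurableSet {z : Y × R | 2 ^ j * t < ‖F (z.2, z.1)‖} :=
        measurableSet_lt measurable_const (hF.comp measurable_swap).norm
      exact measurable_measure_prodMk_left h1
    simp only [hN, hb]
    rw [lintegral_const_mul _ hmj, ENNReal.ofReal_mul hC₀.le, ENNReal.ofReal_mul h2j.le,
      ENNReal.mul_rpow_of_nonneg _ _ hp.le, ENNReal.mul_rpow_of_nonneg _ _ hp.le]
    set u := ENNReal.ofReal (2 ^ j) ^ p
    set v := ENNReal.ofReal (2 ^ j) ^ (-p)
    set I := ∫⁻ y, ν {r | 2 ^ j * t < ‖F (r, y)‖} ∂m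
    calc _ = ENNReal.ofReal C₀ ^ p * ENNReal.ofReal t ^ p * (c j * I) * (v * u) := by
          rw [e1, mul_one]
      _ = _ := by ring
  rw [← hbsum]
  rcases eq_or_ne q ∞ with rfl | hqt
  · rw [lorentzNorm_top_rpow_le_iff μ hp]
    intro t ht
    have ht' : 0 < t / C₀ := by positivity
    have := key _ ht'
    rw [mul_div_cancel₀ _ hC₀.ne'] at this
    refine this.trans ?_
    rw [← ENNReal.tsum_mul_right]
    refine ENNReal.tsum_le_tsum fun j => ?_
    gcongr with y
    exact (lorentzNorm_top_rpow_le_iff ν hp _ _).mp le_rfl _ (by positivity)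
  · set Q := q.toReal / p with hQ
    have hQ1 : 1 ≤ Q := by
      rw [hQ, one_le_div hp]
      exact (ENNReal.ofReal_le_iff_le_toReal hqt).mp hq
    have hQ0 : 0 < Q := by linarith
    simp only [lorentzNorm_rpow_eq _ hp hqt]
    rw [← lintegral_dilationMeasure_comp_mul _ hC₀]
    have hGm : ∀ j : ℤ, Measurable (Function.uncurry fun y t => N y (2 ^ j * t)) := fun j =>
      hNm.comp (f := fun z : Y × ℝ => (z.1, 2 ^ j * z.2)) (by fun_prop)
    have hIm : ∀ j : ℤ, Measurable fun t => ∫⁻ y, N y (2 ^ j * t) ∂m := fun j =>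
      ((hGm j).comp measurable_swap).lintegral_prod_right'
    calc _ ≤ (∫⁻ t, (∫⁻ j, b j * ∫⁻ y, N y (2 ^ j * t) ∂m ∂(Measure.count : Measure ℤ)) ^ Q
          ∂dilationMeasure) ^ (1 / Q) := by
          refine ENNReal.rpow_le_rpow ?_ (by positivity)
          refine lintegral_mono_ae ?_
          filter_upwards [ae_dilationMeasure_pos] with t ht
          refine ENNReal.rpow_le_rpow ?_ hQ0.le
          rw [lintegral_count]
          exact key t ht
      _ ≤ ∫⁻ j, (∫⁻ t, (b j * ∫⁻ y, N y (2 ^ j * t) ∂m) ^ Q ∂dilationMeasure) ^ (1 / Q)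
          ∂(Measure.count : Measure ℤ) := by
          refine lintegral_rpow_lintegral_le hQ1
            (G := fun (j : ℤ) t => b j * ∫⁻ y, N y (2 ^ j * t) ∂m) ?_
          exact measurable_from_prod_countable_right fun j => (hIm j).const_mul (b j)
      _ = ∑' j, b j * (∫⁻ t, (∫⁻ y, N y (2 ^ j * t) ∂m) ^ Q ∂dilationMeasure) ^ (1 / Q) := by
          rw [lintegral_count]
          congr 1
          ext j
          simp only [ENNReal.mul_rpow_of_nonneg _ _ hQ0.le]
          rw [lintegral_const_mul _ ((hIm j).pow_const Q),
            ENNReal.mul_rpow_of_nonneg _ _ (by positivity), ← ENNReal.rpow_mul,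
            mul_one_div_cancel hQ0.ne', ENNReal.rpow_one]
      _ ≤ ∑' j, b j * ∫⁻ y, (∫⁻ t, N y (2 ^ j * t) ^ Q ∂dilationMeasure) ^ (1 / Q) ∂m := by
          gcongr with j
          exact lintegral_rpow_lintegral_le hQ1 (hGm j)
      _ = ∑' j, b j * ∫⁻ y, (∫⁻ t, N y t ^ Q ∂dilationMeasure) ^ (1 / Q) ∂m := by
          congr 1
          ext j
          congr 2
          ext y
          rw [lintegral_dilationMeasure_comp_mul (fun t => N y t ^ Q) (by positivity)]
      _ = _ := ENNReal.tsum_mul_right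

/-- The weak-type bound implied by finiteness of a Lorentz norm. -/
lemma exists_le_lorentzNorm_rpow (hp : 0 < p) (hq : ENNReal.ofReal p ≤ q) :
    ∃ C : ℝ≥0∞, C ≠ ∞ ∧ ∀ (μ : Measure X) (f : X → E) (t : ℝ), 0 < t →
      ENNReal.ofReal t ^ p * μ {x | t < ‖f x‖} ≤ C * lorentzNorm μ p q f ^ p := by
  rcases eq_or_ne q ∞ with rfl | hqt
  · refine ⟨1, ENNReal.one_ne_top, fun μ f t ht => ?_⟩
    rw [one_mul]
    exact (lorentzNorm_top_rpow_le_iff μ hp f _).mp le_rfl t ht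
  · set Q := q.toReal / p with hQ
    have hQ1 : 1 ≤ Q := by
      rw [hQ, one_le_div hp]
      exact (ENNReal.ofReal_le_iff_le_toReal hqt).mp hq
    have hQ0 : 0 < Q := by linarith
    set B := ENNReal.ofReal 2 ^ p * 2 ^ (1 / Q) with hB
    refine ⟨B, ENNReal.mul_ne_top (ENNReal.rpow_ne_top_of_nonneg hp.le ENNReal.ofReal_ne_top)
      (ENNReal.rpow_ne_top_of_nonneg (by positivity) ENNReal.ofNat_ne_top), fun μ f t ht => ?_⟩
    rw [lorentzNorm_rpow_eq _ hp hqt]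
    set m := μ {x | t < ‖f x‖} with hm
    set V := ENNReal.ofReal (t / 2) ^ p * m with hV
    have h1 : V ^ Q / 2 ≤
        ∫⁻ t, (ENNReal.ofReal t ^ p * μ {x | t < ‖f x‖}) ^ Q ∂dilationMeasure := by
      rw [lintegral_dilationMeasure]
      calc V ^ Q / 2 = ∫⁻ s in Ioo (t / 2) t, V ^ Q / ENNReal.ofReal t := by
            rw [setLIntegral_const, Real.volume_Ioo, show t - t / 2 = t / 2 by ring,
              ENNReal.ofReal_div_of_pos two_pos, ENNReal.ofReal_ofNat]
            have h0 : ENNReal.ofReal t ≠ 0 := by simpa using ht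
            rw [div_eq_mul_inv, div_eq_mul_inv, div_eq_mul_inv, mul_assoc,
              ← mul_assoc (ENNReal.ofReal t)⁻¹, ENNReal.inv_mul_cancel h0 ENNReal.ofReal_ne_top,
              one_mul]
        _ ≤ ∫⁻ s in Ioo (t / 2) t,
            (ENNReal.ofReal s ^ p * μ {x | s < ‖f x‖}) ^ Q / ENNReal.ofReal s := by
            refine setLIntegral_mono' measurableSet_Ioo fun s hs => ?_
            have h2 : m ≤ μ {x | s < ‖f x‖} := measure_mono fun x hx => hs.2.trans hx
            have h3 : V ≤ ENNReal.ofReal s ^ p * μ {x | s < ‖f x‖} := by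
              rw [hV]
              gcongr
              exact hs.1.le
            gcongr
            exact hs.2.le
        _ ≤ _ := lintegral_mono_set fun s hs => (half_pos ht).trans hs.1
    have h2 : ENNReal.ofReal t ^ p * m = ENNReal.ofReal 2 ^ p * V := by
      rw [hV, ← mul_assoc, ← ENNReal.mul_rpow_of_nonneg _ _ hp.le,
        ← ENNReal.ofReal_mul two_pos.le]
      congr 3; ring
    rw [h2, hB, mul_assoc]
    gcongr
    rw [← ENNReal.mul_rpow_of_nonneg _ _ (by positivity), one_div, ENNReal.le_rpow_inv_iff hQ0]
    refine le_trans (le_of_eq ?_) (mul_le_mul_right h1 2)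
    rw [ENNReal.mul_div_cancel two_ne_zero ENNReal.ofNat_ne_top]

end lorentz

section absconv
variable {d : ℕ} {D : ℝ → Rd d → ℝ} {L : ℝ} {k : ℝ → Rd d → ℂ}

/-- The measure `(1+|r|)^{d-1} dr dy`. -/
def shellMeas (d : ℕ) : Measure (ℝ × Rd d) :=
  volume.withDensity fun P => ENNReal.ofReal ((1 + |P.1|) ^ (d - 1))

lemma shellMeas_apply {A : Set (ℝ × Rd d)} (hA : MeasurableSet A) :
    shellMeas d A = shellMass A := withDensity_apply _ hA

lemma lintegral_shellMeas (g : ℝ × Rd d → ℝ≥0∞) :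
    ∫⁻ P, g P ∂shellMeas d = ∫⁻ P, ENNReal.ofReal ((1 + |P.1|) ^ (d - 1)) * g P :=
  lintegral_withDensity_eq_lintegral_mul_non_measurable _ (by fun_prop)
    (ae_of_all _ fun _ => ENNReal.ofReal_lt_top) _

/-- The quotient of `‖f‖` by `(1+|r|)^{(d-1)/2}`. -/
def normQuot (f : ℝ × Rd d → ℂ) (P : ℝ × Rd d) : ℝ := ‖f P‖ / √(1 + |P.1|) ^ (d - 1)

lemma lt_normQuot_iff {f : ℝ × Rd d → ℂ} {t : ℝ} {P : ℝ × Rd d} :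
    t < normQuot f P ↔ P ∈ superLevel f t := lt_div_iff₀ (by positivity)

lemma measurable_normQuot {f : ℝ × Rd d → ℂ} (hf : Measurable f) : Measurable (normQuot f) :=
  hf.norm.div (by fun_prop)

lemma normQuot_nonneg (f : ℝ × Rd d → ℂ) (P : ℝ × Rd d) : 0 ≤ normQuot f P := by
  unfold normQuot; positivity

lemma shellMass_superLevel_le {f : ℝ × Rd d → ℂ} {p : ℝ} {B : ℝ≥0∞}
    (h : ∀ t, 0 < t → ENNReal.ofReal t ^ p * shellMass (superLevel f t) ≤ B) {t : ℝ} (ht : 0 < t) :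
    shellMass (superLevel f t) ≤ B * ENNReal.ofReal (t ^ (-p)) := by
  have h0 : ENNReal.ofReal t ≠ 0 := by simpa using ht
  have e1 : ENNReal.ofReal (t ^ (-p)) * ENNReal.ofReal t ^ p = 1 := by
    rw [← ENNReal.ofReal_rpow_of_pos ht, ← ENNReal.rpow_add _ _ h0 ENNReal.ofReal_ne_top]
    simp
  calc _ = ENNReal.ofReal (t ^ (-p)) * (ENNReal.ofReal t ^ p * shellMass (superLevel f t)) := by
        rw [← mul_assoc, e1, one_mul]
    _ ≤ _ := by rw [mul_comm B]; gcongr; exact h t ht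

lemma lintegral_normQuot_high_lt_top {f : ℝ × Rd d → ℂ} (hf : Measurable f) {p : ℝ} (hp : 1 < p)
    {B : ℝ≥0∞} (hB : B ≠ ∞)
    (h : ∀ t, 0 < t → ENNReal.ofReal t ^ p * shellMass (superLevel f t) ≤ B) :
    ∫⁻ P, ENNReal.ofReal ((superLevel f 1).indicator (normQuot f) P) ∂shellMeas d < ∞ := by
  have hm : Measurable ((superLevel f 1).indicator (normQuot f)) :=
    (measurable_normQuot hf).indicator (measurableSet_superLevel hf 1)
  have h1 := lintegral_rpow_eq_lintegral_meas_lt_mul (shellMeas d)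
    (ae_of_all _ fun P => indicator_nonneg (fun P _ => normQuot_nonneg f P) P) hm.aemeasurable
    one_pos
  simp only [Real.rpow_one, sub_self, Real.rpow_zero, ENNReal.ofReal_one, mul_one, one_mul] at h1
  rw [h1]
  have hle : ∀ t : ℝ, 0 < t → shellMeas d {P | t < (superLevel f 1).indicator (normQuot f) P} ≤
      shellMass (superLevel f (max t 1)) := by
    intro t ht
    rw [← shellMeas_apply (measurableSet_superLevel hf _)]
    refine measure_mono fun P hP => ?_
    have hP : t < (superLevel f 1).indicator (normQuot f) P := hP
    by_cases h1 : P ∈ superLevel f 1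
    · rw [indicator_of_mem h1] at hP
      exact lt_normQuot_iff.mp (max_lt hP (lt_normQuot_iff.mpr h1))
    · rw [indicator_of_notMem h1] at hP
      linarith
  rw [← Ioc_union_Ioi_eq_Ioi (zero_le_one' ℝ), lintegral_union measurableSet_Ioi
    (Ioc_disjoint_Ioi le_rfl)]
  refine ENNReal.add_lt_top.mpr ⟨?_, ?_⟩
  · calc _ ≤ ∫⁻ t in Ioc (0 : ℝ) 1, B := by
          refine setLIntegral_mono' measurableSet_Ioc fun t ht => (hle t ht.1).trans ?_
          rw [max_eq_right ht.2]
          simpa using shellMass_superLevel_le h one_pos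
      _ < ∞ := by
          rw [setLIntegral_const]
          exact ENNReal.mul_lt_top hB.lt_top (by simp)
  · calc _ ≤ ∫⁻ t in Ioi (1 : ℝ), B * ENNReal.ofReal (t ^ (-p)) := by
          refine setLIntegral_mono' measurableSet_Ioi fun t ht => ?_
          have ht : 1 < t := ht
          refine (hle t (by linarith)).trans ?_
          rw [max_eq_left ht.le]
          exact shellMass_superLevel_le h (by linarith)
      _ = B * ∫⁻ t in Ioi (1 : ℝ), ENNReal.ofReal (t ^ (-p)) := by
          rw [lintegral_const_mul]; fun_prop
      _ < ∞ := by
          refine ENNReal.mul_lt_top hB.lt_top ?_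
          exact (integrableOn_Ioi_rpow_of_lt (by linarith) one_pos).lintegral_lt_top

lemma lintegral_normQuot_low_lt_top {f : ℝ × Rd d → ℂ} (hf : Measurable f) {p e : ℝ} (he0 : 0 < e)
    (hpe : p < e) {B : ℝ≥0∞} (hB : B ≠ ∞)
    (h : ∀ t, 0 < t → ENNReal.ofReal t ^ p * shellMass (superLevel f t) ≤ B) :
    ∫⁻ P, ENNReal.ofReal ((superLevel f 1)ᶜ.indicator (normQuot f) P ^ e) ∂shellMeas d < ∞ := by
  have hm : Measurable ((superLevel f 1)ᶜ.indicator (normQuot f)) :=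
    (measurable_normQuot hf).indicator (measurableSet_superLevel hf 1).compl
  rw [lintegral_rpow_eq_lintegral_meas_lt_mul (shellMeas d)
    (ae_of_all _ fun P => indicator_nonneg (fun P _ => normQuot_nonneg f P) P) hm.aemeasurable
    he0]
  refine ENNReal.mul_lt_top ENNReal.ofReal_lt_top ?_
  rw [← Ioc_union_Ioi_eq_Ioi (zero_le_one' ℝ), lintegral_union measurableSet_Ioi
    (Ioc_disjoint_Ioi le_rfl)]
  refine ENNReal.add_lt_top.mpr ⟨?_, ?_⟩
  · calc _ ≤ ∫⁻ t in Ioc (0 : ℝ) 1, B * ENNReal.ofReal (t ^ (e - p - 1)) := by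
          refine setLIntegral_mono' measurableSet_Ioc fun t ht => ?_
          rw [show e - p - 1 = -p + (e - 1) by ring, Real.rpow_add ht.1,
            ENNReal.ofReal_mul (by have := ht.1; positivity), ← mul_assoc]
          gcongr
          refine le_trans ?_ (shellMass_superLevel_le h ht.1)
          rw [← shellMeas_apply (measurableSet_superLevel hf _)]
          refine measure_mono fun P hP => ?_
          have hP : t < (superLevel f 1)ᶜ.indicator (normQuot f) P := hP
          exact lt_normQuot_iff.mp
            (hP.trans_le (indicator_le_self' (fun P _ => normQuot_nonneg f P) P))
      _ = B * ∫⁻ t in Ioc (0 : ℝ) 1, ENNReal.ofReal (t ^ (e - p - 1)) := by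
          rw [lintegral_const_mul]; fun_prop
      _ < ∞ := by
          refine ENNReal.mul_lt_top hB.lt_top ?_
          have := (intervalIntegral.intervalIntegrable_rpow' (a := 0) (b := 1)
            (r := e - p - 1) (by linarith)).1
          exact this.lintegral_lt_top
  · refine lt_of_le_of_lt (le_of_eq ?_) ENNReal.zero_lt_top
    refine setLIntegral_eq_zero measurableSet_Ioi fun t ht => ?_
    have ht : 1 < t := ht
    have : {P | t < (superLevel f 1)ᶜ.indicator (normQuot f) P} = ∅ := by
      ext P
      simp only [mem_ofPred_eq, mem_empty_iff_false, iff_false, not_lt]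
      by_cases hP : P ∈ superLevel f 1
      · rw [indicator_of_notMem (by simpa using hP)]; linarith
      · rw [indicator_of_mem (by simpa using hP)]
        have := mt lt_normQuot_iff.mp hP
        linarith
    simp [this]

lemma IsDispKer.lintegral_rpow_lt_top (hd : 2 ≤ d) (hD : IsConeDist D L) (hk : IsDispKer D k)
    {s : ℝ} (hs1 : 1 ≤ s) (hs : 1 < ((d : ℝ) - 1) * (s - 2)) (x : Rd d) :
    ∫⁻ P, ENNReal.ofReal ((‖k P.1 (x - P.2)‖ / √(1 + |P.1|) ^ (d - 1)) ^ s) ∂shellMeas d < ∞ := by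
  obtain ⟨C, hC, hdec⟩ := hk.decay (d + 1)
  have hk1 : Measurable fun P : ℝ × Rd d => k P.1 (x - P.2) :=
    hk.measurable.comp (f := fun P : ℝ × Rd d => ((P.1, x - P.2) : ℝ × Rd d)) (by fun_prop)
  have hmeas : Measurable fun P : ℝ × Rd d => ENNReal.ofReal ((1 + |P.1|) ^ (d - 1)) *
      ENNReal.ofReal ((‖k P.1 (x - P.2)‖ / √(1 + |P.1|) ^ (d - 1)) ^ s) := by
    have h1 : Measurable fun P : ℝ × Rd d => ‖k P.1 (x - P.2)‖ / √(1 + |P.1|) ^ (d - 1) :=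
      hk1.norm.div (by fun_prop)
    exact (by fun_prop : Measurable fun P : ℝ × Rd d => ENNReal.ofReal ((1 + |P.1|) ^ (d - 1))).mul
      (h1.pow_const s).ennreal_ofReal
  rw [lintegral_shellMeas, Measure.volume_eq_prod, lintegral_prod _ hmeas.aemeasurable]
  set n : ℝ := (d : ℝ) - 1 with hn
  set C' := C ^ s * (2 ^ (d + 1) * L) with hC'
  have hL := hD.one_le
  have hr : ∀ r : ℝ, ∫⁻ y : Rd d, ENNReal.ofReal ((1 + |r|) ^ (d - 1)) *
      ENNReal.ofReal ((‖k r (x - y)‖ / √(1 + |r|) ^ (d - 1)) ^ s) ≤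
      ENNReal.ofReal C' * ENNReal.ofReal ((1 + ‖r‖) ^ (-(n * (s - 2)))) := by
    intro r
    set w := 1 + |r| with hw
    have hw0 : 0 < w := by positivity
    have hWn : √w ^ (d - 1) * √w ^ (d - 1) = w ^ n := by
      rw [sqrt_pow_mul_self hw0.le, ← Real.rpow_natCast]
      congr 1
      rw [hn, Nat.cast_sub (by omega)]; norm_num
    have hwn : w ^ (d - 1) = w ^ n := by rw [← hWn, sqrt_pow_mul_self hw0.le]
    have hpt : ∀ z : Rd d, w ^ (d - 1) * (‖k r z‖ / √w ^ (d - 1)) ^ s ≤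
        C ^ s * w ^ (n - n * s) * (1 / (1 + D r z / 1) ^ (d + 1)) := by
      intro z
      have hD0 := hD.nonneg r z
      have h1 : ‖k r z‖ / √w ^ (d - 1) ≤ C * (w ^ n)⁻¹ * (1 / (1 + D r z) ^ (d + 1)) := by
        rw [← hWn]
        calc _ ≤ C / (√w ^ (d - 1) * (1 + D r z) ^ (d + 1)) / √w ^ (d - 1) := by
              gcongr; exact hdec r z
          _ = _ := by field_simp
      have h2 : (1 / (1 + D r z) ^ (d + 1)) ^ s ≤ 1 / (1 + D r z) ^ (d + 1) :=
        Real.rpow_le_self_of_le_one (by positivity)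
          (div_le_one_of_le₀ (one_le_pow₀ (by linarith)) (by positivity)) hs1
      calc _ ≤ w ^ n * (C * (w ^ n)⁻¹ * (1 / (1 + D r z) ^ (d + 1))) ^ s := by
            rw [hwn]; gcongr
        _ = C ^ s * (w ^ n * w ^ (-(n * s))) * (1 / (1 + D r z) ^ (d + 1)) ^ s := by
            rw [Real.mul_rpow (by positivity) (by positivity), Real.mul_rpow hC.le (by positivity),
              ← Real.rpow_neg hw0.le, ← Real.rpow_mul hw0.le]
            ring_nf
        _ ≤ _ := by
            rw [← Real.rpow_add hw0, ← sub_eq_add_neg, div_one]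
            gcongr
    calc _ ≤ ∫⁻ y : Rd d, ENNReal.ofReal (C ^ s * w ^ (n - n * s)) *
          ENNReal.ofReal (1 / (1 + D r (x - y) / 1) ^ (d + 1)) := by
          refine lintegral_mono fun y => ?_
          rw [← ENNReal.ofReal_mul (by positivity), ← ENNReal.ofReal_mul (by positivity)]
          exact ENNReal.ofReal_le_ofReal (hpt _)
      _ = ENNReal.ofReal (C ^ s * w ^ (n - n * s)) *
          ∫⁻ y : Rd d, ENNReal.ofReal (1 / (1 + D r y / 1) ^ (d + 1)) := by
          rw [lintegral_const_mul' _ _ ENNReal.ofReal_ne_top,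
            lintegral_sub_left_eq_self (fun y => ENNReal.ofReal (1 / (1 + D r y / 1) ^ (d + 1))) x]
      _ ≤ ENNReal.ofReal (C ^ s * w ^ (n - n * s)) *
          ENNReal.ofReal (2 ^ (d + 1) * L * (1 * (1 + |r|) ^ (d - 1))) := by
          gcongr
          exact hD.lintegral_le (by omega) r one_pos
      _ = _ := by
          rw [← ENNReal.ofReal_mul (by positivity), ← ENNReal.ofReal_mul (by positivity)]
          congr 1
          rw [← hw, hwn, Real.norm_eq_abs, ← hw, hC',
            show -(n * (s - 2)) = (n - n * s) + n by ring, Real.rpow_add hw0]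
          ring
  refine (lintegral_mono hr).trans_lt ?_
  rw [lintegral_const_mul' _ _ ENNReal.ofReal_ne_top]
  refine ENNReal.mul_lt_top ENNReal.ofReal_lt_top ?_
  exact (integrable_one_add_norm (E := ℝ) (μ := volume) (by simpa using hs)).lintegral_lt_top

lemma IsDispKer.ae_integrable_of_weak (hd : 4 ≤ d) (hD : IsConeDist D L) (hk : IsDispKer D k)
    {f : ℝ × Rd d → ℂ} (hf : Measurable f) {p : ℝ} (hp1 : 1 < p)
    (hp2 : p < 2 * ((d : ℝ) - 1) / ((d : ℝ) + 1)) {B : ℝ≥0∞} (hB : B ≠ ∞)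
    (h : ∀ t, 0 < t → ENNReal.ofReal t ^ p * shellMass (superLevel f t) ≤ B) :
    ∀ᵐ x, Integrable fun P : ℝ × Rd d => k P.1 (x - P.2) * f P := by
  have hd' : (4 : ℝ) ≤ d := by exact_mod_cast hd
  set S := superLevel f 1 with hS
  have hSm : MeasurableSet S := measurableSet_superLevel hf 1
  have hW : ∀ P : ℝ × Rd d, 0 < √(1 + |P.1|) ^ (d - 1) := fun P => by positivity
  have hfq : ∀ P : ℝ × Rd d, ‖f P‖ = √(1 + |P.1|) ^ (d - 1) * normQuot f P := fun P => by
    rw [normQuot, mul_div_cancel₀ _ (hW P).ne']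
  have hhigh : ∫⁻ P : ℝ × Rd d, ENNReal.ofReal (√(1 + |P.1|) ^ (d - 1)) * ‖S.indicator f P‖ₑ < ∞ := by
    refine lt_of_le_of_lt (le_of_eq ?_) (lintegral_normQuot_high_lt_top hf hp1 hB h)
    rw [lintegral_shellMeas]
    congr 1
    ext P
    by_cases hP : P ∈ S
    · rw [indicator_of_mem hP, indicator_of_mem hP, ← ofReal_norm, hfq P,
        ← sqrt_pow_mul_self (by positivity : 0 ≤ 1 + |P.1|), ← ENNReal.ofReal_mul (hW P).le,
        ← ENNReal.ofReal_mul (mul_pos (hW P) (hW P)).le, mul_assoc]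
    · rw [indicator_of_notMem hP, indicator_of_notMem hP]
      simp
  filter_upwards [hk.ae_integrable (by omega) hD (hf.indicator hSm) hhigh] with x hx
  set e := 2 * ((d : ℝ) - 1) / ((d : ℝ) + 1) with he
  have he1 : 1 < e := by linarith
  have hconj := Real.HolderConjugate.conjExponent he1
  set s := e.conjExponent with hs
  have hse : s = 2 * ((d : ℝ) - 1) / ((d : ℝ) - 3) := by
    rw [hs, Real.conjExponent, he]
    have h1 : (d : ℝ) - 3 ≠ 0 := by linarith
    have h2 : (d : ℝ) + 1 ≠ 0 := by linarith
    have h3 : 2 * ((d : ℝ) - 1) / ((d : ℝ) + 1) - 1 = ((d : ℝ) - 3) / ((d : ℝ) + 1) := by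
      field_simp; ring
    rw [h3]
    field_simp
  have hs2 : 1 < ((d : ℝ) - 1) * (s - 2) := by
    have h1 : 0 < (d : ℝ) - 3 := by linarith
    have h3 : s - 2 = 4 / ((d : ℝ) - 3) := by rw [hse]; field_simp; ring
    rw [h3, ← mul_div_assoc, one_lt_div h1]
    linarith
  have hlow : Integrable fun P : ℝ × Rd d => k P.1 (x - P.2) * Sᶜ.indicator f P := by
    refine ⟨((hk.measurable_integrand (hf.indicator hSm.compl)).of_uncurry_left
      (x := x)).aestronglyMeasurable, ?_⟩
    have h1 := lintegral_normQuot_low_lt_top hf (by linarith) hp2 hB h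
    have h2 := hk.lintegral_rpow_lt_top (by omega) hD hconj.symm.lt.le hs2 x
    refine lt_of_le_of_lt ?_ (ENNReal.add_lt_top.mpr ⟨h1, h2⟩)
    have hm1 : Measurable fun P => ENNReal.ofReal (Sᶜ.indicator (normQuot f) P ^ e) :=
      (((measurable_normQuot hf).indicator hSm.compl).pow_const e).ennreal_ofReal
    rw [← lintegral_add_left hm1, lintegral_shellMeas]
    refine lintegral_mono fun P => ?_
    by_cases hP : P ∈ Sᶜ
    · have hw0 : 0 ≤ 1 + |P.1| := by positivity
      have hq0 := normQuot_nonneg f P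
      simp only [indicator_of_mem hP]
      rw [← ENNReal.ofReal_add (by positivity) (by positivity),
        ← ENNReal.ofReal_mul (by positivity), ← ofReal_norm, norm_mul, hfq P]
      apply ENNReal.ofReal_le_ofReal
      have hy := Real.young_inequality_of_nonneg hq0
        (by positivity : 0 ≤ ‖k P.1 (x - P.2)‖ / √(1 + |P.1|) ^ (d - 1)) hconj
      have hs0 := hconj.symm.lt
      have h5 : normQuot f P ^ e / e ≤ normQuot f P ^ e :=
        div_le_self (by positivity) he1.le
      have h6 : (‖k P.1 (x - P.2)‖ / √(1 + |P.1|) ^ (d - 1)) ^ s / s ≤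
          (‖k P.1 (x - P.2)‖ / √(1 + |P.1|) ^ (d - 1)) ^ s :=
        div_le_self (by positivity) hs0.le
      calc _ = (1 + |P.1|) ^ (d - 1) *
            (normQuot f P * (‖k P.1 (x - P.2)‖ / √(1 + |P.1|) ^ (d - 1))) := by
            rw [← sqrt_pow_mul_self hw0]
            have := (hW P).ne'
            field_simp
        _ ≤ _ := by
            gcongr
            linarith
    · simp [indicator_of_notMem hP]
  refine (hx.add hlow).congr (ae_of_all _ fun P => ?_)
  simp only [Pi.add_apply]
  rw [← mul_add, indicator_self_add_compl_apply]

end absconv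

section assembly
variable {d : ℕ}

instance : SFinite (nuMeas d) := by unfold nuMeas; infer_instance

/-- The quotient of `f` by `(1+|r|)^{(d-1)/2}`. -/
def weightQuot (f : ℝ × Rd d → ℂ) (P : ℝ × Rd d) : ℂ :=
  f P / (((1 + |P.1|) ^ (((d : ℝ) - 1) / 2) : ℝ) : ℂ)

lemma measurable_weightQuot {f : ℝ × Rd d → ℂ} (hf : Measurable f) : Measurable (weightQuot f) :=
  hf.div (Complex.measurable_ofReal.comp (by fun_prop))

lemma rpow_half_eq_sqrt_pow (hd : 1 ≤ d) {w : ℝ} (hw : 0 ≤ w) :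
    w ^ (((d : ℝ) - 1) / 2) = √w ^ (d - 1) := by
  rw [Real.sqrt_eq_rpow, ← Real.rpow_natCast, ← Real.rpow_mul hw, Nat.cast_sub hd]
  congr 1
  push_cast
  ring

lemma lt_norm_weightQuot_iff (hd : 1 ≤ d) {f : ℝ × Rd d → ℂ} {t : ℝ} {P : ℝ × Rd d} :
    t < ‖weightQuot f P‖ ↔ P ∈ superLevel f t := by
  rw [weightQuot, rpow_half_eq_sqrt_pow hd (by positivity), norm_div, Complex.norm_real,
    Real.norm_of_nonneg (by positivity)]
  exact lt_div_iff₀ (by positivity)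

lemma shellMass_superLevel (hd : 1 ≤ d) {f : ℝ × Rd d → ℂ} (hf : Measurable f) (t : ℝ) :
    shellMass (superLevel f t) = ∫⁻ y, nuMeas d {r | t < ‖weightQuot f (r, y)‖} := by
  have hS := measurableSet_superLevel hf t
  have hw : Measurable fun P : ℝ × Rd d => ENNReal.ofReal ((1 + |P.1|) ^ (d - 1)) := by fun_prop
  rw [shellMass, ← lintegral_indicator hS, Measure.volume_eq_prod,
    lintegral_prod_symm' _ (hw.indicator hS)]
  refine lintegral_congr fun y => ?_
  have hm : MeasurableSet {r : ℝ | (r, y) ∈ superLevel f t} := measurable_prodMk_right hS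
  have he : {r | t < ‖weightQuot f (r, y)‖} = {r : ℝ | (r, y) ∈ superLevel f t} := by
    ext r
    exact lt_norm_weightQuot_iff hd
  rw [he, nuMeas, withDensity_apply _ hm, ← lintegral_indicator hm]
  rfl

lemma superpos_eq_integral_conv {k : ℝ → Rd d → ℂ} {f : ℝ × Rd d → ℂ} {x : Rd d}
    (h : Integrable fun P : ℝ × Rd d => k P.1 (x - P.2) * f P) :
    superpos k f x = ∫ r : ℝ, conv (k r) (fun y => f (r, y)) x := by
  rw [Measure.volume_eq_prod] at h
  rw [superpos, Measure.volume_eq_prod, integral_prod _ h]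
  rfl

end assembly

/-- the Lorentz space version of the model inequality (Proposition 4.1):
`‖∫ K_r ∗ f(r,·) dr‖_{L^{p,q}}^p ≲ ∫ ‖f(·,y)/(1+|·|)^{(d-1)/2}‖_{L^{p,q}(ν_d)}^p dy`. -/
theorem statement16 (d : ℕ) (hd : 4 ≤ d) (a : Rd d → ℝ) (ha : IsDistFn a)
    (hcurv : CurvNondeg a) (η : ℝ → ℝ) (hη : IsBump η)
    (p : ℝ) (hp1 : 1 < p) (hp2 : p < 2 * ((d : ℝ) - 1) / ((d : ℝ) + 1))
    (q : ℝ≥0∞) (hq : ENNReal.ofReal p ≤ q) :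
    ∃ C : ℝ, 0 < C ∧ ∀ f : ℝ × Rd d → ℂ, Measurable f →
      lorentzNorm volume p q
          (fun x : Rd d => ∫ r : ℝ, conv (Kker a η r) (fun y => f (r, y)) x) ^ p ≤
        ENNReal.ofReal C *
          ∫⁻ y : Rd d,
            lorentzNorm (nuMeas d) p q
              (fun r : ℝ => f (r, y) / (((1 + |r|) ^ (((d : ℝ) - 1) / 2) : ℝ) : ℂ)) ^ p
            ∂volume := by
  have hp : 0 < p := by linarith
  have hd1 : 1 ≤ d := by omega
  obtain ⟨m, M, hu⟩ := hη.isAmp hd1 ha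
  obtain ⟨L, hD⟩ := isConeDist_phDist hd1 ha
  have hk := isDispKer_oscKer hd1 ha hcurv hu
  obtain ⟨C₀, hC₀, c, hc, hmain⟩ := hk.volume_superpos_le_tsum hd hD
    (isDispKer_oscKer hd1 ha hcurv hu.sq) (integral_oscKer_mul_conj ha hu) hp1 hp2
  set A := ENNReal.ofReal C₀ ^ p * ∑' j : ℤ, c j * ENNReal.ofReal (2 ^ j) ^ (-p) with hA
  have hAt : A ≠ ∞ :=
    ENNReal.mul_ne_top (ENNReal.rpow_ne_top_of_nonneg hp.le ENNReal.ofReal_ne_top) hc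
  refine ⟨A.toReal + 1, by positivity, fun f hf => ?_⟩
  change _ ≤ _ * ∫⁻ y, lorentzNorm (nuMeas d) p q (fun r => weightQuot f (r, y)) ^ p
  set I := ∫⁻ y, lorentzNorm (nuMeas d) p q (fun r => weightQuot f (r, y)) ^ p with hI
  rcases eq_or_ne I ∞ with hIt | hIt
  · rw [hIt, ENNReal.mul_top (ENNReal.ofReal_pos.mpr (by positivity)).ne']
    exact le_top
  obtain ⟨C₁, hC₁, hweak⟩ := exists_le_lorentzNorm_rpow (X := ℝ) (E := ℂ) hp hq
  have hB : ∀ t, 0 < t → ENNReal.ofReal t ^ p * shellMass (superLevel f t) ≤ C₁ * I := by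
    intro t ht
    rw [shellMass_superLevel hd1 hf, hI, ← lintegral_const_mul' _ _ hC₁,
      ← lintegral_const_mul' _ _ (ENNReal.rpow_ne_top_of_nonneg hp.le ENNReal.ofReal_ne_top)]
    exact lintegral_mono fun y => hweak _ _ t ht
  have hBt : C₁ * I ≠ ∞ := ENNReal.mul_ne_top hC₁ hIt
  have hint := hk.ae_integrable_of_weak hd hD hf hp1 hp2 hBt hB
  have hfin : ∀ t, 0 < t → shellMass (superLevel f t) < ∞ := fun t ht =>
    (shellMass_superLevel_le hB ht).trans_lt (ENNReal.mul_lt_top hBt.lt_top ENNReal.ofReal_lt_top)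
  have hkey := lorentzNorm_rpow_le (μ := volume) (m := volume) (c := c)
    (h := fun x : Rd d => ∫ r : ℝ, conv (Kker a η r) (fun y => f (r, y)) x) hp hq hC₀
    (ν := nuMeas d) (measurable_weightQuot hf) fun t ht => by
      simp only [← shellMass_superLevel hd1 hf]
      refine le_trans (measure_mono_ae ?_) (hmain f hf hfin hint t ht)
      filter_upwards [hint] with x hx h
      change C₀ * t < ‖superpos _ f x‖
      rw [superpos_eq_integral_conv hx]
      exact h
  refine hkey.trans ?_
  gcongr
  exact (ENNReal.ofReal_toReal hAt).symm.le.trans (ENNReal.ofReal_le_ofReal (by simp))
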